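/- arXiv:2112.10533 — 3 statements merged into one kernel-verified Lean document; each statement's English description precedes it below -/
import Mathlib

section
/- If f ∈ ℝ[x,y,z] is a smooth psd ternary quartic, then the Gram spectrahedron Gram(f) contains exactly eight matrices of rank 3; equivalently, f has exactly eight representations as a sum of three squares of real quadratic forms up to orthogonal equivalence. -/
open MvPolynomial Matrix

/-- The monomial basis `x², y², z², xy, xz, yz` of `ℝ[x,y,z]₂`. -/
noncomputable def gramBasis : Fin 6 → MvPolynomial (Fin 3) ℝ :=
  ![X 0 ^ 2, X 1 ^ 2, X 2 ^ 2, X 0 * X 1, X 0 * X 2, X 1 * X 2]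

/-- The Gram spectrahedron of `f`: all real symmetric psd `6×6` matrices `G` with
`Σᵢⱼ gᵢⱼ·mᵢ·mⱼ = f` for the monomial basis `m` of `ℝ[x,y,z]₂`. -/
noncomputable def GramSpectrahedron (f : MvPolynomial (Fin 3) ℝ) :
    Set (Matrix (Fin 6) (Fin 6) ℝ) :=
  {G | G.PosSemidef ∧
    (∑ i, ∑ j, MvPolynomial.C (G i j) * (gramBasis i * gramBasis j)) = f}

/-- `f` is smooth: no nonzero complex point at which all partial derivatives of the
complexification of `f` vanish. -/
def IsSmooth (f : MvPolynomial (Fin 3) ℝ) : Prop :=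
  ∀ a : Fin 3 → ℂ,
    (∀ i, eval a (pderiv i (map (algebraMap ℝ ℂ) f)) = 0) → a = 0

/-- `f` is positive semidefinite on `ℝ³`. -/
def IsPsd (f : MvPolynomial (Fin 3) ℝ) : Prop :=
  ∀ a : Fin 3 → ℝ, 0 ≤ eval a f

namespace TQ

lemma radical_eq_of_no_zero (s : Set (MvPolynomial (Fin 3) ℂ))
    (h0 : ∀ p ∈ s, eval 0 p = 0)
    (h : ∀ a : Fin 3 → ℂ, (∀ p ∈ s, eval a p = 0) → a = 0) :
    (Ideal.span s).radical = vanishingIdeal ℂ {(0 : Fin 3 → ℂ)} := by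
  rw [← vanishingIdeal_zeroLocus_eq_radical (K := ℂ)]
  congr 1
  rw [zeroLocus_span]
  ext a
  simp only [Set.mem_ofPred_eq, Set.mem_singleton_iff]
  constructor
  · intro ha
    exact h a (fun p hp => by simpa [aeval_eq_eval] using ha p hp)
  · rintro rfl p hp
    simpa [aeval_eq_eval] using h0 p hp

lemma mem_max_iff (p : MvPolynomial (Fin 3) ℂ) :
    p ∈ vanishingIdeal ℂ {(0 : Fin 3 → ℂ)} ↔ eval 0 p = 0 := by
  rw [mem_vanishingIdeal_singleton_iff]; simp

instance max_isMax : (vanishingIdeal ℂ {(0 : Fin 3 → ℂ)}).IsMaximal :=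
  isMaximal_iff_eq_vanishingIdeal_singleton.2 ⟨0, rfl⟩

lemma isPrime_sub (s : Finset (Fin 3)) :
    (RingHom.ker (aeval (fun i => if i ∈ s then 0 else X i) :
      MvPolynomial (Fin 3) ℂ →ₐ[ℂ] MvPolynomial (Fin 3) ℂ)).IsPrime :=
  RingHom.ker_isPrime _

lemma three_le_height : 3 ≤ (vanishingIdeal ℂ {(0 : Fin 3 → ℂ)}).height := by
  let φ (s : Finset (Fin 3)) : MvPolynomial (Fin 3) ℂ →ₐ[ℂ] MvPolynomial (Fin 3) ℂ :=
    aeval (fun i => if i ∈ s then 0 else X i)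
  let P (s : Finset (Fin 3)) : Ideal (MvPolynomial (Fin 3) ℂ) := RingHom.ker (φ s)
  have hP (s) : (P s).IsPrime := RingHom.ker_isPrime _
  have hle : ∀ s t : Finset (Fin 3), s ⊆ t → P s ≤ P t := by
    intro s t hst p hp
    have : (φ t).comp (φ s) = φ t := by
      ext i
      by_cases hs : i ∈ s
      · simp [φ, hs, hst hs]
      · simp [φ, hs]
    simp only [P, RingHom.mem_ker] at hp ⊢
    rw [← this, AlgHom.comp_apply, hp, map_zero]
  have hlt : ∀ (s t : Finset (Fin 3)) (i : Fin 3), s ⊆ t → i ∈ t → i ∉ s → P s < P t := by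
    intro s t i hst hit his
    refine lt_of_le_of_ne (hle s t hst) ?_
    intro h
    have h1 : (X i : MvPolynomial (Fin 3) ℂ) ∈ P t := by simp [P, φ, hit]
    rw [← h] at h1
    simp [P, φ, his] at h1
  have h1 := Ideal.height_add_one_le_of_lt_of_isPrime (hlt ∅ {0} 0 (by simp) (by simp) (by simp))
  have h2 := Ideal.height_add_one_le_of_lt_of_isPrime (hlt {0} {0,1} 1 (by simp) (by simp) (by simp))
  have h3 := Ideal.height_add_one_le_of_lt_of_isPrime (hlt {0,1} Finset.univ 2 (by simp) (by simp) (by simp))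
  have h4 : P Finset.univ ≤ vanishingIdeal ℂ {(0 : Fin 3 → ℂ)} := by
    intro p hp
    rw [mem_max_iff]
    have : (aeval (0: Fin 3 → ℂ)).comp (φ Finset.univ) = aeval (0: Fin 3 → ℂ) := by
      ext i; simp [φ]
    simp only [P, RingHom.mem_ker] at hp
    have h := congrArg (fun g => g p) this
    simp only [AlgHom.comp_apply, hp, map_zero] at h
    simpa [aeval_eq_eval] using h.symm
  have h5 := Ideal.height_mono h4
  refine le_trans ?_ h5
  refine le_trans ?_ h3
  refine le_trans ?_ (add_le_add_left h2 1)
  refine le_trans ?_ (add_le_add_left (add_le_add_left h1 1) 1)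
  have : (3 : ℕ∞) = 0 + 1 + 1 + 1 := by norm_num
  rw [this]
  gcongr
  exact zero_le

/-- two forms have a common nonzero zero -/
lemma exists_common_zero (p q : MvPolynomial (Fin 3) ℂ) (hp : eval 0 p = 0) (hq : eval 0 q = 0) :
    ∃ a : Fin 3 → ℂ, a ≠ 0 ∧ eval a p = 0 ∧ eval a q = 0 := by
  by_contra hcon
  push Not at hcon
  have hr := radical_eq_of_no_zero {p, q} (by rintro r (rfl | rfl) <;> assumption) (by
    intro a ha
    by_contra hne
    exact hcon a hne (ha p (by simp)) (ha q (by simp)))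
  have hmin : vanishingIdeal ℂ {(0 : Fin 3 → ℂ)} ∈ (Ideal.span {p, q}).minimalPrimes := by
    rw [← Ideal.radical_minimalPrimes, hr, Ideal.minimalPrimes_eq_subsingleton_self]
    rfl
  have h1 := Ideal.height_le_card_of_mem_minimalPrimes_span (by simp) hmin
  have h2 : ({p, q} : Set (MvPolynomial (Fin 3) ℂ)).ncard ≤ 2 := (Set.ncard_insert_le _ _).trans (by simp)
  have h3 := three_le_height.trans (h1.trans (Nat.cast_le.2 h2))
  norm_num at h3

lemma isHom_eval_smul {n : ℕ} {q : MvPolynomial (Fin 3) ℂ} (hq : q.IsHomogeneous n)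
    (a : Fin 3 → ℂ) (t : ℂ) : eval (fun i => t * a i) q = t ^ n * eval a q := by
  rw [eval_eq, eval_eq, Finset.mul_sum]
  refine Finset.sum_congr rfl fun d hd => ?_
  have hd' := hq (mem_support_iff.1 hd)
  simp only [mul_pow, Finset.prod_mul_distrib, Finset.prod_pow_eq_pow_sum]
  have : ∑ i ∈ d.support, d i = n := by
    rw [← hd', Finsupp.weight_apply, Finsupp.sum]; simp
  rw [this]; ring

/-- a factor of a nonzero form, nonvanishing at the origin, is a unit. -/
lemma isUnit_of_dvd {n : ℕ} {q g : MvPolynomial (Fin 3) ℂ} (hq : q.IsHomogeneous n) (hq0 : q ≠ 0)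
    (hg : g ∣ q) (h0 : eval 0 g ≠ 0) : IsUnit g := by
  obtain ⟨k, hk⟩ := hg
  have key : ∀ a, eval a q ≠ 0 → eval a g = eval 0 g := by
    intro a ha
    let ψ : MvPolynomial (Fin 3) ℂ →ₐ[ℂ] Polynomial ℂ := aeval (fun i => Polynomial.C (a i) * Polynomial.X)
    have hψ : ∀ p t, (ψ p).eval t = eval (fun i => t * a i) p := by
      intro p t
      have : (Polynomial.aeval t).comp ψ = aeval (fun i => t * a i) := by
        ext i; simp only [ψ, AlgHom.comp_apply, aeval_X, map_mul, Polynomial.aeval_C, Polynomial.aeval_X]; exact mul_comm _ _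
      have h := congrArg (fun g => g p) this
      simpa [Polynomial.aeval_def, aeval_eq_eval] using h
    have h1 : ψ q = Polynomial.C (eval a q) * Polynomial.X ^ n := by
      apply Polynomial.funext; intro t
      rw [hψ, isHom_eval_smul hq]; simp only [Polynomial.eval_mul, Polynomial.eval_C, Polynomial.eval_pow, Polynomial.eval_X]; exact mul_comm _ _
    have h2 : ψ g ∣ Polynomial.X ^ n := by
      have : ψ g ∣ ψ q := ⟨ψ k, by rw [hk, map_mul]⟩
      rw [h1] at this
      exact (IsUnit.dvd_mul_left (Polynomial.isUnit_C.2 (isUnit_iff_ne_zero.2 ha))).1 this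
    obtain ⟨i, hi, hass⟩ := (dvd_prime_pow Polynomial.prime_X n).1 h2
    obtain ⟨u, hu⟩ := hass.symm
    obtain ⟨c, hc, hcu⟩ := Polynomial.isUnit_iff.1 u.isUnit
    rw [← hcu] at hu
    have e0 := hψ g 0
    have e1 := hψ g 1
    simp only [zero_mul, one_mul] at e0 e1
    rw [← hu] at e0 e1
    have e0' : eval (fun _ => (0:ℂ)) g ≠ 0 := h0
    rw [← e0] at e0'
    have hi0 : i = 0 := by
      by_contra hne
      simp [hne] at e0'
    subst hi0
    have : eval 0 g = eval (fun _ => (0:ℂ)) g := rfl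
    rw [this, ← e0, ← e1]; simp
  have h3 : (g - C (eval 0 g)) * q = 0 := by
    apply MvPolynomial.funext
    intro a
    by_cases ha : eval a q = 0
    · simp [ha]
    · simp [key a ha]
  rcases mul_eq_zero.1 h3 with h | h
  · rw [sub_eq_zero.1 h]
    exact (isUnit_iff_ne_zero.2 h0).map C
  · exact absurd h hq0

lemma isHom_eval_zero {n : ℕ} (hn : n ≠ 0) {q : MvPolynomial (Fin 3) ℂ} (hq : q.IsHomogeneous n) :
    eval 0 q = 0 := by
  have := isHom_eval_smul hq 0 0
  simpa [hn] using this

lemma isRelPrime_of {q1 q2 q3 : MvPolynomial (Fin 3) ℂ} (h1 : q1.IsHomogeneous 2)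
    (h2 : q2.IsHomogeneous 2) (h3 : q3.IsHomogeneous 2)
    (h : ∀ a : Fin 3 → ℂ, eval a q1 = 0 → eval a q2 = 0 → eval a q3 = 0 → a = 0) :
    IsRelPrime q1 q2 := by
  intro g hg1 hg2
  have hq0 : q1 ≠ 0 := by
    rintro rfl
    obtain ⟨a, ha, e1, e2⟩ := exists_common_zero q2 q3 (isHom_eval_zero (by norm_num) h2)
      (isHom_eval_zero (by norm_num) h3)
    exact ha (h a (by simp) e1 e2)
  by_contra hu
  have hg0 : eval 0 g = 0 := by
    by_contra hne
    exact hu (isUnit_of_dvd h1 hq0 hg1 hne)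
  obtain ⟨a, ha, e1, e2⟩ := exists_common_zero g q3 hg0 (isHom_eval_zero (by norm_num) h3)
  obtain ⟨k1, rfl⟩ := hg1
  obtain ⟨k2, rfl⟩ := hg2
  exact ha (h a (by simp [e1]) (by simp [e1]) e2)

/-- two-term syzygies of coprime elements -/
lemma syz_two {q1 q2 a b : MvPolynomial (Fin 3) ℂ} (hrp : IsRelPrime q1 q2) (hq : q1 ≠ 0 ∨ q2 ≠ 0)
    (h : a * q1 + b * q2 = 0) : ∃ t, a = t * q2 ∧ b = - t * q1 := by
  by_cases h2 : q2 = 0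
  · subst h2
    have hq1 : q1 ≠ 0 := by simpa using hq
    have ha : a = 0 := by simpa [hq1] using h
    have hu : IsUnit q1 := hrp dvd_rfl (dvd_zero _)
    obtain ⟨u, hu⟩ := hu
    refine ⟨- b * ↑u⁻¹, by simp [ha], ?_⟩
    rw [← hu]; simp [mul_assoc]
  · have : q2 ∣ a * q1 := ⟨-b, by linear_combination h⟩
    obtain ⟨t, rfl⟩ := (hrp.symm.dvd_of_dvd_mul_right this)
    refine ⟨t, by ring, ?_⟩
    apply mul_right_cancel₀ h2
    linear_combination h

lemma X_mem_of {t : MvPolynomial (Fin 3) ℂ} (h : t * X 2 ∈ Ideal.span {(X 0 : MvPolynomial (Fin 3) ℂ), X 1}) :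
    t ∈ Ideal.span {(X 0 : MvPolynomial (Fin 3) ℂ), X 1} := by
  have e : ({(X 0 : MvPolynomial (Fin 3) ℂ), X 1} : Set _) = X '' ({0, 1} : Set (Fin 3)) := by
    simp [Set.image_pair]
  rw [e, mem_ideal_span_X_image] at h ⊢
  intro m hm
  obtain ⟨i, hi, hne⟩ := h (m + Finsupp.single 2 1) (by
    rw [mem_support_iff, coeff_mul_X]; exact mem_support_iff.1 hm)
  refine ⟨i, hi, ?_⟩
  rcases hi with rfl | rfl
  · simpa using hne
  · simpa using hne

lemma relprime_X : IsRelPrime (X 0 : MvPolynomial (Fin 3) ℂ) (X 1) := by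
  have : Prime (X 0 : MvPolynomial (Fin 3) ℂ) := X_prime
  rw [this.irreducible.isRelPrime_iff_not_dvd]
  rw [X_dvd_X]
  simp

/-- Koszul exactness for the variables -/
lemma koszul_X {t0 t1 t2 : MvPolynomial (Fin 3) ℂ} (h : t0 * X 0 + t1 * X 1 + t2 * X 2 = 0) :
    ∃ s0 s1 s2 : MvPolynomial (Fin 3) ℂ, t0 = X 1 * s2 - X 2 * s1 ∧ t1 = X 2 * s0 - X 0 * s2 ∧
      t2 = X 0 * s1 - X 1 * s0 := by
  have hm : t2 * X 2 ∈ Ideal.span {(X 0 : MvPolynomial (Fin 3) ℂ), X 1} := by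
    rw [Ideal.mem_span_pair]
    exact ⟨-t0, -t1, by linear_combination -h⟩
  obtain ⟨α, β, hab⟩ := Ideal.mem_span_pair.1 (X_mem_of hm)
  obtain ⟨γ, e1, e2⟩ := syz_two (a := t0 + α * X 2) (b := t1 + β * X 2) relprime_X
    (Or.inl (X_ne_zero _)) (by linear_combination h + X 2 * hab)
  refine ⟨-β, α, γ, ?_, ?_, ?_⟩
  · linear_combination e1
  · linear_combination e2
  · linear_combination -hab

/-- no embedded component at the origin -/
lemma no_socle {q1 q2 u : MvPolynomial (Fin 3) ℂ} (hrp : IsRelPrime q1 q2) (hq : q1 ≠ 0 ∨ q2 ≠ 0)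
    (h : ∀ i, X i * u ∈ Ideal.span {q1, q2}) : u ∈ Ideal.span {q1, q2} := by
  simp only [Ideal.mem_span_pair] at h ⊢
  choose a b hab using h
  have key (i j : Fin 3) : ∃ t, X j * a i - X i * a j = t * q2 ∧ X j * b i - X i * b j = - t * q1 :=
    syz_two hrp hq (by linear_combination X j * hab i - X i * hab j)
  obtain ⟨t2, c2, d2⟩ := key 0 1
  obtain ⟨t0, c0, d0⟩ := key 1 2
  obtain ⟨t1, c1, d1⟩ := key 2 0
  have hz : t0 * X 0 + t1 * X 1 + t2 * X 2 = 0 := by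
    rcases hq with h0 | h0
    · apply mul_right_cancel₀ h0
      linear_combination X 0 * d0 + X 1 * d1 + X 2 * d2
    · apply mul_right_cancel₀ h0
      linear_combination - X 0 * c0 - X 1 * c1 - X 2 * c2
  obtain ⟨s0, s1, s2, e0, e1, e2⟩ := koszul_X hz
  obtain ⟨α, f1, f2⟩ := syz_two (a := a 1 + s1 * q2) (b := - (a 0 + s0 * q2)) relprime_X
    (Or.inl (X_ne_zero _)) (by rw [e2] at c2; linear_combination -c2)
  obtain ⟨β, g1, g2⟩ := syz_two (a := b 1 - s1 * q1) (b := - (b 0 - s0 * q1)) relprime_X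
    (Or.inl (X_ne_zero _)) (by rw [e2] at d2; linear_combination -d2)
  refine ⟨α, β, ?_⟩
  apply mul_left_cancel₀ (X_ne_zero (R := ℂ) (0 : Fin 3))
  linear_combination hab 0 + q1 * f2 + q2 * g2

lemma nzd {q1 q2 q3 h : MvPolynomial (Fin 3) ℂ} (h1 : q1.IsHomogeneous 2)
    (h2 : q2.IsHomogeneous 2) (h3 : q3.IsHomogeneous 2)
    (hz : ∀ a : Fin 3 → ℂ, eval a q1 = 0 → eval a q2 = 0 → eval a q3 = 0 → a = 0)
    (hm : h * q3 ∈ Ideal.span {q1, q2}) : h ∈ Ideal.span {q1, q2} := by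
  by_contra hcon
  set J := Ideal.span {q1, q2} with hJ
  have hx : (Ideal.Quotient.mk J h) ≠ 0 := by rwa [Ne, Ideal.Quotient.eq_zero_iff_mem]
  obtain ⟨P, hP, hle⟩ := exists_le_isAssociatedPrime_of_isNoetherianRing
    (MvPolynomial (Fin 3) ℂ) (Ideal.Quotient.mk J h) hx
  rw [isAssociatedPrime_iff] at hP
  obtain ⟨hprime, x, hPx⟩ := hP
  obtain ⟨u, rfl⟩ := Ideal.Quotient.mk_surjective x
  have hs : ∀ r v, r • (Ideal.Quotient.mk J v) = Ideal.Quotient.mk J (r * v) := fun _ _ => rfl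
  have hmem : ∀ r, r ∈ P ↔ r * u ∈ J := by
    intro r
    rw [hPx, Submodule.mem_colon_singleton, Submodule.mem_bot, ← Ideal.Quotient.eq_zero_iff_mem, hs]
  have hq3 : q3 ∈ P := by
    apply hle
    rw [Submodule.mem_colon_singleton, Submodule.mem_bot, hs, Ideal.Quotient.eq_zero_iff_mem, mul_comm]
    exact hm
  have hrad := radical_eq_of_no_zero {q1, q2, q3} (by
      rintro r (rfl | rfl | rfl)
      · exact isHom_eval_zero (by norm_num) h1
      · exact isHom_eval_zero (by norm_num) h2
      · exact isHom_eval_zero (by norm_num) h3) (by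
    intro a ha
    exact hz a (ha _ (by simp)) (ha _ (by simp)) (ha _ (by simp)))
  have hIP : Ideal.span {q1, q2, q3} ≤ P := by
    rw [Ideal.span_le]
    rintro r (rfl | rfl | rfl)
    · exact (hmem _).2 (Ideal.mul_mem_right _ _ (Ideal.subset_span (by simp)))
    · exact (hmem _).2 (Ideal.mul_mem_right _ _ (Ideal.subset_span (by simp)))
    · exact hq3
  have hmP : vanishingIdeal ℂ {(0 : Fin 3 → ℂ)} ≤ P := by
    rw [← hrad]; exact (hprime.radical_le_iff).2 hIP
  have hu : u ∉ J := by
    intro hu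
    apply hprime.ne_top
    rw [Ideal.eq_top_iff_one, hmem]; simpa using hu
  apply hu
  have hrp := isRelPrime_of h1 h2 h3 hz
  refine no_socle hrp ?_ (fun i => (hmem _).1 (hmP ((mem_max_iff _).2 (by simp))))
  by_contra hne
  push Not at hne
  have := hrp (d := 0) (by simp [hne.1]) (by simp [hne.2])
  simp at this

lemma hc_mul_hom {q p : MvPolynomial (Fin 3) ℂ} (hq : q.IsHomogeneous 2) :
    homogeneousComponent 2 (p * q) = C (coeff 0 p) * q := by
  induction p using MvPolynomial.induction_on' with
  | monomial d c =>
    have hh : (monomial d c * q).IsHomogeneous (d.degree + 2) :=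
      (isHomogeneous_monomial c rfl).mul hq
    rw [homogeneousComponent_of_mem hh]
    by_cases hd : d = 0
    · subst hd; simp
    · have : d.degree ≠ 0 := by rwa [Ne, Finsupp.degree_eq_zero_iff]
      rw [if_neg (by omega), coeff_monomial, if_neg hd]; simp
  | add p q hp hq => simp [add_mul, hp, hq]

/-- Syzygies of degree two of three quadratic forms without common zero are Koszul. -/
lemma syz_three {q1 q2 q3 g1 g2 g3 : MvPolynomial (Fin 3) ℂ} (h1 : q1.IsHomogeneous 2)
    (h2 : q2.IsHomogeneous 2) (h3 : q3.IsHomogeneous 2)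
    (k1 : g1.IsHomogeneous 2) (k2 : g2.IsHomogeneous 2) (k3 : g3.IsHomogeneous 2)
    (hz : ∀ a : Fin 3 → ℂ, eval a q1 = 0 → eval a q2 = 0 → eval a q3 = 0 → a = 0)
    (h : g1 * q1 + g2 * q2 + g3 * q3 = 0) :
    ∃ α β γ : ℂ, g1 = C γ * q2 - C α * q3 ∧ g2 = - C γ * q1 - C β * q3 ∧
      g3 = C α * q1 + C β * q2 := by
  have hm : g3 * q3 ∈ Ideal.span {q1, q2} := by
    rw [Ideal.mem_span_pair]
    exact ⟨-g1, -g2, by linear_combination -h⟩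
  obtain ⟨α, β, hab⟩ := Ideal.mem_span_pair.1 (nzd h1 h2 h3 hz hm)
  have hrp := isRelPrime_of h1 h2 h3 hz
  have hne : q1 ≠ 0 ∨ q2 ≠ 0 := by
    by_contra hne
    push Not at hne
    have := hrp (d := 0) (by simp [hne.1]) (by simp [hne.2])
    simp at this
  obtain ⟨γ, e1, e2⟩ := syz_two (a := g1 + α * q3) (b := g2 + β * q3) hrp hne
    (by linear_combination h + q3 * hab)
  refine ⟨coeff 0 α, coeff 0 β, coeff 0 γ, ?_, ?_, ?_⟩
  · have := congrArg (homogeneousComponent 2) e1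
    rw [map_add, hc_mul_hom h3, hc_mul_hom h2, homogeneousComponent_eq_self k1] at this
    linear_combination this
  · have := congrArg (homogeneousComponent 2) e2
    rw [neg_mul, map_neg, map_add, hc_mul_hom h3, hc_mul_hom h1, homogeneousComponent_eq_self k2] at this
    linear_combination this
  · have := congrArg (homogeneousComponent 2) hab
    rw [map_add, hc_mul_hom h1, hc_mul_hom h2, homogeneousComponent_eq_self k3] at this
    linear_combination -this

end TQ

namespace TQ

section coords
variable {R : Type*} [CommRing R]

/-- value of the quadratic form with coefficients `v` -/
def qv (v : Fin 6 → R) (a : Fin 3 → R) : R :=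
  v 0 * a 0 ^ 2 + v 1 * a 1 ^ 2 + v 2 * a 2 ^ 2 + v 3 * (a 0 * a 1) + v 4 * (a 0 * a 2)
    + v 5 * (a 1 * a 2)

/-- value of the quartic form with coefficients `c` -/
def quart (c : Fin 15 → R) (a : Fin 3 → R) : R :=
  c 0 * a 0 ^ 4 + c 1 * a 1 ^ 4 + c 2 * a 2 ^ 4 + c 3 * (a 0 ^ 3 * a 1) + c 4 * (a 0 ^ 3 * a 2)
  + c 5 * (a 1 ^ 3 * a 0) + c 6 * (a 1 ^ 3 * a 2) + c 7 * (a 2 ^ 3 * a 0) + c 8 * (a 2 ^ 3 * a 1)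
  + c 9 * (a 0 ^ 2 * a 1 ^ 2) + c 10 * (a 0 ^ 2 * a 2 ^ 2) + c 11 * (a 1 ^ 2 * a 2 ^ 2)
  + c 12 * (a 0 ^ 2 * (a 1 * a 2)) + c 13 * (a 1 ^ 2 * (a 0 * a 2)) + c 14 * (a 2 ^ 2 * (a 0 * a 1))

/-- the partial derivatives of the quartic form -/
def grad (c : Fin 15 → R) (a : Fin 3 → R) : Fin 3 → R :=
  ![4 * c 0 * a 0 ^ 3 + 3 * c 3 * (a 0 ^ 2 * a 1) + 3 * c 4 * (a 0 ^ 2 * a 2) + c 5 * a 1 ^ 3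
      + c 7 * a 2 ^ 3 + 2 * c 9 * (a 0 * a 1 ^ 2) + 2 * c 10 * (a 0 * a 2 ^ 2)
      + 2 * c 12 * (a 0 * (a 1 * a 2)) + c 13 * (a 1 ^ 2 * a 2) + c 14 * (a 2 ^ 2 * a 1),
    4 * c 1 * a 1 ^ 3 + 3 * c 5 * (a 1 ^ 2 * a 0) + 3 * c 6 * (a 1 ^ 2 * a 2) + c 3 * a 0 ^ 3
      + c 8 * a 2 ^ 3 + 2 * c 9 * (a 1 * a 0 ^ 2) + 2 * c 11 * (a 1 * a 2 ^ 2)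
      + 2 * c 13 * (a 1 * (a 0 * a 2)) + c 12 * (a 0 ^ 2 * a 2) + c 14 * (a 2 ^ 2 * a 0),
    4 * c 2 * a 2 ^ 3 + 3 * c 7 * (a 2 ^ 2 * a 0) + 3 * c 8 * (a 2 ^ 2 * a 1) + c 4 * a 0 ^ 3
      + c 6 * a 1 ^ 3 + 2 * c 10 * (a 2 * a 0 ^ 2) + 2 * c 11 * (a 2 * a 1 ^ 2)
      + 2 * c 14 * (a 2 * (a 0 * a 1)) + c 12 * (a 0 ^ 2 * a 1) + c 13 * (a 1 ^ 2 * a 0)]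

/-- coefficients of the quartic attached to a Gram matrix -/
def sig (G : Matrix (Fin 6) (Fin 6) R) : Fin 15 → R :=
  ![G 0 0, G 1 1, G 2 2, G 0 3 + G 3 0, G 0 4 + G 4 0, G 1 3 + G 3 1, G 1 5 + G 5 1,
    G 2 4 + G 4 2, G 2 5 + G 5 2, G 0 1 + G 1 0 + G 3 3, G 0 2 + G 2 0 + G 4 4,
    G 1 2 + G 2 1 + G 5 5, G 0 5 + G 5 0 + G 3 4 + G 4 3, G 1 4 + G 4 1 + G 3 5 + G 5 3,
    G 2 3 + G 3 2 + G 4 5 + G 5 4]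

/-- product of two quadratic forms in coordinates -/
def qmul (u v : Fin 6 → R) : Fin 15 → R := sig (Matrix.of fun i j => u i * v j)

/-- `∑ hᵢ qᵢ` -/
def Lm (M H : Fin 3 → Fin 6 → R) : Fin 15 → R := ∑ k, qmul (M k) (H k)

/-- Gram matrix -/
def gm (M : Fin 3 → Fin 6 → R) : Matrix (Fin 6) (Fin 6) R := Matrix.of fun i j => ∑ k, M k i * M k j

/-- sum of squares -/
def Fm (M : Fin 3 → Fin 6 → R) : Fin 15 → R := Lm M M

lemma quart_qmul (u v : Fin 6 → R) (a) : quart (qmul u v) a = qv u a * qv v a := by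
  simp only [quart, qmul, qv, sig, Matrix.of_apply, Matrix.cons_val]; ring

lemma quart_add (c d : Fin 15 → R) (a) : quart (c + d) a = quart c a + quart d a := by
  simp only [quart, Pi.add_apply]; ring

lemma quart_smul (t : R) (c : Fin 15 → R) (a) : quart (t • c) a = t * quart c a := by
  simp only [quart, Pi.smul_apply, smul_eq_mul]; ring

lemma quart_Lm (M H : Fin 3 → Fin 6 → R) (a) :
    quart (Lm M H) a = ∑ k, qv (M k) a * qv (H k) a := by
  simp only [Lm, Fin.sum_univ_three, quart_add, quart_qmul]

lemma sig_add (A B : Matrix (Fin 6) (Fin 6) R) : sig (A + B) = sig A + sig B := by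
  ext k
  fin_cases k <;> simp [sig] <;> ring

lemma sig_gm (M : Fin 3 → Fin 6 → R) : sig (gm M) = Fm M := by
  have : gm M = Matrix.of (fun i j => M 0 i * M 0 j) + Matrix.of (fun i j => M 1 i * M 1 j)
      + Matrix.of (fun i j => M 2 i * M 2 j) := by
    ext i j; simp [gm, Fin.sum_univ_three]
  rw [this, sig_add, sig_add]
  simp [Fm, Lm, qmul, Fin.sum_univ_three]

/-- partial derivatives of a quadratic form -/
def qgrad (v : Fin 6 → R) (a : Fin 3 → R) : Fin 3 → R :=
  ![2 * v 0 * a 0 + v 3 * a 1 + v 4 * a 2, 2 * v 1 * a 1 + v 3 * a 0 + v 5 * a 2,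
    2 * v 2 * a 2 + v 4 * a 0 + v 5 * a 1]

lemma grad_add (c d : Fin 15 → R) (a) : grad (c + d) a = grad c a + grad d a := by
  ext i; fin_cases i <;> simp [grad] <;> ring

lemma grad_qmul (u : Fin 6 → R) (a) : grad (qmul u u) a = (2 * qv u a) • qgrad u a := by
  ext i; fin_cases i <;> simp [grad, qmul, qv, sig, qgrad] <;> ring

lemma grad_Fm (M : Fin 3 → Fin 6 → R) (a) (h : ∀ k, qv (M k) a = 0) : grad (Fm M) a = 0 := by
  simp [Fm, Lm, Fin.sum_univ_three, grad_add, grad_qmul, h]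

lemma euler (c : Fin 15 → R) (a) : ∑ i, a i * grad c a i = 4 * quart c a := by
  simp [Fin.sum_univ_three, grad, quart]; ring

lemma quart_map {S : Type*} [CommRing S] (φ : R →+* S) (c : Fin 15 → R) (a) :
    φ (quart c a) = quart (fun k => φ (c k)) (fun i => φ (a i)) := by
  simp [quart]

lemma qv_map {S : Type*} [CommRing S] (φ : R →+* S) (c : Fin 6 → R) (a) :
    φ (qv c a) = qv (fun k => φ (c k)) (fun i => φ (a i)) := by
  simp [qv]

end coords

/-- the polynomial with coefficients `c` -/
noncomputable def P {R : Type*} [CommRing R] (c : Fin 15 → R) : MvPolynomial (Fin 3) R :=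
  quart (fun k => C (c k)) X

/-- the quadratic polynomial with coefficients `v` -/
noncomputable def Q {R : Type*} [CommRing R] (v : Fin 6 → R) : MvPolynomial (Fin 3) R :=
  qv (fun k => C (v k)) X

lemma eval_P {R : Type*} [CommRing R] (c : Fin 15 → R) (a) : eval a (P c) = quart c a := by
  simp [P, quart_map]

lemma eval_Q {R : Type*} [CommRing R] (c : Fin 6 → R) (a) : eval a (Q c) = qv c a := by
  simp [Q, qv_map]

lemma Q_hom {R : Type*} [CommRing R] (v : Fin 6 → R) : (Q v).IsHomogeneous 2 := by
  have h1 (r : R) (i : Fin 3) : (C r * X i ^ 2 : MvPolynomial (Fin 3) R).IsHomogeneous 2 :=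
    ((isHomogeneous_X R i).pow 2).C_mul r
  have h2 (r : R) (i j : Fin 3) : (C r * (X i * X j) : MvPolynomial (Fin 3) R).IsHomogeneous 2 :=
    ((isHomogeneous_X R i).mul (isHomogeneous_X R j)).C_mul r
  exact (((((h1 _ _).add (h1 _ _)).add (h1 _ _)).add (h2 _ _ _)).add (h2 _ _ _)).add (h2 _ _ _)

lemma gram_sum (G : Matrix (Fin 6) (Fin 6) ℝ) :
    (∑ i, ∑ j, C (G i j) * (gramBasis i * gramBasis j)) = P (sig G) := by
  simp only [Fin.sum_univ_six, gramBasis, P, quart, sig, Matrix.cons_val, map_add]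
  ring

lemma pderiv_P (c : Fin 15 → ℝ) (a : Fin 3 → ℂ) (i : Fin 3) :
    eval a (pderiv i (map (algebraMap ℝ ℂ) (P c))) = grad (fun k => (c k : ℂ)) a i := by
  fin_cases i <;>
  · simp [P, quart, grad, Derivation.leibniz, pderiv_X, Derivation.leibniz_pow]
    ring

/-- zero test for complex or real quartics -/
lemma quart_zero (c : Fin 15 → ℝ) (h : ∀ a, quart c a = 0) : c = 0 := by
  have e1 := h ![1,0,0]
  have e2 := h ![0,1,0]
  have e3 := h ![0,0,1]
  have a1 := h ![1,1,0]
  have a2 := h ![1,-1,0]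
  have a3 := h ![1,2,0]
  have b1 := h ![1,0,1]
  have b2 := h ![1,0,-1]
  have b3 := h ![1,0,2]
  have c1 := h ![0,1,1]
  have c2 := h ![0,1,-1]
  have c3 := h ![0,1,2]
  have d1 := h ![1,1,1]
  have d2 := h ![1,-1,1]
  have d3 := h ![1,1,-1]
  simp [quart] at e1 e2 e3 a1 a2 a3 b1 b2 b3 c1 c2 c3 d1 d2 d3
  ext k
  fin_cases k <;> simp <;> linarith

lemma qv_zero (c : Fin 6 → ℂ) (h : ∀ a, qv c a = 0) : c = 0 := by
  have e1 := h ![1,0,0]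
  have e2 := h ![0,1,0]
  have e3 := h ![0,0,1]
  have a1 := h ![1,1,0]
  have b1 := h ![1,0,1]
  have c1 := h ![0,1,1]
  simp [qv] at e1 e2 e3 
  simp [qv, e1, e2, e3] at a1 b1 c1
  ext k
  fin_cases k <;> simp [*]

lemma P_inj {c d : Fin 15 → ℝ} (h : P c = P d) : c = d := by
  rw [← sub_eq_zero]
  apply quart_zero
  intro a
  have := congrArg (eval a) h
  rw [eval_P, eval_P] at this
  rw [sub_eq_add_neg, ← neg_one_smul ℝ, quart_add, quart_smul, this]; ring

lemma P_surj (f : MvPolynomial (Fin 3) ℝ) (hf : f.IsHomogeneous 4) : ∃ c, f = P c := by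
  let L : (Fin 15 → ℝ) →ₗ[ℝ] MvPolynomial (Fin 3) ℝ :=
    { toFun := P
      map_add' := by intro c d; simp [P, quart]; ring
      map_smul' := by intro r d; simp [P, quart, MvPolynomial.smul_eq_C_mul]; ring }
  have hL : ∀ c, L c = P c := fun _ => rfl
  suffices h : f ∈ LinearMap.range L by
    obtain ⟨c, hc⟩ := h; exact ⟨c, hc.symm⟩
  rw [f.as_sum]
  refine Submodule.sum_mem _ fun d hd => ?_
  have hd' := hf (mem_support_iff.1 hd)
  have hdeg : d 0 + d 1 + d 2 = 4 := by
    rw [← hd', Finsupp.weight_apply, Finsupp.sum_fintype] <;> simp [Fin.sum_univ_three]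
  have hm (r : ℝ) : monomial d r = C r * (X 0 ^ d 0 * X 1 ^ d 1 * X 2 ^ d 2) := by
    rw [monomial_eq, Finsupp.prod_fintype _ _ (by simp), Fin.prod_univ_three]
  rw [hm]
  generalize coeff d f = r
  generalize d 0 = x at *
  generalize d 1 = y at *
  generalize d 2 = z at *
  have key : ∀ k : Fin 15, P (Pi.single k r) ∈ LinearMap.range L := fun k => ⟨_, hL _⟩
  have hx : x ≤ 4 := by omega
  have hy : y ≤ 4 := by omega
  obtain rfl : z = 4 - x - y := by omega
  have hall : ∃ k : Fin 15, P (Pi.single k r) =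
      C r * (X 0 ^ x * X 1 ^ y * X 2 ^ (4 - x - y) : MvPolynomial (Fin 3) ℝ) := by
    interval_cases x <;> interval_cases y <;> first
      | (exfalso; omega)
      | skip
    · exact ⟨2, by simp [P, quart]⟩
    · exact ⟨8, by simp [P, quart]; left; ring⟩
    · exact ⟨11, by simp [P, quart]⟩
    · exact ⟨6, by simp [P, quart]⟩
    · exact ⟨1, by simp [P, quart]⟩
    · exact ⟨7, by simp [P, quart]; left; ring⟩
    · exact ⟨14, by simp [P, quart]; left; ring⟩
    · exact ⟨13, by simp [P, quart]; left; ring⟩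
    · exact ⟨5, by simp [P, quart]; left; ring⟩
    · exact ⟨10, by simp [P, quart]⟩
    · exact ⟨12, by simp [P, quart]; left; ring⟩
    · exact ⟨9, by simp [P, quart]⟩
    · exact ⟨4, by simp [P, quart]⟩
    · exact ⟨3, by simp [P, quart]⟩
    · exact ⟨0, by simp [P, quart]⟩
  obtain ⟨k, hk⟩ := hall
  rw [← hk]; exact key k

end TQ

namespace TQ

/-- complexification of coefficient vectors -/
def cc {n : ℕ} (c : Fin n → ℝ) : Fin n → ℂ := fun k => (c k : ℂ)

/-- smoothness in coordinates -/
def Smooth (c : Fin 15 → ℝ) : Prop := ∀ a : Fin 3 → ℂ, grad (cc c) a = 0 → a = 0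

/-- no common zero -/
def NCZ (M : Fin 3 → Fin 6 → ℝ) : Prop := ∀ a : Fin 3 → ℂ, (∀ k, qv (cc (M k)) a = 0) → a = 0

lemma smooth_iff (c : Fin 15 → ℝ) : IsSmooth (P c) ↔ Smooth c := by
  unfold IsSmooth Smooth
  simp only [pderiv_P, funext_iff]
  rfl

lemma cc_qmul (u v : Fin 6 → ℝ) : cc (qmul u v) = qmul (cc u) (cc v) := by
  change Complex.ofReal ∘ (qmul u v) = _
  have hc {n : ℕ} (x : ℝ) (w : Fin n → ℝ) :
      Complex.ofReal ∘ (vecCons x w) = vecCons (x : ℂ) (Complex.ofReal ∘ w) := by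
    ext k; refine Fin.cases ?_ (fun i => ?_) k <;> simp
  have h0 (w : Fin 0 → ℝ) : Complex.ofReal ∘ w = ![] := Matrix.empty_eq _
  simp only [qmul, sig, Matrix.of_apply, hc, h0, Complex.ofReal_add, Complex.ofReal_mul, cc]

lemma cc_Lm (M H : Fin 3 → Fin 6 → ℝ) : cc (Lm M H) = Lm (fun k => cc (M k)) (fun k => cc (H k)) := by
  have hadd (c d : Fin 15 → ℝ) : cc (c + d) = cc c + cc d := by ext; simp [cc]
  simp only [Lm, Fin.sum_univ_three, hadd, cc_qmul]

lemma ncz_of_smooth {M : Fin 3 → Fin 6 → ℝ} (h : Smooth (Fm M)) : NCZ M := by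
  intro a ha
  apply h
  rw [Fm, cc_Lm]
  exact grad_Fm _ _ ha

lemma lin_of_ncz {M : Fin 3 → Fin 6 → ℝ} (h : NCZ M) {s : Fin 3 → ℝ}
    (hs : ∑ k, s k • M k = 0) : s = 0 := by
  have hev (a : Fin 3 → ℂ) : (s 0 : ℂ) * qv (cc (M 0)) a + s 1 * qv (cc (M 1)) a
      + s 2 * qv (cc (M 2)) a = 0 := by
    have e (k : Fin 6) : (s 0 : ℂ) * (M 0 k : ℂ) + s 1 * M 1 k + s 2 * M 2 k = 0 := by
      have := congrFun hs k
      simp only [Fin.sum_univ_three, Pi.add_apply, Pi.smul_apply, smul_eq_mul, Pi.zero_apply] at this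
      exact_mod_cast this
    simp only [qv, cc]
    linear_combination a 0 ^ 2 * e 0 + a 1 ^ 2 * e 1 + a 2 ^ 2 * e 2 + a 0 * a 1 * e 3
      + a 0 * a 2 * e 4 + a 1 * a 2 * e 5
  have hz (i j : Fin 3) : ∃ a : Fin 3 → ℂ, a ≠ 0 ∧ qv (cc (M i)) a = 0 ∧ qv (cc (M j)) a = 0 := by
    have := exists_common_zero (Q (cc (M i))) (Q (cc (M j))) (by rw [eval_Q]; simp [qv])
      (by rw [eval_Q]; simp [qv])
    simpa only [eval_Q] using this
  by_contra hne
  have : ∃ k, s k ≠ 0 := by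
    by_contra hk; push Not at hk; exact hne (funext hk)
  obtain ⟨k, hk⟩ := this
  have hk' : (s k : ℂ) ≠ 0 := by exact_mod_cast hk
  fin_cases k
  · obtain ⟨a, ha, e1, e2⟩ := hz 1 2
    have := hev a
    rw [e1, e2] at this
    have e0 : qv (cc (M 0)) a = 0 := by simpa [show (s 0 : ℂ) ≠ 0 from hk'] using this
    exact ha (h a (by intro k; fin_cases k <;> assumption))
  · obtain ⟨a, ha, e1, e2⟩ := hz 0 2
    have := hev a
    rw [e1, e2] at this
    have e0 : qv (cc (M 1)) a = 0 := by simpa [show (s 1 : ℂ) ≠ 0 from hk'] using this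
    exact ha (h a (by intro k; fin_cases k <;> assumption))
  · obtain ⟨a, ha, e1, e2⟩ := hz 0 1
    have := hev a
    rw [e1, e2] at this
    have e0 : qv (cc (M 2)) a = 0 := by simpa [show (s 2 : ℂ) ≠ 0 from hk'] using this
    exact ha (h a (by intro k; fin_cases k <;> assumption))

lemma real_of_Q {x y z : Fin 6 → ℝ} {β γ : ℂ} (h : Q (cc x) = C β * Q (cc y) + C γ * Q (cc z)) :
    x = β.re • y + γ.re • z := by
  have h0 : cc x - β • cc y - γ • cc z = 0 := by
    apply qv_zero
    intro a
    have := congrArg (eval a) h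
    simp only [map_add, map_mul, eval_C, eval_Q] at this
    simp only [qv, Pi.sub_apply, Pi.smul_apply, smul_eq_mul] at this ⊢
    linear_combination this
  ext k
  have := congrArg Complex.re (congrFun h0 k)
  simp [cc] at this
  simp
  linarith

lemma real_syz {M H : Fin 3 → Fin 6 → ℝ} (h : NCZ M) (hs : Lm M H = 0) :
    ∃ α β γ : ℝ, H 0 = γ • M 1 - α • M 2 ∧ H 1 = -γ • M 0 - β • M 2 ∧ H 2 = α • M 0 + β • M 1 := by
  obtain ⟨α, β, γ, e1, e2, e3⟩ := syz_three (Q_hom (cc (M 0))) (Q_hom (cc (M 1))) (Q_hom (cc (M 2)))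
    (Q_hom (cc (H 0))) (Q_hom (cc (H 1))) (Q_hom (cc (H 2))) (by
      intro a
      simp only [eval_Q]
      intro a0 a1 a2
      exact h a (by intro k; fin_cases k <;> assumption)) (by
    apply MvPolynomial.funext
    intro a
    have := congrArg (fun c => quart (cc c) a) hs
    simp only [cc_Lm, quart_Lm, Fin.sum_univ_three] at this
    simp only [map_add, map_mul, eval_Q, map_zero]
    have z : quart (cc (0 : Fin 15 → ℝ)) a = 0 := by simp [quart, cc]
    rw [z] at this
    linear_combination this)
  refine ⟨α.re, β.re, γ.re, ?_, ?_, ?_⟩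
  · have := real_of_Q (x := H 0) (y := M 1) (z := M 2) (β := γ) (γ := -α) (by rw [e1, C_neg]; ring)
    rw [this]; simp [sub_eq_add_neg]
  · have := real_of_Q (x := H 1) (y := M 0) (z := M 2) (β := -γ) (γ := -β) (by
      rw [e2, C_neg, C_neg]; ring)
    rw [this]; simp [sub_eq_add_neg]
  · exact real_of_Q e3

lemma quart_ext {c d : Fin 15 → ℝ} (h : ∀ a, quart c a = quart d a) : c = d := by
  rw [← sub_eq_zero]
  apply quart_zero
  intro a
  rw [sub_eq_add_neg, ← neg_one_smul ℝ, quart_add, quart_smul, h]; ring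

lemma qmul_add (u v w : Fin 6 → ℝ) : qmul u (v + w) = qmul u v + qmul u w := by
  apply quart_ext; intro a; simp only [quart_add, quart_smul, quart_qmul]; simp [qv]; ring

lemma qmul_smul (t : ℝ) (u v : Fin 6 → ℝ) : qmul u (t • v) = t • qmul u v := by
  apply quart_ext; intro a; simp only [quart_add, quart_smul, quart_qmul]; simp [qv]; ring

lemma qmul_comm (u v : Fin 6 → ℝ) : qmul u v = qmul v u := by
  apply quart_ext; intro a; simp only [quart_add, quart_smul, quart_qmul]; simp [qv]; ring

lemma Lm_comm (M H : Fin 3 → Fin 6 → ℝ) : Lm M H = Lm H M := by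
  simp [Lm, qmul_comm]

/-- `Lm M` as a linear map -/
def Ll (M : Fin 3 → Fin 6 → ℝ) : (Fin 3 → Fin 6 → ℝ) →ₗ[ℝ] (Fin 15 → ℝ) where
  toFun := Lm M
  map_add' := by intro x y; simp only [Lm, Pi.add_apply, qmul_add, Finset.sum_add_distrib]
  map_smul' := by intro t x; simp only [Lm, Pi.smul_apply, qmul_smul, Finset.smul_sum, RingHom.id_apply]

/-- skew combinations -/
def skewL (M : Fin 3 → Fin 6 → ℝ) : (Fin 3 → ℝ) →ₗ[ℝ] (Fin 3 → Fin 6 → ℝ) where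
  toFun s := ![s 2 • M 1 - s 0 • M 2, -s 2 • M 0 - s 1 • M 2, s 0 • M 0 + s 1 • M 1]
  map_add' := by
    intro x y; ext i j; fin_cases i <;> simp <;> ring
  map_smul' := by
    intro x y; ext i j; fin_cases i <;> simp <;> ring

lemma Ll_surj {M : Fin 3 → Fin 6 → ℝ} (h : NCZ M) : Function.Surjective (Ll M) := by
  have hle : LinearMap.ker (Ll M) ≤ LinearMap.range (skewL M) := by
    intro H hH
    obtain ⟨α, β, γ, e1, e2, e3⟩ := real_syz h (LinearMap.mem_ker.1 hH)
    refine ⟨![α, β, γ], ?_⟩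
    ext i j
    fin_cases i
    · simp [skewL, e1]
    · simp [skewL, e2]
    · simp [skewL, e3]
  have h1 := Submodule.finrank_mono hle
  have h2 := LinearMap.finrank_range_le (skewL M)
  have h3 := LinearMap.finrank_range_add_finrank_ker (Ll M)
  rw [← LinearMap.range_eq_top]
  apply Submodule.eq_top_of_finrank_eq
  have h4 := Submodule.finrank_le (LinearMap.range (Ll M))
  simp only [Module.finrank_fintype_fun_eq_card, Fintype.card_fin] at h2 h4 ⊢
  have h5 : Module.finrank ℝ (Fin 3 → Fin 6 → ℝ) = 18 := by
    rw [Module.finrank_pi_fintype]; simp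
  omega

/-- key injectivity: two triples with the same sum of squares whose sum has no common zero have the same Gram matrix -/
lemma gm_eq_of {M M' : Fin 3 → Fin 6 → ℝ} (h : NCZ (M + M')) (hF : Fm M = Fm M') : gm M = gm M' := by
  have hs : Lm (M + M') (M' - M) = 0 := by
    have e1 : Lm (M + M') (M' - M) = Ll (M + M') M' - Ll (M + M') M := by
      rw [← map_sub]; rfl
    have e2 (x) : Ll (M + M') x = Lm x M + Lm x M' := by
      rw [show Ll (M + M') x = Lm (M + M') x from rfl, Lm_comm]
      exact (Ll x).map_add M M'
    rw [e1, e2, e2]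
    have : Lm M M = Lm M' M' := hF
    rw [this, Lm_comm M M']; abel
  obtain ⟨α, β, γ, e0, e1, e2⟩ := real_syz h hs
  ext i j
  simp only [gm, Matrix.of_apply, Fin.sum_univ_three]
  have f0 (i) := congrFun e0 i
  have f1 (i) := congrFun e1 i
  have f2 (i) := congrFun e2 i
  simp only [Pi.add_apply, Pi.sub_apply, Pi.smul_apply, smul_eq_mul] at f0 f1 f2
  linear_combination (-1/2) * ((M 0 i + M' 0 i) * f0 j + (M 1 i + M' 1 i) * f1 j
    + (M 2 i + M' 2 i) * f2 j + (M 0 j + M' 0 j) * f0 i + (M 1 j + M' 1 j) * f1 i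
    + (M 2 j + M' 2 j) * f2 i)

lemma sig_smul (t : ℝ) (A : Matrix (Fin 6) (Fin 6) ℝ) : sig (t • A) = t • sig A := by
  simp only [sig, Matrix.smul_cons, Matrix.smul_apply, smul_add, Matrix.smul_empty]

/-- `sig` as a linear map -/
def sigL : (Fin 6 → Fin 6 → ℝ) →ₗ[ℝ] (Fin 15 → ℝ) where
  toFun G := sig (Matrix.of G)
  map_add' _ _ := sig_add _ _
  map_smul' _ _ := sig_smul _ _

lemma Fm_contDiff : ContDiff ℝ 1 (Fm : (Fin 3 → Fin 6 → ℝ) → Fin 15 → ℝ) := by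
  have h1 : (Fm : (Fin 3 → Fin 6 → ℝ) → Fin 15 → ℝ) =
      fun M => LinearMap.toContinuousLinearMap sigL (fun i j => ∑ k, M k i * M k j) := by
    funext M
    exact (sig_gm M).symm
  rw [h1]
  apply (LinearMap.toContinuousLinearMap sigL).contDiff.comp
  fun_prop

lemma Fm_line (M H : Fin 3 → Fin 6 → ℝ) (t : ℝ) :
    Fm (M + t • H) = Fm M + t • ((2 : ℝ) • Lm M H) + t ^ 2 • Fm H := by
  have e : Fm (M + t • H) = Ll (M + t • H) M + t • Ll (M + t • H) H := by
    rw [← map_smul, ← map_add]; rfl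
  have e2 (x) : Ll (M + t • H) x = Lm x M + t • Lm x H := by
    rw [show Ll (M + t • H) x = Lm (M + t • H) x from rfl, Lm_comm]
    exact ((Ll x).map_add M (t • H)).trans (by rw [map_smul]; rfl)
  rw [e, e2, e2, Lm_comm H M, Fm, Fm]
  module

lemma Fm_open {M : Fin 3 → Fin 6 → ℝ} (h : NCZ M) : Filter.map Fm (nhds M) = nhds (Fm M) := by
  have hd : HasStrictFDerivAt Fm (fderiv ℝ Fm M) M :=
    Fm_contDiff.contDiffAt.hasStrictFDerivAt (by norm_num)
  apply hd.map_nhds_eq_of_surj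
  rw [LinearMap.range_eq_top]
  intro c
  obtain ⟨H, hH⟩ := Ll_surj h ((1/2 : ℝ) • c)
  refine ⟨H, ?_⟩
  have h1 := hd.hasFDerivAt.hasLineDerivAt H
  have h2 : HasLineDerivAt ℝ Fm c M H := by
    unfold HasLineDerivAt
    have : (fun t : ℝ => Fm (M + t • H)) = fun t => Fm M + t • c + t ^ 2 • Fm H := by
      ext1 t
      rw [Fm_line, show Lm M H = (1/2 : ℝ) • c from hH, smul_smul]
      norm_num [smul_smul]
      rw [mul_assoc]; norm_num
    rw [this]
    have h3 : HasDerivAt (fun t : ℝ => t • c) ((1:ℝ) • c) 0 := (hasDerivAt_id (0:ℝ)).smul_const c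
    have h4 : HasDerivAt (fun t : ℝ => t ^ 2 • Fm H) (((2:ℕ) * (0:ℝ) ^ (2-1) * 1) • Fm H) 0 :=
      ((hasDerivAt_id (0:ℝ)).pow 2).smul_const (Fm H)
    have h5 := (h3.const_add (Fm M)).add h4
    simp only [one_smul, mul_one, Nat.reduceSub, pow_one, mul_zero, zero_smul, add_zero] at h5
    exact h5
  exact h1.unique h2

end TQ

namespace TQ

open Filter Topology in
lemma fibre_const {X Y : Type*} [TopologicalSpace X] [T2Space X] [TopologicalSpace Y]
    (p : X → Y) (hp : IsProperMap p) (y0 : Y)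
    (hinj : ∀ x, p x = y0 → ∃ U ∈ 𝓝 x, Set.InjOn p U)
    (hop : ∀ x, p x = y0 → 𝓝 y0 ≤ map p (𝓝 x)) :
    ∀ᶠ y in 𝓝 y0, (p ⁻¹' {y}).ncard = (p ⁻¹' {y0}).ncard := by
  set S := p ⁻¹' {y0} with hS
  have hcomp : IsCompact S := hp.isCompact_preimage isCompact_singleton
  choose! W hW hWi using hinj
  have hfin : S.Finite := by
    obtain ⟨t, ht, hcov⟩ := hcomp.elim_nhds_subcover W (fun x hx => hW x hx)
    refine (t.finite_toSet).subset fun x hx => ?_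
    obtain ⟨z, hz, hxz⟩ := Set.mem_iUnion₂.1 (hcov hx)
    have : p x = p z := by rw [show p x = y0 from hx, show p z = y0 from ht z hz]
    have := hWi z (ht z hz) hxz (mem_of_mem_nhds (hW z (ht z hz))) this
    rw [this]; exact hz
  obtain ⟨U, hU, hdis⟩ := hfin.t2_separation
  let V : X → Set X := fun x => U x ∩ interior (W x)
  have hVo (x) : IsOpen (V x) := (hU x).2.inter isOpen_interior
  have hVm (x) (hx : x ∈ S) : x ∈ V x := ⟨(hU x).1, mem_interior_iff_mem_nhds.2 (hW x hx)⟩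
  have h1 : ∀ᶠ y in 𝓝 y0, ∀ x ∈ S, y ∈ p '' V x := by
    rw [Filter.eventually_all_finite hfin]
    intro x hx
    exact hop x hx (image_mem_map ((hVo x).mem_nhds (hVm x hx)))
  have h2 : ∀ᶠ y in 𝓝 y0, p ⁻¹' {y} ⊆ ⋃ x ∈ S, V x := by
    have hVU : IsOpen (⋃ x ∈ S, V x) := isOpen_biUnion fun x _ => hVo x
    have hcl := hp.isClosedMap _ hVU.isClosed_compl
    have : y0 ∈ (p '' (⋃ x ∈ S, V x)ᶜ)ᶜ := by
      rintro ⟨x, hx, hxy⟩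
      exact hx (Set.mem_biUnion (show x ∈ S from hxy) (hVm x hxy))
    filter_upwards [hcl.isOpen_compl.mem_nhds this] with y hy x hx
    by_contra hc
    exact hy ⟨x, hc, hx⟩
  filter_upwards [h1, h2] with y hy1 hy2
  choose! s hs1 hs2 using hy1
  have : p ⁻¹' {y} = s '' S := by
    ext z
    constructor
    · intro hz
      obtain ⟨x, hx, hzx⟩ := Set.mem_iUnion₂.1 (hy2 hz)
      refine ⟨x, hx, ?_⟩
      apply hWi x hx (interior_subset (hs1 x hx).2) (interior_subset hzx.2)
      rw [hs2 x hx]; exact hz.symm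
    · rintro ⟨x, hx, rfl⟩
      exact hs2 x hx
  rw [this]
  apply Set.InjOn.ncard_image
  intro a ha b hb hab
  by_contra hne
  exact Set.disjoint_left.1 (hdis ha hb hne) (hs1 a ha).1 (by
    rw [hab]; exact (hs1 b hb).1)

lemma continuous_Fm : Continuous (Fm : (Fin 3 → Fin 6 → ℝ) → Fin 15 → ℝ) := Fm_contDiff.continuous

lemma entry_bound (M : Fin 3 → Fin 6 → ℝ) (k i) : (M k i) ^ 2 ≤ 3 * ‖Fm M‖ := by
  have hn (j) : Fm M j ≤ ‖Fm M‖ := (le_abs_self _).trans (norm_le_pi_norm (Fm M) j)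
  have e0 : Fm M 0 = ∑ k, M k 0 ^ 2 := by
    simp [← sig_gm, sig, gm, Fin.sum_univ_three]; ring
  have e1 : Fm M 1 = ∑ k, M k 1 ^ 2 := by
    simp [← sig_gm, sig, gm, Fin.sum_univ_three]; ring
  have e2 : Fm M 2 = ∑ k, M k 2 ^ 2 := by
    simp [← sig_gm, sig, gm, Fin.sum_univ_three]; ring
  have e3 : Fm M 9 + Fm M 0 + Fm M 1 = ∑ k, (M k 3 ^ 2 + (M k 0 + M k 1) ^ 2) := by
    simp [← sig_gm, sig, gm, Fin.sum_univ_three]; ring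
  have e4 : Fm M 10 + Fm M 0 + Fm M 2 = ∑ k, (M k 4 ^ 2 + (M k 0 + M k 2) ^ 2) := by
    simp [← sig_gm, sig, gm, Fin.sum_univ_three]; ring
  have e5 : Fm M 11 + Fm M 1 + Fm M 2 = ∑ k, (M k 5 ^ 2 + (M k 1 + M k 2) ^ 2) := by
    simp [← sig_gm, sig, gm, Fin.sum_univ_three]; ring
  have key (g : Fin 3 → ℝ) (hg : ∀ k, 0 ≤ g k) : g k ≤ ∑ k, g k :=
    Finset.single_le_sum (fun i _ => hg i) (Finset.mem_univ k)
  have n0 := norm_nonneg (Fm M)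
  fin_cases i
  · have := key (fun k => M k 0 ^ 2) (fun k => by positivity)
    have := hn 0
    simp only [Fin.zero_eta] at *; linarith
  · have := key (fun k => M k 1 ^ 2) (fun k => by positivity)
    have := hn 1
    simp only [Fin.mk_one] at *; linarith
  · have := key (fun k => M k 2 ^ 2) (fun k => by positivity)
    have := hn 2
    simp only [Fin.reduceFinMk] at *; linarith
  · have := key (fun k => M k 3 ^ 2 + (M k 0 + M k 1) ^ 2) (fun k => by positivity)
    have := hn 9
    have := hn 0
    have := hn 1
    have := sq_nonneg (M k 0 + M k 1)
    simp only [Fin.reduceFinMk] at *; linarith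
  · have := key (fun k => M k 4 ^ 2 + (M k 0 + M k 2) ^ 2) (fun k => by positivity)
    have := hn 10
    have := hn 0
    have := hn 2
    have := sq_nonneg (M k 0 + M k 2)
    simp only [Fin.reduceFinMk] at *; linarith
  · have := key (fun k => M k 5 ^ 2 + (M k 1 + M k 2) ^ 2) (fun k => by positivity)
    have := hn 11
    have := hn 1
    have := hn 2
    have := sq_nonneg (M k 1 + M k 2)
    simp only [Fin.reduceFinMk] at *; linarith

lemma Fm_proper : IsProperMap (Fm : (Fin 3 → Fin 6 → ℝ) → Fin 15 → ℝ) := by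
  rw [isProperMap_iff_isCompact_preimage]
  refine ⟨continuous_Fm, fun K hK => ?_⟩
  apply Metric.isCompact_of_isClosed_isBounded (hK.isClosed.preimage continuous_Fm)
  obtain ⟨R, hR⟩ := hK.isBounded.exists_norm_le
  rw [isBounded_iff_forall_norm_le]
  refine ⟨3 * |R| + 1, fun M hM => ?_⟩
  rw [pi_norm_le_iff_of_nonneg (by positivity)]
  intro k
  rw [pi_norm_le_iff_of_nonneg (by positivity)]
  intro i
  have h1 := entry_bound M k i
  have h2 := (hR _ hM).trans (le_abs_self R)
  rw [Real.norm_eq_abs]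
  have := sq_abs (M k i)
  nlinarith [abs_nonneg (M k i), abs_nonneg R, sq_nonneg (|M k i| - 1)]

open Filter Topology in
lemma NCZ_open {M : Fin 3 → Fin 6 → ℝ} (h : NCZ M) : ∀ᶠ M' in 𝓝 M, NCZ M' := by
  have hK : IsCompact (Metric.sphere (0 : Fin 3 → ℂ) 1) := isCompact_sphere _ _
  have hc (k : Fin 3) : Continuous fun z : (Fin 3 → Fin 6 → ℝ) × (Fin 3 → ℂ) => qv (cc (z.1 k)) z.2 := by
    simp only [qv, cc]; fun_prop
  have : ∀ᶠ M' in 𝓝 M, ∀ a ∈ Metric.sphere (0 : Fin 3 → ℂ) 1, ∃ k, qv (cc (M' k)) a ≠ 0 := by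
    apply hK.eventually_forall_of_forall_eventually
    intro a ha
    have : ∃ k, qv (cc (M k)) a ≠ 0 := by
      by_contra hk; push Not at hk
      have := h a hk
      rw [this] at ha; simp at ha
    obtain ⟨k, hk⟩ := this
    have := (hc k).continuousAt.eventually_ne (x := (M, a)) hk
    filter_upwards [this] with z hz using ⟨k, hz⟩
  filter_upwards [this] with M' hM' a ha
  by_contra hne
  have hn : ‖a‖ ≠ 0 := norm_ne_zero_iff.2 hne
  obtain ⟨k, hk⟩ := hM' ((‖a‖⁻¹ : ℂ) • a) (by simp [norm_smul, hn])
  apply hk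
  have := ha k
  simp only [qv, Pi.smul_apply, smul_eq_mul] at this ⊢
  linear_combination (‖a‖⁻¹ : ℂ) ^ 2 * this

lemma gm_eq_mul (M : Fin 3 → Fin 6 → ℝ) : gm M = (Matrix.of M)ᵀ * Matrix.of M := by
  ext i j; simp [gm, Matrix.mul_apply]

lemma exists_orth {M M' : Fin 3 → Fin 6 → ℝ} (h : NCZ M) (hg : gm M = gm M') :
    ∃ O : Matrix (Fin 3) (Fin 3) ℝ, Oᵀ * O = 1 ∧ O * Oᵀ = 1 ∧ Matrix.of M' = O * Matrix.of M := by
  set A : Matrix (Fin 3) (Fin 6) ℝ := Matrix.of M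
  set B : Matrix (Fin 3) (Fin 6) ℝ := Matrix.of M'
  have hAB : Aᵀ * A = Bᵀ * B := by rw [← gm_eq_mul, ← gm_eq_mul, hg]
  have hunit : IsUnit (A * Aᵀ) := by
    rw [← Matrix.mulVec_injective_iff_isUnit]
    have hinj : Function.Injective (A * Aᵀ).mulVec := by
      intro s t hst
      rw [← sub_eq_zero]
      apply lin_of_ncz h
      have h1 : (A * Aᵀ) *ᵥ (s - t) = 0 := by rw [Matrix.mulVec_sub, sub_eq_zero]; exact hst
      have h2 : Aᵀ *ᵥ (s - t) = 0 := by
        rw [← Matrix.mulVec_mulVec] at h1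
        have := congrArg (fun v => (s - t) ⬝ᵥ v) h1
        simp only [dotProduct_zero] at this
        rw [Matrix.dotProduct_mulVec, ← Matrix.mulVec_transpose] at this
        exact dotProduct_self_eq_zero.1 this
      ext i
      have := congrFun h2 i
      simp only [Matrix.mulVec, dotProduct, Matrix.transpose_apply, Pi.zero_apply] at this
      simp only [Finset.sum_apply, Pi.smul_apply, smul_eq_mul, Pi.zero_apply]
      rw [← this]
      exact Finset.sum_congr rfl fun k _ => mul_comm _ _
    exact hinj
  have hdet : IsUnit (A * Aᵀ).det := (Matrix.isUnit_iff_isUnit_det _).1 hunit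
  have hsymm : ((A * Aᵀ)⁻¹)ᵀ = (A * Aᵀ)⁻¹ := by
    rw [Matrix.transpose_nonsing_inv]; simp
  have hi1 : (A * Aᵀ)⁻¹ * (A * Aᵀ) = 1 := Matrix.nonsing_inv_mul _ hdet
  have hi2 : (A * Aᵀ) * (A * Aᵀ)⁻¹ = 1 := Matrix.mul_nonsing_inv _ hdet
  set I := (A * Aᵀ)⁻¹
  -- kernel inclusion
  have hB : B = B * Aᵀ * I * A := by
    rw [← sub_eq_zero, ← Matrix.conjTranspose_mul_self_eq_zero,
      Matrix.conjTranspose_eq_transpose_of_trivial]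
    have e : B - B * Aᵀ * I * A = B * (1 - Aᵀ * I * A) := by
      rw [Matrix.mul_sub, Matrix.mul_one]; simp only [Matrix.mul_assoc]
    have e2 : A * (1 - Aᵀ * I * A) = 0 := by
      rw [Matrix.mul_sub, Matrix.mul_one, ← Matrix.mul_assoc, ← Matrix.mul_assoc, hi2]; simp
    rw [e]
    generalize 1 - Aᵀ * I * A = Z at e2
    rw [Matrix.transpose_mul, Matrix.mul_assoc, ← Matrix.mul_assoc Bᵀ, ← hAB, Matrix.mul_assoc, e2]
    simp
  refine ⟨B * Aᵀ * I, ?_, ?_, hB⟩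
  · have : (B * Aᵀ * I)ᵀ * (B * Aᵀ * I) = I * A * (Bᵀ * B) * Aᵀ * I := by
      simp only [Matrix.transpose_mul, hsymm, Matrix.transpose_transpose, Matrix.mul_assoc]
    rw [this, ← hAB]
    calc I * A * (Aᵀ * A) * Aᵀ * I = (I * (A * Aᵀ)) * ((A * Aᵀ) * I) := by
          simp only [Matrix.mul_assoc]
      _ = 1 := by rw [hi1, hi2, one_mul]
  · apply mul_eq_one_comm.1
    have : (B * Aᵀ * I)ᵀ * (B * Aᵀ * I) = I * A * (Bᵀ * B) * Aᵀ * I := by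
      simp only [Matrix.transpose_mul, hsymm, Matrix.transpose_transpose, Matrix.mul_assoc]
    rw [this, ← hAB]
    calc I * A * (Aᵀ * A) * Aᵀ * I = (I * (A * Aᵀ)) * ((A * Aᵀ) * I) := by
          simp only [Matrix.mul_assoc]
      _ = 1 := by rw [hi1, hi2, one_mul]

/-- rotating a triple of quadratic forms -/
def rot (O : Matrix (Fin 3) (Fin 3) ℝ) (N : Fin 3 → Fin 6 → ℝ) : Fin 3 → Fin 6 → ℝ :=
  fun k i => ∑ l, O l k * N l i

lemma of_rot (O : Matrix (Fin 3) (Fin 3) ℝ) (N) : Matrix.of (rot O N) = Oᵀ * Matrix.of N := by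
  ext k i; simp [rot, Matrix.mul_apply]

lemma rot_cont (O : Matrix (Fin 3) (Fin 3) ℝ) :
    Continuous fun z : (Fin 3 → Fin 6 → ℝ) × (Fin 3 → Fin 6 → ℝ) => z.1 + rot O z.2 := by
  have : Continuous (rot O) := by unfold rot; fun_prop
  exact continuous_fst.add (this.comp continuous_snd)

lemma gm_rot {O : Matrix (Fin 3) (Fin 3) ℝ} (h2 : O * Oᵀ = 1) (N) : gm (rot O N) = gm N := by
  rw [gm_eq_mul, gm_eq_mul, of_rot, Matrix.transpose_mul, Matrix.transpose_transpose,
      Matrix.mul_assoc, ← Matrix.mul_assoc O, h2, Matrix.one_mul]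

lemma ncz_double {M : Fin 3 → Fin 6 → ℝ} (h : NCZ M) : NCZ (M + M) := by
  intro a ha
  apply h
  intro k
  have := ha k
  simp only [qv, cc, Pi.add_apply, Complex.ofReal_add] at this ⊢
  linear_combination (1/2) * this

open Filter Topology in
lemma local_pair {M M' : Fin 3 → Fin 6 → ℝ} (h : NCZ M) (hg : gm M = gm M') :
    ∀ᶠ z in 𝓝 (M, M'), Fm z.1 = Fm z.2 → gm z.1 = gm z.2 := by
  obtain ⟨O, h1, h2, h3⟩ := exists_orth h hg
  have hTM : rot O M' = M := by
    have e : Matrix.of (rot O M') = Matrix.of M := by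
      rw [of_rot, h3, ← Matrix.mul_assoc, h1, Matrix.one_mul]
    exact e
  have hN : NCZ (M + rot O M') := by
    rw [hTM]
    exact ncz_double h
  have h4 : Tendsto (fun z : (Fin 3 → Fin 6 → ℝ) × (Fin 3 → Fin 6 → ℝ) => z.1 + rot O z.2)
    (𝓝 (M, M')) (𝓝 (M + rot O M')) := (rot_cont O).tendsto (M, M')
  refine (h4.eventually (NCZ_open hN)).mono ?_
  intro z hz hF
  rw [← gm_rot h2 z.2]
  apply gm_eq_of hz
  rw [hF, ← sig_gm, ← sig_gm, gm_rot h2]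

/-- Gram matrices of rank at most three representing `c` -/
def Gs (c : Fin 15 → ℝ) : Set (Matrix (Fin 6) (Fin 6) ℝ) := {G | ∃ M, gm M = G ∧ Fm M = c}

/-- the space of psd matrices of rank at most three -/
abbrev XX := Set.range (gm : (Fin 3 → Fin 6 → ℝ) → Matrix (Fin 6) (Fin 6) ℝ)

open Filter Topology in
lemma Gs_const {c : Fin 15 → ℝ} (hc : Smooth c) :
    ∀ᶠ d in 𝓝 c, (Gs d).ncard = (Gs c).ncard := by
  let g : (Fin 3 → Fin 6 → ℝ) → XX := fun M => ⟨gm M, M, rfl⟩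
  let p : XX → (Fin 15 → ℝ) := fun x => sig x.1
  have hpg : p ∘ g = Fm := by funext M; exact sig_gm M
  have hgc : Continuous g := by
    apply Continuous.subtype_mk
    unfold gm
    refine continuous_matrix fun i j => ?_
    simp only [Matrix.of_apply]; fun_prop
  have hgs : Function.Surjective g := by
    rintro ⟨_, M, rfl⟩; exact ⟨M, rfl⟩
  have hpc : Continuous p := by
    have : Continuous (sigL : (Fin 6 → Fin 6 → ℝ) → (Fin 15 → ℝ)) := LinearMap.continuous_of_finiteDimensional _
    exact this.comp continuous_subtype_val
  have hpp : IsProperMap p := isProperMap_of_comp_of_surj hgc hpc (hpg ▸ Fm_proper) hgs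
  have hgp : IsProperMap g := isProperMap_of_comp_of_t2 hgc hpc (hpg ▸ Fm_proper)
  have hncz (M) (hM : Fm M = c) : NCZ M := ncz_of_smooth (hM ▸ hc)
  have hfib (d) : (p ⁻¹' {d}).ncard = (Gs d).ncard := by
    have : Gs d = Subtype.val '' (p ⁻¹' {d}) := by
      ext G
      constructor
      · rintro ⟨M, rfl, hM⟩
        exact ⟨g M, (congrFun hpg M).trans hM, rfl⟩
      · rintro ⟨⟨_, M, rfl⟩, hx, rfl⟩
        exact ⟨M, rfl, (sig_gm M).symm.trans hx⟩
    rw [this, Set.ncard_image_of_injective _ Subtype.val_injective]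
  have := fibre_const p hpp c ?_ ?_
  · simpa only [hfib] using this
  · intro x hx
    have hcl := (hgp.prodMap hgp).isClosedMap
    have hcm := hcl.comap_nhds_eq (hgp.prodMap hgp).continuous (x, x)
    have hD : {z : (Fin 3 → Fin 6 → ℝ) × (Fin 3 → Fin 6 → ℝ) | Fm z.1 = Fm z.2 → gm z.1 = gm z.2} ∈
        𝓝ˢ (Prod.map g g ⁻¹' {(x, x)}) := by
      rw [mem_nhdsSet_iff_forall]
      rintro ⟨M, M'⟩ hMM
      simp only [Set.mem_preimage, Prod.map_apply, Set.mem_singleton_iff, Prod.mk.injEq] at hMM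
      apply local_pair
      · apply hncz
        rw [← hpg, Function.comp, hMM.1]; exact hx
      · exact congrArg Subtype.val (hMM.1.trans hMM.2.symm)
    rw [← hcm, mem_comap] at hD
    obtain ⟨t, ht, hsub⟩ := hD
    rw [nhds_prod_eq, mem_prod_same_iff] at ht
    obtain ⟨U, hU, hUt⟩ := ht
    refine ⟨U, hU, ?_⟩
    intro a ha b hb hab
    obtain ⟨M, rfl⟩ := hgs a
    obtain ⟨M', rfl⟩ := hgs b
    apply Subtype.ext
    refine hsub (a := (M, M')) (hUt ⟨ha, hb⟩) ?_
    have e1 := congrFun hpg M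
    have e2 := congrFun hpg M'
    exact e1.symm.trans (hab.trans e2)
  · intro x hx
    obtain ⟨M, rfl⟩ := hgs x
    have hM : Fm M = c := (congrFun hpg M).symm.trans hx
    rw [← hM, ← Fm_open (hncz M hM), ← hpg, ← Filter.map_map]
    exact map_mono hgc.continuousAt

/-- constancy along segments of smooth quartics -/
lemma Gs_segment {c d : Fin 15 → ℝ} (h : ∀ s ∈ Set.Icc (0:ℝ) 1, Smooth ((1 - s) • c + s • d)) :
    (Gs c).ncard = (Gs d).ncard := by
  let F : Set.Icc (0:ℝ) 1 → ℕ := fun s => (Gs ((1 - s.1) • c + s.1 • d)).ncard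
  have hF : IsLocallyConstant F := by
    rw [IsLocallyConstant.iff_eventually_eq]
    intro s
    have hc : Continuous fun s : Set.Icc (0:ℝ) 1 => (1 - s.1) • c + s.1 • d := by fun_prop
    exact hc.continuousAt.eventually (Gs_const (h s.1 s.2))
  have := hF.apply_eq_of_preconnectedSpace ⟨0, by simp⟩ ⟨1, by simp⟩
  simpa [F] using this

end TQ

namespace TQ

/-- positive definite quartics -/
def PD (c : Fin 15 → ℝ) : Prop := ∀ a : Fin 3 → ℝ, a ≠ 0 → 0 < quart c a

lemma lin_coeff_zero {g h k m : ℝ} (H : ∀ t : ℝ, 0 ≤ t * g + t ^ 2 * h + t ^ 3 * k + t ^ 4 * m) :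
    g = 0 := by
  have hd : HasDerivAt (fun t : ℝ => t * g + t ^ 2 * h + t ^ 3 * k + t ^ 4 * m) g 0 := by
    have h1 := ((((hasDerivAt_id (0:ℝ)).mul_const g).add
      (((hasDerivAt_id (0:ℝ)).pow 2).mul_const h)).add
      (((hasDerivAt_id (0:ℝ)).pow 3).mul_const k)).add
      (((hasDerivAt_id (0:ℝ)).pow 4).mul_const m)
    exact h1.congr_deriv (by simp)
  have hmin : IsLocalMin (fun t : ℝ => t * g + t ^ 2 * h + t ^ 3 * k + t ^ 4 * m) 0 := by
    refine Filter.Eventually.of_forall fun t => ?_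
    simpa using H t
  exact hmin.hasDerivAt_eq_zero hd

lemma grad_zero_of_min {c : Fin 15 → ℝ} (hp : ∀ a, 0 ≤ quart c a) {a : Fin 3 → ℝ}
    (h0 : quart c a = 0) : grad c a = 0 := by
  ext i
  fin_cases i
  · apply lin_coeff_zero (h := 6 * c 0 * a 0 ^ 2 + 3 * c 3 * a 0 * a 1 + 3 * c 4 * a 0 * a 2 + c 9 * a 1 ^ 2
      + c 10 * a 2 ^ 2 + c 12 * a 1 * a 2) (k := 4 * c 0 * a 0 + c 3 * a 1 + c 4 * a 2) (m := c 0)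
    intro t
    have := hp ![a 0 + t, a 1, a 2]
    refine le_of_le_of_eq this ?_
    refine (sub_zero _).symm.trans ?_
    rw [← h0]
    simp [quart, grad]; ring
  · apply lin_coeff_zero (h := 6 * c 1 * a 1 ^ 2 + 3 * c 5 * a 1 * a 0 + 3 * c 6 * a 1 * a 2 + c 9 * a 0 ^ 2
      + c 11 * a 2 ^ 2 + c 13 * a 0 * a 2) (k := 4 * c 1 * a 1 + c 5 * a 0 + c 6 * a 2) (m := c 1)
    intro t
    have := hp ![a 0, a 1 + t, a 2]
    refine le_of_le_of_eq this ?_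
    refine (sub_zero _).symm.trans ?_
    rw [← h0]
    simp [quart, grad]; ring
  · apply lin_coeff_zero (h := 6 * c 2 * a 2 ^ 2 + 3 * c 7 * a 2 * a 0 + 3 * c 8 * a 2 * a 1 + c 10 * a 0 ^ 2
      + c 11 * a 1 ^ 2 + c 14 * a 0 * a 1) (k := 4 * c 2 * a 2 + c 7 * a 0 + c 8 * a 1) (m := c 2)
    intro t
    have := hp ![a 0, a 1, a 2 + t]
    refine le_of_le_of_eq this ?_
    refine (sub_zero _).symm.trans ?_
    rw [← h0]
    simp [quart, grad]; ring

lemma grad_map {R S : Type*} [CommRing R] [CommRing S] (φ : R →+* S) (c : Fin 15 → R) (a) (i) :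
    φ (grad c a i) = grad (fun k => φ (c k)) (fun i => φ (a i)) i := by
  fin_cases i <;> simp [grad, map_ofNat]

lemma cc_grad (c : Fin 15 → ℝ) (a : Fin 3 → ℝ) : grad (cc c) (cc a) = cc (grad c a) := by
  ext i; exact (grad_map Complex.ofRealHom c a i).symm

lemma cc_ne {a : Fin 3 → ℝ} (h : cc a = 0) : a = 0 := by
  ext i; have := congrFun h i; simpa [cc] using this

lemma pd_of_smooth {c : Fin 15 → ℝ} (hs : Smooth c) (hp : ∀ a, 0 ≤ quart c a) : PD c := by
  intro a ha
  refine lt_of_le_of_ne (hp a) fun h0 => ha ?_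
  apply cc_ne
  apply hs
  rw [cc_grad, grad_zero_of_min hp h0.symm]
  ext; simp [cc]

lemma pd_convex {c d : Fin 15 → ℝ} (hc : PD c) (hd : PD d) {s : ℝ} (h0 : 0 ≤ s) (h1 : s ≤ 1) :
    PD ((1 - s) • c + s • d) := by
  intro a ha
  rw [quart_add, quart_smul, quart_smul]
  have := hc a ha
  have := hd a ha
  rcases h0.eq_or_lt with rfl | h
  · simpa
  · have : 0 ≤ (1 - s) * quart c a := mul_nonneg (by linarith) (by linarith)
    have : 0 < s * quart d a := by positivity
    linarith

lemma quart_hom {R : Type*} [CommRing R] (c : Fin 15 → R) (t : R) (a) : quart c (t • a) = t ^ 4 * quart c a := by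
  simp only [quart, Pi.smul_apply, smul_eq_mul]; ring

lemma grad_hom {R : Type*} [CommRing R] (c : Fin 15 → R) (t : R) (a) :
    grad c (t • a) = t ^ 3 • grad c a := by
  ext i; fin_cases i <;> simp [grad] <;> ring

open Filter Topology in
lemma PD_open : IsOpen {c : Fin 15 → ℝ | PD c} := by
  rw [isOpen_iff_mem_nhds]
  intro c hc
  have hK : IsCompact (Metric.sphere (0 : Fin 3 → ℝ) 1) := isCompact_sphere _ _
  have hcont : Continuous fun z : (Fin 15 → ℝ) × (Fin 3 → ℝ) => quart z.1 z.2 := by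
    simp only [quart]; fun_prop
  have : ∀ᶠ c' in 𝓝 c, ∀ a ∈ Metric.sphere (0 : Fin 3 → ℝ) 1, 0 < quart c' a := by
    apply hK.eventually_forall_of_forall_eventually
    intro a ha
    have hne : a ≠ 0 := by rintro rfl; simp at ha
    exact (hcont.continuousAt (x := (c, a))).eventually_const_lt (hc a hne)
  filter_upwards [this] with c' h a ha
  have hn : ‖a‖ ≠ 0 := norm_ne_zero_iff.2 ha
  have h1 := h (‖a‖⁻¹ • a) (by simp [norm_smul, hn])
  rw [quart_hom] at h1
  exact pos_of_mul_pos_right h1 (by positivity)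

/-- parametrisation of quartics singular at a non-real point with parameters `v` -/
def Phi (v : Fin 14 → ℝ) : Fin 15 → ℝ :=
  qmul ![v 0 ^ 2, v 1 ^ 2, 1, 2 * v 0 * v 1, -2 * v 0, -2 * v 1] ![v 4, v 5, v 6, v 7, v 8, v 9]
  + qmul ![-v 0 * v 10, -v 1 * v 11, 0, -v 0 * v 11 - v 1 * v 10, v 10, v 11] ![v 3, 1, 0, v 2, 0, 0]
  + v 12 • qmul ![v 3, 1, 0, v 2, 0, 0] ![v 3, 1, 0, v 2, 0, 0]

lemma qmul_contDiff {u v : (Fin 14 → ℝ) → Fin 6 → ℝ} (hu : ContDiff ℝ 1 u) (hv : ContDiff ℝ 1 v) :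
    ContDiff ℝ 1 fun x => qmul (u x) (v x) := by
  have h1 : (fun x => qmul (u x) (v x)) =
      fun x => LinearMap.toContinuousLinearMap sigL (fun i j => u x i * v x j) := rfl
  rw [h1]
  apply (LinearMap.toContinuousLinearMap sigL).contDiff.comp
  fun_prop

lemma Phi_contDiff : ContDiff ℝ 1 Phi := by
  unfold Phi
  have h1 : ContDiff ℝ 1 fun v : Fin 14 → ℝ => (![v 3, 1, 0, v 2, 0, 0] : Fin 6 → ℝ) := by
    rw [contDiff_pi]; intro i; fin_cases i <;> simp <;> fun_prop
  have h2 : ContDiff ℝ 1 fun v : Fin 14 → ℝ => (![v 4, v 5, v 6, v 7, v 8, v 9] : Fin 6 → ℝ) := by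
    rw [contDiff_pi]; intro i; fin_cases i <;> simp <;> fun_prop
  have h3 : ContDiff ℝ 1 fun v : Fin 14 → ℝ =>
      (![v 0 ^ 2, v 1 ^ 2, 1, 2 * v 0 * v 1, -2 * v 0, -2 * v 1] : Fin 6 → ℝ) := by
    rw [contDiff_pi]; intro i; fin_cases i <;> simp <;> fun_prop
  have h4 : ContDiff ℝ 1 fun v : Fin 14 → ℝ =>
      (![-v 0 * v 10, -v 1 * v 11, 0, -v 0 * v 11 - v 1 * v 10, v 10, v 11] : Fin 6 → ℝ) := by
    rw [contDiff_pi]; intro i; fin_cases i <;> simp <;> fun_prop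
  have h5 : ContDiff ℝ 1 fun v : Fin 14 → ℝ => v 12 := by fun_prop
  exact ((qmul_contDiff h3 h2).add (qmul_contDiff h4 h1)).add (h5.smul (qmul_contDiff h1 h1))

/-- coefficients of the part of the quartic linear in `l` -/
def cC {R : Type*} [CommRing R] (c : Fin 15 → R) (α β : R) : Fin 4 → R :=
  ![4 * c 2 * α ^ 3 + 3 * α ^ 2 * c 7 + 2 * α * c 10 + c 4,
    12 * c 2 * α ^ 2 * β + 3 * (α ^ 2 * c 8 + 2 * α * β * c 7) + 2 * (α * c 14 + β * c 10) + c 12,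
    12 * c 2 * α * β ^ 2 + 3 * (β ^ 2 * c 7 + 2 * α * β * c 8) + 2 * (β * c 14 + α * c 11) + c 13,
    4 * c 2 * β ^ 3 + 3 * β ^ 2 * c 8 + 2 * β * c 11 + c 6]

/-- coefficients of the part of the quartic free of `l` -/
def cD {R : Type*} [CommRing R] (c : Fin 15 → R) (α β : R) : Fin 5 → R :=
  ![c 2 * α ^ 4 + α ^ 3 * c 7 + α ^ 2 * c 10 + α * c 4 + c 0,
    4 * c 2 * α ^ 3 * β + α ^ 3 * c 8 + 3 * α ^ 2 * β * c 7 + α ^ 2 * c 14 + 2 * α * β * c 10 + α * c 12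
      + β * c 4 + c 3,
    6 * c 2 * α ^ 2 * β ^ 2 + 3 * α ^ 2 * β * c 8 + 3 * α * β ^ 2 * c 7 + α ^ 2 * c 11 + β ^ 2 * c 10
      + 2 * α * β * c 14 + α * c 13 + β * c 12 + c 9,
    4 * c 2 * α * β ^ 3 + β ^ 3 * c 7 + 3 * α * β ^ 2 * c 8 + β ^ 2 * c 14 + 2 * α * β * c 11 + β * c 13
      + α * c 6 + c 5,
    c 2 * β ^ 4 + β ^ 3 * c 8 + β ^ 2 * c 11 + β * c 6 + c 1]

/-- coefficients of the remaining quadratic factor -/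
def cA {R : Type*} [CommRing R] (c : Fin 15 → R) (α β : R) : Fin 6 → R :=
  ![3 * c 2 * α ^ 2 + 2 * α * c 7 + c 10, 3 * c 2 * β ^ 2 + 2 * β * c 8 + c 11, c 2,
    6 * c 2 * α * β + 2 * (α * c 8 + β * c 7) + c 14, 2 * c 2 * α + c 7, 2 * c 2 * β + c 8]

lemma decomp {R : Type*} [CommRing R] (c : Fin 15 → R) (α β : R) (a : Fin 3 → R) :
    quart c a = (a 2 - α * a 0 - β * a 1) ^ 2 * qv (cA c α β) a
      + (a 2 - α * a 0 - β * a 1) * (cC c α β 0 * a 0 ^ 3 + cC c α β 1 * a 0 ^ 2 * a 1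
        + cC c α β 2 * a 0 * a 1 ^ 2 + cC c α β 3 * a 1 ^ 3)
      + (cD c α β 0 * a 0 ^ 4 + cD c α β 1 * a 0 ^ 3 * a 1 + cD c α β 2 * a 0 ^ 2 * a 1 ^ 2
        + cD c α β 3 * a 0 * a 1 ^ 3 + cD c α β 4 * a 1 ^ 4) := by
  simp only [quart, qv, cA, cC, cD, Matrix.cons_val]; ring

lemma re_im_zero {e f : ℝ} {b : ℂ} (hb : b.im ≠ 0) (h : (e : ℂ) + f * b = 0) : e = 0 ∧ f = 0 := by
  have h1 := congrArg Complex.im h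
  have h2 := congrArg Complex.re h
  simp at h1 h2
  have hf : f = 0 := h1.resolve_right hb
  refine ⟨?_, hf⟩
  rw [hf] at h2; simpa using h2

lemma chart {c : Fin 15 → ℝ} {a : Fin 3 → ℂ} (hg : grad (cc c) a = 0)
    (hm : (a 0).re * (a 1).im - (a 0).im * (a 1).re ≠ 0) (t : ℝ) :
    ∃ v : Fin 14 → ℝ, v 13 = t ∧ Phi v = c := by
  -- solve for a 2
  obtain ⟨α, β, hab⟩ : ∃ α β : ℝ, a 2 = α * a 0 + β * a 1 := by
    refine ⟨((a 2).re * (a 1).im - (a 2).im * (a 1).re) / ((a 0).re * (a 1).im - (a 0).im * (a 1).re),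
      ((a 0).re * (a 2).im - (a 0).im * (a 2).re) / ((a 0).re * (a 1).im - (a 0).im * (a 1).re), ?_⟩
    apply Complex.ext
    · rw [Complex.add_re, Complex.re_ofReal_mul, Complex.re_ofReal_mul]
      rw [div_mul_eq_mul_div, div_mul_eq_mul_div, ← add_div, eq_div_iff hm]; ring
    · rw [Complex.add_im, Complex.im_ofReal_mul, Complex.im_ofReal_mul]
      rw [div_mul_eq_mul_div, div_mul_eq_mul_div, ← add_div, eq_div_iff hm]; ring
  have ha0 : a 0 ≠ 0 := by
    intro h; rw [h] at hm; simp at hm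
  set b := a 1 / a 0 with hb
  have hab1 : a 1 = b * a 0 := by rw [hb]; field_simp
  have hbim : b.im ≠ 0 := by
    intro h
    have : b = (b.re : ℂ) := Complex.ext (by simp) (by simp [h])
    rw [hab1, this] at hm
    apply hm
    rw [Complex.re_ofReal_mul, Complex.im_ofReal_mul]; ring
  set p : ℝ := -2 * b.re with hp
  set r : ℝ := b.re ^ 2 + b.im ^ 2 with hr
  have hdisc : 4 * r - p ^ 2 ≠ 0 := by
    rw [hp, hr]
    have : 4 * (b.re ^ 2 + b.im ^ 2) - (-2 * b.re) ^ 2 = 4 * b.im ^ 2 := by ring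
    rw [this]; positivity
  have hb2 : b ^ 2 = -p * b - r := by
    apply Complex.ext
    · simp [hp, hr, pow_two]; ring
    · simp [hp, hr, pow_two]; ring
  clear_value p r
  have g0 := congrFun hg 0
  have g1 := congrFun hg 1
  have g2 := congrFun hg 2
  simp only [grad, Matrix.cons_val, Pi.zero_apply, hab, hab1, cc] at g0 g1 g2
  have eC (i) : ((cC c α β i : ℝ) : ℂ) = cC (cc c) α β i := by
    fin_cases i <;> simp [cC, cc]
  have eD (i) : ((cD c α β i : ℝ) : ℂ) = cD (cc c) α β i := by
    fin_cases i <;> simp [cD, cc]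
  have hb3 : b ^ 3 = (p ^ 2 - r) * b + p * r := by
    linear_combination (b - p) * hb2
  have kC : ((cC c α β 0 : ℝ) : ℂ) + cC c α β 1 * b + cC c α β 2 * b ^ 2 + cC c α β 3 * b ^ 3 = 0 := by
    apply mul_left_cancel₀ (pow_ne_zero 3 ha0)
    simp only [eC]
    simp only [cC, Matrix.cons_val, cc]
    linear_combination g2
  have kD0 : 4 * ((cD c α β 0 : ℝ) : ℂ) + 3 * cD c α β 1 * b + 2 * cD c α β 2 * b ^ 2 + cD c α β 3 * b ^ 3 = 0 := by
    apply mul_left_cancel₀ (pow_ne_zero 3 ha0)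
    simp only [eD]
    simp only [cD, Matrix.cons_val, cc]
    linear_combination g0 + α * g2
  have kD1 : ((cD c α β 1 : ℝ) : ℂ) + 2 * cD c α β 2 * b + 3 * cD c α β 3 * b ^ 2 + 4 * cD c α β 4 * b ^ 3 = 0 := by
    apply mul_left_cancel₀ (pow_ne_zero 3 ha0)
    simp only [eD]
    simp only [cD, Matrix.cons_val, cc]
    linear_combination g1 + β * g2
  have dec := decomp c α β
  clear eC eD g0 g1 g2
  generalize cC c α β = K at *
  generalize cD c α β = D at *
  generalize cA c α β = A at *
  obtain ⟨x1, x2⟩ := re_im_zero (e := K 0 - r * K 2 + p * r * K 3) (f := K 1 - p * K 2 + (p ^ 2 - r) * K 3) hbim (by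
    push_cast
    linear_combination kC - K 2 * hb2 - K 3 * hb3)
  obtain ⟨y1, y2⟩ := re_im_zero (e := 4 * D 0 - 2 * r * D 2 + p * r * D 3)
    (f := 3 * D 1 - 2 * p * D 2 + (p ^ 2 - r) * D 3) hbim (by
    push_cast
    linear_combination kD0 - 2 * D 2 * hb2 - D 3 * hb3)
  obtain ⟨z1, z2⟩ := re_im_zero (e := D 1 - 3 * r * D 3 + 4 * p * r * D 4)
    (f := 2 * D 2 - 3 * p * D 3 + 4 * (p ^ 2 - r) * D 4) hbim (by
    push_cast
    linear_combination kD1 - 3 * D 3 * hb2 - 4 * D 4 * hb3)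
  have d3 : D 3 = 2 * p * D 4 := by
    have : (4 * r - p ^ 2) * (D 3 - 2 * p * D 4) = 0 := by
      linear_combination (1/2) * (y2 - 3 * z1 + p * z2)
    rcases mul_eq_zero.1 this with h | h
    · exact absurd h hdisc
    · linarith
  have d2 : D 2 = (p ^ 2 + 2 * r) * D 4 := by linear_combination (1/2) * z2 + (3/2) * p * d3
  have d1 : D 1 = 2 * p * r * D 4 := by linear_combination z1 + 3 * r * d3
  have d0 : D 0 = r ^ 2 * D 4 := by linear_combination (1/4) * y1 + (1/2) * r * d2 - (1/4) * p * r * d3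
  refine ⟨![α, β, p, r, A 0, A 1, A 2, A 3, A 4, A 5, K 2 - p * K 3, K 3, D 4, t], by simp, ?_⟩
  apply quart_ext
  intro w
  rw [dec w, Phi, quart_add, quart_add, quart_smul, quart_qmul, quart_qmul, quart_qmul, d0, d1, d2, d3]
  have k0 : K 0 = r * K 2 - p * r * K 3 := by linear_combination x1
  have k1 : K 1 = p * K 2 - (p ^ 2 - r) * K 3 := by linear_combination x2
  rw [k0, k1]
  simp only [qv, Matrix.cons_val]
  ring

end TQ

namespace TQ

/-- action of swapping `y, z` on coefficient indices -/
def τ1 : Fin 15 → Fin 15 := ![0, 2, 1, 4, 3, 7, 8, 5, 6, 10, 9, 11, 12, 14, 13]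

/-- action of swapping `x, z` on coefficient indices -/
def τ2 : Fin 15 → Fin 15 := ![2, 1, 0, 8, 7, 6, 5, 4, 3, 11, 10, 9, 14, 13, 12]

lemma τ1_inv (k) : τ1 (τ1 k) = k := by revert k; decide
lemma τ2_inv (k) : τ2 (τ2 k) = k := by revert k; decide

lemma grad_τ1 {c : Fin 15 → ℝ} {a : Fin 3 → ℂ} (h : grad (cc c) a = 0) :
    grad (cc fun k => c (τ1 k)) ![a 0, a 2, a 1] = 0 := by
  have h0 := congrFun h 0
  have h1 := congrFun h 1
  have h2 := congrFun h 2
  simp only [grad, cc, Matrix.cons_val, Pi.zero_apply] at h0 h1 h2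
  ext i
  fin_cases i
  · simp [grad, cc, τ1]; linear_combination h0
  · simp [grad, cc, τ1]; linear_combination h2
  · simp [grad, cc, τ1]; linear_combination h1

lemma grad_τ2 {c : Fin 15 → ℝ} {a : Fin 3 → ℂ} (h : grad (cc c) a = 0) :
    grad (cc fun k => c (τ2 k)) ![a 2, a 1, a 0] = 0 := by
  have h0 := congrFun h 0
  have h1 := congrFun h 1
  have h2 := congrFun h 2
  simp only [grad, cc, Matrix.cons_val, Pi.zero_apply] at h0 h1 h2
  ext i
  fin_cases i
  · simp [grad, cc, τ2]; linear_combination h2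
  · simp [grad, cc, τ2]; linear_combination h1
  · simp [grad, cc, τ2]; linear_combination h0

/-- quartics on a line through `f` and a singular quartic -/
def Psi (f : Fin 15 → ℝ) (τ : Fin 15 → Fin 15) (v : Fin 14 → ℝ) : Fin 15 → ℝ :=
  f + v 13 • ((fun k => Phi v (τ k)) - f)

lemma Psi_contDiff (f τ) : ContDiff ℝ 1 (Psi f τ) := by
  have h1 : ContDiff ℝ 1 fun v : Fin 14 → ℝ => fun k => Phi v (τ k) := by
    rw [contDiff_pi]; intro k
    exact (contDiff_pi.1 Phi_contDiff) (τ k)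
  have h5 : ContDiff ℝ 1 fun v : Fin 14 → ℝ => v 13 := by fun_prop
  exact contDiff_const.add (h5.smul (h1.sub contDiff_const))

/-- the bad set -/
def Bad (f : Fin 15 → ℝ) : Set (Fin 15 → ℝ) :=
  Set.range (Psi f id) ∪ Set.range (Psi f τ1) ∪ Set.range (Psi f τ2)

lemma Psi_dim (f τ) : dimH (Set.range (Psi f τ)) ≤ 14 := by
  have := (Psi_contDiff f τ).dimH_range_le
  simpa using this

lemma Bad_dim (f) : dimH (Bad f) ≤ 14 := by
  simp only [Bad, dimH_union, sup_le_iff]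
  exact ⟨⟨Psi_dim _ _, Psi_dim _ _⟩, Psi_dim _ _⟩

/-- a singular point of a positive definite quartic is not proportional to a real one -/
lemma minor_ne {c : Fin 15 → ℝ} (hp : PD c) {a : Fin 3 → ℂ} (ha : a ≠ 0) (hg : grad (cc c) a = 0) :
    ∃ i j, (a i).re * (a j).im - (a i).im * (a j).re ≠ 0 := by
  by_contra hno
  push Not at hno
  obtain ⟨i, hi⟩ : ∃ i, a i ≠ 0 := by
    by_contra h; push Not at h; exact ha (funext h)
  let w : Fin 3 → ℝ := fun j => (a j * (a i)⁻¹).re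
  have hw : a = (a i) • cc w := by
    ext j
    have him : (a j * (a i)⁻¹).im = 0 := by
      rw [Complex.mul_im, Complex.inv_im, Complex.inv_re]
      have := hno i j
      linear_combination (Complex.normSq (a i))⁻¹ * this
    have : ((w j : ℝ) : ℂ) = a j * (a i)⁻¹ := Complex.ext (by simp [w]) (by simp only [Complex.ofReal_im, him])
    simp only [Pi.smul_apply, smul_eq_mul, cc, this]
    field_simp
  have hg2 : grad (cc c) (cc w) = 0 := by
    rw [hw, grad_hom] at hg
    exact (smul_eq_zero.1 hg).resolve_left (pow_ne_zero 3 hi)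
  rw [cc_grad] at hg2
  have hg3 := cc_ne hg2
  have he := euler c w
  rw [hg3] at he
  have hw0 : w ≠ 0 := by
    intro h
    have h1 : (a i * (a i)⁻¹).re = 0 := congrFun h i
    rw [mul_inv_cancel₀ hi] at h1
    simp at h1
  have := hp w hw0
  simp at he
  linarith

lemma bad_of_singular {f g : Fin 15 → ℝ} {s : ℝ} (hs : 0 < s) (hp : PD ((1 - s) • f + s • g))
    (hns : ¬ Smooth ((1 - s) • f + s • g)) : g ∈ Bad f := by
  set c := (1 - s) • f + s • g with hc
  unfold Smooth at hns
  push Not at hns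
  obtain ⟨a, hg, ha⟩ := hns
  have key {τ : Fin 15 → Fin 15} (hτ : ∀ k, τ (τ k) = k) {v : Fin 14 → ℝ} (hv : v 13 = s⁻¹)
      (h : Phi v = fun k => c (τ k)) : Psi f τ v = g := by
    unfold Psi
    rw [hv, h]
    ext k
    simp only [hτ, Pi.add_apply, Pi.smul_apply, Pi.sub_apply, smul_eq_mul, hc]
    field_simp
    ring
  have case01 (h : (a 0).re * (a 1).im - (a 0).im * (a 1).re ≠ 0) : g ∈ Bad f := by
    obtain ⟨v, hv, h⟩ := chart hg h s⁻¹
    exact Or.inl (Or.inl ⟨v, key (τ := id) (fun _ => rfl) hv h⟩)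
  have case02 (h : (a 0).re * (a 2).im - (a 0).im * (a 2).re ≠ 0) : g ∈ Bad f := by
    obtain ⟨v, hv, h⟩ := chart (grad_τ1 hg) (by simpa using h) s⁻¹
    exact Or.inl (Or.inr ⟨v, key τ1_inv hv h⟩)
  have case12 (h : (a 2).re * (a 1).im - (a 2).im * (a 1).re ≠ 0) : g ∈ Bad f := by
    obtain ⟨v, hv, h⟩ := chart (grad_τ2 hg) (by simpa using h) s⁻¹
    exact Or.inr ⟨v, key τ2_inv hv h⟩
  obtain ⟨i, j, hij⟩ := minor_ne hp ha hg
  have hneg {i j : Fin 3} (h : (a i).re * (a j).im - (a i).im * (a j).re ≠ 0) :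
      (a j).re * (a i).im - (a j).im * (a i).re ≠ 0 := by
    intro h2; apply h; linarith
  fin_cases i <;> fin_cases j
  · exact absurd (by ring) hij
  · exact case01 hij
  · exact case02 hij
  · exact case01 (hneg hij)
  · exact absurd (by ring) hij
  · exact case12 (hneg hij)
  · exact case02 (hneg hij)
  · exact case12 hij
  · exact absurd (by ring) hij

lemma Gs_eq {f f0 : Fin 15 → ℝ} (hf : Smooth f) (hfp : PD f) (hf0 : Smooth f0) (hfp0 : PD f0) :
    (Gs f).ncard = (Gs f0).ncard := by
  have hd : dimH (Bad f ∪ Bad f0) < Module.finrank ℝ (Fin 15 → ℝ) := by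
    rw [dimH_union]
    refine lt_of_le_of_lt (sup_le (Bad_dim _) (Bad_dim _)) ?_
    simp only [Module.finrank_fintype_fun_eq_card, Fintype.card_fin]
    norm_num
  obtain ⟨g, hgp, hgb⟩ := (dense_compl_of_dimH_lt_finrank hd).exists_mem_open PD_open ⟨f, hfp⟩
  have seg {f : Fin 15 → ℝ} (hf : Smooth f) (hfp : PD f) (hb : g ∉ Bad f) :
      (Gs f).ncard = (Gs g).ncard := by
    apply Gs_segment
    rintro s ⟨hs0, hs1⟩
    rcases hs0.eq_or_lt with rfl | hs
    · simpa using hf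
    · by_contra hns
      exact hb (bad_of_singular hs (pd_convex hfp hgb hs0 hs1) hns)
  have hgp' : g ∉ Bad f ∪ Bad f0 := hgp
  rw [seg hf hfp fun h => hgp' (Or.inl h), seg hf0 hfp0 fun h => hgp' (Or.inr h)]

end TQ

namespace TQ

/-- Fermat quartic -/
def c0 : Fin 15 → ℝ := ![1, 1, 1, 0, 0, 0, 0, 0, 0, 0, 0, 0, 0, 0, 0]

lemma c0_smooth : Smooth c0 := by
  intro a h
  have h0 := congrFun h 0
  have h1 := congrFun h 1
  have h2 := congrFun h 2
  simp [grad, cc, c0] at h0 h1 h2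
  ext i; fin_cases i <;> simp [*]

lemma c0_pd : PD c0 := by
  apply pd_of_smooth c0_smooth
  intro a
  simp [quart, c0]; positivity

/-- the general Gram matrix of the Fermat quartic -/
def matT (A B C d e g : ℝ) : Matrix (Fin 6) (Fin 6) ℝ :=
  !![1, -A, -B, 0, 0, d; -A, 1, -C, 0, e, 0; -B, -C, 1, g, 0, 0; 0, 0, g, 2 * A, -d, -e;
    0, e, 0, -d, 2 * B, -g; d, 0, 0, -e, -g, 2 * C]

lemma det_rank {N K : Matrix (Fin 3) (Fin 4) ℝ} : (Nᵀ * K).det = 0 := by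
  by_contra h
  have hu : IsUnit (Nᵀ * K) := (Matrix.isUnit_iff_isUnit_det _).2 (isUnit_iff_ne_zero.2 h)
  have h1 := Matrix.rank_of_isUnit _ hu
  have h2 := Matrix.rank_mul_le_right Nᵀ K
  have h3 := Matrix.rank_le_card_height K
  simp at h1 h3
  omega

lemma minor_zero (M : Fin 3 → Fin 6 → ℝ) (r s : Fin 4 → Fin 6) : ((gm M).submatrix r s).det = 0 := by
  have : (gm M).submatrix r s = ((Matrix.of M).submatrix id r)ᵀ * ((Matrix.of M).submatrix id s) := by
    ext i j; simp [gm, Matrix.mul_apply]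
  rw [this, det_rank]

lemma det_four (G : Matrix (Fin 4) (Fin 4) ℝ) : G.det =
    G 0 0 * (G 1 1 * (G 2 2 * G 3 3 - G 2 3 * G 3 2) - G 1 2 * (G 2 1 * G 3 3 - G 2 3 * G 3 1)
      + G 1 3 * (G 2 1 * G 3 2 - G 2 2 * G 3 1))
    - G 0 1 * (G 1 0 * (G 2 2 * G 3 3 - G 2 3 * G 3 2) - G 1 2 * (G 2 0 * G 3 3 - G 2 3 * G 3 0)
      + G 1 3 * (G 2 0 * G 3 2 - G 2 2 * G 3 0))
    + G 0 2 * (G 1 0 * (G 2 1 * G 3 3 - G 2 3 * G 3 1) - G 1 1 * (G 2 0 * G 3 3 - G 2 3 * G 3 0)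
      + G 1 3 * (G 2 0 * G 3 1 - G 2 1 * G 3 0))
    - G 0 3 * (G 1 0 * (G 2 1 * G 3 2 - G 2 2 * G 3 1) - G 1 1 * (G 2 0 * G 3 2 - G 2 2 * G 3 0)
      + G 1 2 * (G 2 0 * G 3 1 - G 2 1 * G 3 0)) := by
  simp only [det_succ_row_zero, Fin.sum_univ_succ, submatrix_apply, Fin.succ_zero_eq_one, Fin.succ_one_eq_two]
  simp [Fin.succAbove, Fin.lt_def]
  ring

lemma gm_sym (M : Fin 3 → Fin 6 → ℝ) (i j) : gm M i j = gm M j i := by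
  simp [gm, mul_comm]

lemma cls {M : Fin 3 → Fin 6 → ℝ} (h : Fm M = c0) :
    gm M = matT (-gm M 0 1) (-gm M 0 2) (-gm M 1 2) (gm M 0 5) (gm M 1 4) (gm M 2 3) := by
  rw [← sig_gm] at h
  have hs := gm_sym M
  generalize gm M = G at *
  have f (k) := congrFun h k
  have e0 := f 0
  have e1 := f 1
  have e2 := f 2
  have e3 := f 3
  have e4 := f 4
  have e5 := f 5
  have e6 := f 6
  have e7 := f 7
  have e8 := f 8
  have e9 := f 9
  have e10 := f 10
  have e11 := f 11
  have e12 := f 12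
  have e13 := f 13
  have e14 := f 14
  simp only [sig, c0, Matrix.cons_val] at e0 e1 e2 e3 e4 e5 e6 e7 e8 e9 e10 e11 e12 e13 e14
  have s1 := hs 0 1
  have s2 := hs 0 2
  have s3 := hs 0 3
  have s4 := hs 0 4
  have s5 := hs 0 5
  have s6 := hs 1 2
  have s7 := hs 1 3
  have s8 := hs 1 4
  have s9 := hs 1 5
  have s10 := hs 2 3
  have s11 := hs 2 4
  have s12 := hs 2 5
  have s13 := hs 3 4
  have s14 := hs 3 5
  have s15 := hs 4 5
  clear h hs f
  ext i j
  fin_cases i <;> fin_cases j <;> simp [matT] <;> linarith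

set_option maxHeartbeats 1000000 in
lemma solve {A B C d e g D : ℝ} (hA : 0 ≤ A) (hB : 0 ≤ B) (hC : 0 ≤ C) (hA1 : A ≤ 1) (hB1 : B ≤ 1) (hC1 : C ≤ 1)
    (hD : D = 1 - 2 * A * B * C - A ^ 2 - B ^ 2 - C ^ 2) (hD0 : 0 ≤ D)
    (p1 : g ^ 2 * (1 - A ^ 2) = 2 * A * D) (p2 : e ^ 2 * (1 - B ^ 2) = 2 * B * D)
    (p3 : d ^ 2 * (1 - C ^ 2) = 2 * C * D)
    (m1 : -d * D = g * e * (C + A * B)) (m2 : -e * D = g * d * (B + A * C)) (m3 : -g * D = d * e * (A + B * C))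
    (z : d = 0 → e = 0 → g = 0 → A * B * C = 0 ∧ (1 - A ^ 2) * (B * C) = 0 ∧ (1 - B ^ 2) * (A * C) = 0
      ∧ (1 - C ^ 2) * (A * B) = 0)
    (zA : A = 0 → d = 0 ∧ e = 0) (zB : B = 0 → d = 0 ∧ g = 0) (zC : C = 0 → e = 0 ∧ g = 0) :
    (d = 0 ∧ e = 0 ∧ g = 0 ∧ (A = 0 ∧ B = 0 ∧ C = 0 ∨ A = 1 ∧ B = 0 ∧ C = 0 ∨ A = 0 ∧ B = 1 ∧ C = 0 ∨
      A = 0 ∧ B = 0 ∧ C = 1)) ∨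
    (A = √2 - 1 ∧ B = √2 - 1 ∧ C = √2 - 1 ∧ (
      d = -(2 - √2) ∧ e = -(2 - √2) ∧ g = -(2 - √2) ∨ d = -(2 - √2) ∧ e = (2 - √2) ∧ g = (2 - √2) ∨
      d = (2 - √2) ∧ e = -(2 - √2) ∧ g = (2 - √2) ∨ d = (2 - √2) ∧ e = (2 - √2) ∧ g = -(2 - √2))) := by
  by_cases h0 : d = 0 ∧ e = 0 ∧ g = 0
  · obtain ⟨rfl, rfl, rfl⟩ := h0
    left
    refine ⟨rfl, rfl, rfl, ?_⟩
    obtain ⟨z1, z2, z3, z4⟩ := z rfl rfl rfl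
    have q1 : A * D = 0 := by linarith
    have q2 : B * D = 0 := by linarith
    have q3 : C * D = 0 := by linarith
    have two : (A = 0 ∧ B = 0) ∨ (A = 0 ∧ C = 0) ∨ (B = 0 ∧ C = 0) := by
      rcases mul_eq_zero.1 z1 with h | h
      · rcases mul_eq_zero.1 h with h | h
        · rw [h] at z2; simp at z2; tauto
        · rw [h] at z3; simp at z3; tauto
      · rw [h] at z4; simp at z4; tauto
    have fin (x : ℝ) (hx : 0 ≤ x) (h : x * (1 - x ^ 2) = 0) : x = 0 ∨ x = 1 := by
      rcases mul_eq_zero.1 h with h | h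
      · exact Or.inl h
      · right; nlinarith
    rcases two with ⟨rfl, rfl⟩ | ⟨rfl, rfl⟩ | ⟨rfl, rfl⟩
    · rcases fin C hC (by rw [hD] at q3; linarith) with h | h <;> simp [h]
    · rcases fin B hB (by rw [hD] at q2; linarith) with h | h <;> simp [h]
    · rcases fin A hA (by rw [hD] at q1; linarith) with h | h <;> simp [h]
  right
  -- D is positive
  have hDpos : 0 < D := by
    rcases hD0.eq_or_lt with h | h
    · exfalso
      rw [← h] at p1 p2 p3 hD
      simp at p1 p2 p3
      have one {x y w : ℝ} (hx : x = 1) (hy : 0 ≤ y) (hw : 0 ≤ w)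
        (h : 0 = 1 - 2 * x * y * w - x ^ 2 - y ^ 2 - w ^ 2) : y = 0 ∧ w = 0 := by
        subst hx
        have := mul_nonneg hy hw
        constructor <;> nlinarith [sq_nonneg y, sq_nonneg w]
      have sq1 {x : ℝ} (hx : 0 ≤ x) (h : 1 - x ^ 2 = 0) : x = 1 := by nlinarith
      rcases p1 with h1 | h1
      · rcases p2 with h2 | h2
        · rcases p3 with h3 | h3
          · exact h0 ⟨h3, h2, h1⟩
          · obtain ⟨y, w⟩ := one (sq1 hC h3) hA hB (by linarith)
            exact h0 ⟨(zA y).1, (zA y).2, (zB w).2⟩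
        · obtain ⟨y, w⟩ := one (sq1 hB h2) hA hC (by linarith)
          exact h0 ⟨(zA y).1, (zA y).2, (zC w).2⟩
      · obtain ⟨y, w⟩ := one (sq1 hA h1) hB hC (by linarith)
        exact h0 ⟨(zB y).1, (zC w).1, (zC w).2⟩
    · exact h
  have hABC := mul_nonneg (mul_nonneg hA hB) hC
  have lA : 0 < 1 - A ^ 2 := by nlinarith [sq_nonneg B, sq_nonneg C]
  have lB : 0 < 1 - B ^ 2 := by nlinarith [sq_nonneg A, sq_nonneg C]
  have lC : 0 < 1 - C ^ 2 := by nlinarith [sq_nonneg B, sq_nonneg A]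
  have nA : A ≠ 0 := by
    intro h
    obtain ⟨x, y⟩ := zA h
    refine h0 ⟨x, y, ?_⟩
    rw [h] at p1; simp at p1; exact p1
  have nB : B ≠ 0 := by
    intro h
    obtain ⟨x, y⟩ := zB h
    refine h0 ⟨x, ?_, y⟩
    rw [h] at p2; simp at p2; exact p2
  have nC : C ≠ 0 := by
    intro h
    obtain ⟨x, y⟩ := zC h
    refine h0 ⟨?_, x, y⟩
    rw [h] at p3; simp at p3; exact p3
  have A0 : 0 < A := lt_of_le_of_ne hA nA.symm
  have B0 : 0 < B := lt_of_le_of_ne hB nB.symm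
  have C0 : 0 < C := lt_of_le_of_ne hC nC.symm
  clear z zA zB zC
  obtain ⟨T, hT⟩ : ∃ T, T = -(d * e * g) := ⟨_, rfl⟩
  have t1 : T * (C + A * B) * (1 - C ^ 2) = 2 * C * D ^ 2 := by
    rw [hT]; linear_combination d * (1 - C ^ 2) * m1 + D * p3
  have t2 : T * (B + A * C) * (1 - B ^ 2) = 2 * B * D ^ 2 := by
    rw [hT]; linear_combination e * (1 - B ^ 2) * m2 + D * p2
  have t3 : T * (A + B * C) * (1 - A ^ 2) = 2 * A * D ^ 2 := by
    rw [hT]; linear_combination g * (1 - A ^ 2) * m3 + D * p1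
  have Tpos : 0 < T := by
    have h1 : 0 < 2 * C * D ^ 2 := by positivity
    rw [← t1] at h1
    have h2 : 0 < (C + A * B) * (1 - C ^ 2) := by positivity
    rw [mul_assoc] at h1
    exact pos_of_mul_pos_left h1 h2.le
  have BC : B = C := by
    have : T * (A + B * C) * ((B + C) * (B - C)) = 0 := by linear_combination B * t1 - C * t2
    have h1 : T * (A + B * C) ≠ 0 := by positivity
    have h2 : B + C ≠ 0 := by positivity
    have := (mul_eq_zero.1 ((mul_eq_zero.1 this).resolve_left h1)).resolve_left h2
    linarith
  subst BC
  have AB : A = B := by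
    have : T * (B + A * B) * ((A + B) * (A - B)) = 0 := by linear_combination A * t1 - B * t3
    have h1 : T * (B + A * B) ≠ 0 := by positivity
    have h2 : A + B ≠ 0 := by positivity
    have := (mul_eq_zero.1 ((mul_eq_zero.1 this).resolve_left h1)).resolve_left h2
    linarith
  subst AB
  have hD' : D = (1 + A) ^ 2 * (1 - 2 * A) := by rw [hD]; ring
  have hA1' : 0 < 1 - A := by nlinarith
  have hA2 : 0 < 1 - 2 * A := by
    rw [hD'] at hDpos; exact pos_of_mul_pos_right hDpos (by positivity)
  have hT2 : T ^ 2 * (1 - A ^ 2) ^ 3 = (2 * A * D) ^ 3 := by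
    rw [hT]
    calc (-(d * e * g)) ^ 2 * (1 - A ^ 2) ^ 3 = (g ^ 2 * (1 - A ^ 2)) * (e ^ 2 * (1 - A ^ 2)) * (d ^ 2 * (1 - A ^ 2)) := by ring
      _ = _ := by rw [p1, p2, p3]; ring
  have hT1 : T * ((1 + A) * (1 - A ^ 2)) = 2 * D ^ 2 := by
    apply mul_left_cancel₀ nA
    linear_combination t1
  have hq : A ^ 2 + 2 * A - 1 = 0 := by
    have e1 : (2 * A * D) ^ 3 * (1 + A) ^ 2 = 4 * D ^ 4 * (1 - A ^ 2) := by
      rw [← hT2]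
      calc _ = (T * ((1 + A) * (1 - A ^ 2))) ^ 2 * (1 - A ^ 2) := by ring
        _ = _ := by rw [hT1]; ring
    have e2 : 4 * D ^ 3 * (1 + A) ^ 2 * (2 * A ^ 3 - (1 - 2 * A) * (1 - A ^ 2)) = 0 := by
      have : 4 * D ^ 3 * (1 + A) ^ 2 * (2 * A ^ 3 - (1 - 2 * A) * (1 - A ^ 2)) =
        (2 * A * D) ^ 3 * (1 + A) ^ 2 - 4 * D ^ 3 * ((1 + A) ^ 2 * (1 - 2 * A)) * (1 - A ^ 2) := by ring
      rw [this, ← hD', e1]; ring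
    have := (mul_eq_zero.1 e2).resolve_left (by positivity)
    linear_combination this
  have s2 : √2 ^ 2 = 2 := Real.sq_sqrt (by norm_num)
  have s0 : 0 ≤ √2 := Real.sqrt_nonneg 2
  have hAv : A = √2 - 1 := by
    have : (A + 1 - √2) * (A + 1 + √2) = 0 := by linear_combination hq - s2
    have := (mul_eq_zero.1 this).resolve_right (by positivity)
    linarith
  have h1A : 1 - A ^ 2 = 2 * A := by linarith
  have sq (x : ℝ) (h : x ^ 2 * (1 - A ^ 2) = 2 * A * D) : x = 2 - √2 ∨ x = -(2 - √2) := by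
    apply sq_eq_sq_iff_eq_or_eq_neg.1
    rw [h1A] at h
    have h2 : 2 * A ≠ 0 := by positivity
    have : x ^ 2 = D := by apply mul_left_cancel₀ h2; linarith
    rw [this, hD', hAv]
    linear_combination (-2 * √2 + 3 - 1) * s2
  have spos : 0 < 2 - √2 := by linarith
  have hneg : d * e * g < 0 := by linarith
  refine ⟨hAv, hAv, hAv, ?_⟩
  have cube : 0 < (2 - √2) * (2 - √2) * (2 - √2) := by positivity
  generalize 2 - √2 = s at *
  rcases sq d p3 with rfl | rfl <;> rcases sq e p2 with rfl | rfl <;> rcases sq g p1 with rfl | rfl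
  · exfalso; linarith
  · tauto
  · tauto
  · exfalso; linarith
  · tauto
  · exfalso; linarith
  · exfalso; linarith
  · tauto

end TQ

namespace TQ

set_option maxHeartbeats 1000000 in
lemma minors {M : Fin 3 → Fin 6 → ℝ} {A B C d e g D : ℝ} (h : gm M = matT A B C d e g)
    (hD : D = 1 - 2 * A * B * C - A ^ 2 - B ^ 2 - C ^ 2) :
    (g ^ 2 * (1 - A ^ 2) = 2 * A * D) ∧ (e ^ 2 * (1 - B ^ 2) = 2 * B * D) ∧
    (d ^ 2 * (1 - C ^ 2) = 2 * C * D) ∧ (-d * D = g * e * (C + A * B)) ∧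
    (-e * D = g * d * (B + A * C)) ∧ (-g * D = d * e * (A + B * C)) ∧
    (d = 0 → e = 0 → g = 0 → A * B * C = 0 ∧ (1 - A ^ 2) * (B * C) = 0 ∧ (1 - B ^ 2) * (A * C) = 0
      ∧ (1 - C ^ 2) * (A * B) = 0) := by
  have mz := minor_zero M
  simp only [h, det_four, submatrix_apply] at mz
  subst hD
  refine ⟨?_, ?_, ?_, ?_, ?_, ?_, ?_⟩
  · have := mz ![0, 1, 2, 3] ![0, 1, 2, 3]
    simp [matT] at this
    linear_combination -this
  · have := mz ![0, 1, 2, 4] ![0, 1, 2, 4]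
    simp [matT] at this
    linear_combination -this
  · have := mz ![0, 1, 2, 5] ![0, 1, 2, 5]
    simp [matT] at this
    linear_combination -this
  · have := mz ![0, 1, 2, 3] ![0, 1, 2, 4]
    simp [matT] at this
    linear_combination this
  · have := mz ![0, 1, 2, 3] ![0, 1, 2, 5]
    simp [matT] at this
    linear_combination this
  · have := mz ![0, 1, 2, 4] ![0, 1, 2, 5]
    simp [matT] at this
    linear_combination this
  · rintro rfl rfl rfl
    refine ⟨?_, ?_, ?_, ?_⟩
    · have := mz ![0, 3, 4, 5] ![0, 3, 4, 5]
      simp only [matT, of_apply, Matrix.cons_val] at this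
      linear_combination this / 8
    · have := mz ![0, 1, 4, 5] ![0, 1, 4, 5]
      simp only [matT, of_apply, Matrix.cons_val] at this
      linear_combination this / 4
    · have := mz ![0, 2, 3, 5] ![0, 2, 3, 5]
      simp only [matT, of_apply, Matrix.cons_val] at this
      linear_combination this / 4
    · have := mz ![1, 2, 3, 4] ![1, 2, 3, 4]
      simp only [matT, of_apply, Matrix.cons_val] at this
      linear_combination this / 4

set_option maxHeartbeats 1000000 in
lemma ineqs {M : Fin 3 → Fin 6 → ℝ} {A B C d e g D : ℝ} (h : gm M = matT A B C d e g)
    (hD : D = 1 - 2 * A * B * C - A ^ 2 - B ^ 2 - C ^ 2) :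
    0 ≤ A ∧ 0 ≤ B ∧ 0 ≤ C ∧ A ≤ 1 ∧ B ≤ 1 ∧ C ≤ 1 ∧ 0 ≤ D ∧
    (A = 0 → d = 0 ∧ e = 0) ∧ (B = 0 → d = 0 ∧ g = 0) ∧ (C = 0 → e = 0 ∧ g = 0) := by
  have en (i j) : M 0 i * M 0 j + M 1 i * M 1 j + M 2 i * M 2 j = matT A B C d e g i j := by
    rw [← h]; simp [gm, Fin.sum_univ_three]
  have e00 := en 0 0
  have e11 := en 1 1
  have e22 := en 2 2
  have e33 := en 3 3
  have e44 := en 4 4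
  have e55 := en 5 5
  have e01 := en 0 1
  have e02 := en 0 2
  have e12 := en 1 2
  have e34 := en 3 4
  have e35 := en 3 5
  have e45 := en 4 5
  simp [matT] at e00 e11 e22 e33 e44 e55 e01 e02 e12 e34 e35 e45
  clear en h
  refine ⟨?_, ?_, ?_, ?_, ?_, ?_, ?_, ?_, ?_, ?_⟩
  · linarith [mul_self_nonneg (M 0 3), mul_self_nonneg (M 1 3), mul_self_nonneg (M 2 3)]
  · linarith [mul_self_nonneg (M 0 4), mul_self_nonneg (M 1 4), mul_self_nonneg (M 2 4)]
  · linarith [mul_self_nonneg (M 0 5), mul_self_nonneg (M 1 5), mul_self_nonneg (M 2 5)]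
  · linarith [mul_self_nonneg (M 0 0 + M 0 1), mul_self_nonneg (M 1 0 + M 1 1), mul_self_nonneg (M 2 0 + M 2 1)]
  · linarith [mul_self_nonneg (M 0 0 + M 0 2), mul_self_nonneg (M 1 0 + M 1 2), mul_self_nonneg (M 2 0 + M 2 2)]
  · linarith [mul_self_nonneg (M 0 2 + M 0 1), mul_self_nonneg (M 1 2 + M 1 1), mul_self_nonneg (M 2 2 + M 2 1)]
  · have : D = (M 0 0 * (M 1 1 * M 2 2 - M 1 2 * M 2 1) - M 0 1 * (M 1 0 * M 2 2 - M 1 2 * M 2 0)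
        + M 0 2 * (M 1 0 * M 2 1 - M 1 1 * M 2 0)) ^ 2 := by
      have a1 : A = -(M 0 0 * M 0 1 + M 1 0 * M 1 1 + M 2 0 * M 2 1) := by linarith
      have a2 : B = -(M 0 0 * M 0 2 + M 1 0 * M 1 2 + M 2 0 * M 2 2) := by linarith
      have a3 : C = -(M 0 1 * M 0 2 + M 1 1 * M 1 2 + M 2 1 * M 2 2) := by linarith
      have : D = (M 0 0 * M 0 0 + M 1 0 * M 1 0 + M 2 0 * M 2 0) * (M 0 1 * M 0 1 + M 1 1 * M 1 1 + M 2 1 * M 2 1)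
        * (M 0 2 * M 0 2 + M 1 2 * M 1 2 + M 2 2 * M 2 2) - 2 * A * B * C
        - A ^ 2 * (M 0 2 * M 0 2 + M 1 2 * M 1 2 + M 2 2 * M 2 2)
        - B ^ 2 * (M 0 1 * M 0 1 + M 1 1 * M 1 1 + M 2 1 * M 2 1)
        - C ^ 2 * (M 0 0 * M 0 0 + M 1 0 * M 1 0 + M 2 0 * M 2 0) := by
        rw [e00, e11, e22, hD]; ring
      rw [this, a1, a2, a3]; ring
    rw [this]; positivity
  · intro hA
    have z0 : M 0 3 = 0 := mul_self_eq_zero.1 (by linarith [mul_self_nonneg (M 0 3), mul_self_nonneg (M 1 3), mul_self_nonneg (M 2 3)])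
    have z1 : M 1 3 = 0 := mul_self_eq_zero.1 (by linarith [mul_self_nonneg (M 0 3), mul_self_nonneg (M 1 3), mul_self_nonneg (M 2 3)])
    have z2 : M 2 3 = 0 := mul_self_eq_zero.1 (by linarith [mul_self_nonneg (M 0 3), mul_self_nonneg (M 1 3), mul_self_nonneg (M 2 3)])
    rw [z0, z1, z2] at e34 e35
    constructor <;> linarith
  · intro hB
    have z0 : M 0 4 = 0 := mul_self_eq_zero.1 (by linarith [mul_self_nonneg (M 0 4), mul_self_nonneg (M 1 4), mul_self_nonneg (M 2 4)])
    have z1 : M 1 4 = 0 := mul_self_eq_zero.1 (by linarith [mul_self_nonneg (M 0 4), mul_self_nonneg (M 1 4), mul_self_nonneg (M 2 4)])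
    have z2 : M 2 4 = 0 := mul_self_eq_zero.1 (by linarith [mul_self_nonneg (M 0 4), mul_self_nonneg (M 1 4), mul_self_nonneg (M 2 4)])
    rw [z0, z1, z2] at e34 e45
    constructor <;> linarith
  · intro hC
    have z0 : M 0 5 = 0 := mul_self_eq_zero.1 (by linarith [mul_self_nonneg (M 0 5), mul_self_nonneg (M 1 5), mul_self_nonneg (M 2 5)])
    have z1 : M 1 5 = 0 := mul_self_eq_zero.1 (by linarith [mul_self_nonneg (M 0 5), mul_self_nonneg (M 1 5), mul_self_nonneg (M 2 5)])
    have z2 : M 2 5 = 0 := mul_self_eq_zero.1 (by linarith [mul_self_nonneg (M 0 5), mul_self_nonneg (M 1 5), mul_self_nonneg (M 2 5)])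
    rw [z0, z1, z2] at e35 e45
    constructor <;> linarith

lemma nec {M : Fin 3 → Fin 6 → ℝ} (hM : Fm M = c0) : ∃ A B C d e g : ℝ, gm M = matT A B C d e g ∧
   ((d = 0 ∧ e = 0 ∧ g = 0 ∧ (A = 0 ∧ B = 0 ∧ C = 0 ∨ A = 1 ∧ B = 0 ∧ C = 0 ∨ A = 0 ∧ B = 1 ∧ C = 0 ∨
      A = 0 ∧ B = 0 ∧ C = 1)) ∨
    (A = √2 - 1 ∧ B = √2 - 1 ∧ C = √2 - 1 ∧ (
      d = -(2 - √2) ∧ e = -(2 - √2) ∧ g = -(2 - √2) ∨ d = -(2 - √2) ∧ e = (2 - √2) ∧ g = (2 - √2) ∨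
      d = (2 - √2) ∧ e = -(2 - √2) ∧ g = (2 - √2) ∨ d = (2 - √2) ∧ e = (2 - √2) ∧ g = -(2 - √2)))) := by
  refine ⟨_, _, _, _, _, _, cls hM, ?_⟩
  obtain ⟨p1, p2, p3, m1, m2, m3, z⟩ := minors (cls hM) rfl
  obtain ⟨hA, hB, hC, hA1, hB1, hC1, hD0, zA, zB, zC⟩ := ineqs (cls hM) rfl
  exact solve hA hB hC hA1 hB1 hC1 rfl hD0 p1 p2 p3 m1 m2 m3 z zA zB zC

end TQ

namespace TQ

lemma sig_matT (A B C d e g : ℝ) : sig (matT A B C d e g) = c0 := by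
  ext i; fin_cases i <;> simp [sig, matT, c0] <;> ring

lemma mem_of {M : Fin 3 → Fin 6 → ℝ} {A B C d e g : ℝ} (h : gm M = matT A B C d e g) :
    matT A B C d e g ∈ Gs c0 := ⟨M, h, by rw [← sig_gm, h, sig_matT]⟩

lemma ex0 : matT 0 0 0 0 0 0 ∈ Gs c0 := by
  apply mem_of (M := ![![1, 0, 0, 0, 0, 0], ![0, 1, 0, 0, 0, 0], ![0, 0, 1, 0, 0, 0]])
  ext i j; fin_cases i <;> fin_cases j <;> simp [gm, matT, Fin.sum_univ_three]

lemma exA : matT 1 0 0 0 0 0 ∈ Gs c0 := by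
  apply mem_of (M := ![![1, -1, 0, 0, 0, 0], ![0, 0, 0, √2, 0, 0], ![0, 0, 1, 0, 0, 0]])
  ext i j; fin_cases i <;> fin_cases j <;> simp [gm, matT, Fin.sum_univ_three]

lemma exB : matT 0 1 0 0 0 0 ∈ Gs c0 := by
  apply mem_of (M := ![![1, 0, -1, 0, 0, 0], ![0, 0, 0, 0, √2, 0], ![0, 1, 0, 0, 0, 0]])
  ext i j; fin_cases i <;> fin_cases j <;> simp [gm, matT, Fin.sum_univ_three]

lemma exC : matT 0 0 1 0 0 0 ∈ Gs c0 := by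
  apply mem_of (M := ![![0, 1, -1, 0, 0, 0], ![0, 0, 0, 0, 0, √2], ![1, 0, 0, 0, 0, 0]])
  ext i j; fin_cases i <;> fin_cases j <;> simp [gm, matT, Fin.sum_univ_three]

set_option maxHeartbeats 2000000 in
lemma exT {u0 u1 u2 v0 v1 v2 w0 w1 w2 t s x y z : ℝ} (uu : u0 * u0 + u1 * u1 + u2 * u2 = 1)
    (vv : v0 * v0 + v1 * v1 + v2 * v2 = 1) (ww : w0 * w0 + w1 * w1 + w2 * w2 = 1)
    (uv : u0 * v0 + u1 * v1 + u2 * v2 = -t) (uw : u0 * w0 + u1 * w1 + u2 * w2 = -t)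
    (vw : v0 * w0 + v1 * w1 + v2 * w2 = -t) (ht : t ^ 2 + 2 * t = 1) (hs : t + t ^ 2 = s)
    (det : u0 * (v1 * w2 - v2 * w1) + u1 * (v2 * w0 - v0 * w2) + u2 * (v0 * w1 - v1 * w0) = s)
    (hx : x * x = 1) (hy : y * y = 1) (hz : z * z = 1) (hxyz : x * y = z) :
    matT t t t (z * s) (-(y * s)) (x * s) ∈ Gs c0 := by
  have hxz : x * z = y := by rw [← hxyz, ← mul_assoc, hx, one_mul]
  have hyz : y * z = x := by rw [← hxyz, mul_comm x, ← mul_assoc, hy, one_mul]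
  apply mem_of (M := ![![u0, v0, w0, x * (u1 * v2 - u2 * v1), y * (u1 * w2 - u2 * w1), z * (v1 * w2 - v2 * w1)],
    ![u1, v1, w1, x * (u2 * v0 - u0 * v2), y * (u2 * w0 - u0 * w2), z * (v2 * w0 - v0 * w2)],
    ![u2, v2, w2, x * (u0 * v1 - u1 * v0), y * (u0 * w1 - u1 * w0), z * (v0 * w1 - v1 * w0)]])
  have lag (a0 a1 a2 b0 b1 b2 c0 c1 c2 d0 d1 d2 p q r o k l m : ℝ) (hk : k * l = m)
     (h1 : a0 * c0 + a1 * c1 + a2 * c2 = p) (h2 : b0 * d0 + b1 * d1 + b2 * d2 = q)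
     (h3 : a0 * d0 + a1 * d1 + a2 * d2 = r) (h4 : b0 * c0 + b1 * c1 + b2 * c2 = o) :
     k * (a1 * b2 - a2 * b1) * (l * (c1 * d2 - c2 * d1)) + k * (a2 * b0 - a0 * b2) * (l * (c2 * d0 - c0 * d2))
      + k * (a0 * b1 - a1 * b0) * (l * (c0 * d1 - c1 * d0)) = m * (p * q - r * o) := by
    rw [← hk, ← h1, ← h2, ← h3, ← h4]; ring
  have vu : v0 * u0 + v1 * u1 + v2 * u2 = -t := by linarith
  have wu : w0 * u0 + w1 * u1 + w2 * u2 = -t := by linarith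
  have wv : w0 * v0 + w1 * v1 + w2 * v2 = -t := by linarith
  have e33 := lag _ _ _ _ _ _ _ _ _ _ _ _ _ _ _ _ x x _ hx uu vv uv vu
  have e44 := lag _ _ _ _ _ _ _ _ _ _ _ _ _ _ _ _ y y _ hy uu ww uw wu
  have e55 := lag _ _ _ _ _ _ _ _ _ _ _ _ _ _ _ _ z z _ hz vv ww vw wv
  have e34 := lag _ _ _ _ _ _ _ _ _ _ _ _ _ _ _ _ x y _ hxyz uu vw uw vu
  have e35 := lag _ _ _ _ _ _ _ _ _ _ _ _ _ _ _ _ x z _ hxz uv vw uw vv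
  have e45 := lag _ _ _ _ _ _ _ _ _ _ _ _ _ _ _ _ y z _ hyz uv ww uw wv
  clear lag
  apply Matrix.ext
  have symm : ∀ N : Matrix (Fin 6) (Fin 6) ℝ, ∀ N' : Matrix (Fin 6) (Fin 6) ℝ, (∀ i j, N i j = N j i) →
      (∀ i j, N' i j = N' j i) → (∀ i j, i ≤ j → N i j = N' i j) → ∀ i j, N i j = N' i j := by
    intro N N' h1 h2 h3 i j
    rcases le_total i j with h | h
    · exact h3 i j h
    · rw [h1, h2]; exact h3 _ _ h
  apply symm _ _ (gm_sym _)
  · intro i j; fin_cases i <;> fin_cases j <;> rfl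
  intro i j hij
  simp only [gm, Fin.sum_univ_three, of_apply, Matrix.cons_val_zero, Matrix.cons_val_one, Matrix.cons_val]
  fin_cases i <;> fin_cases j <;> first | (exfalso; revert hij; decide) | skip
  all_goals simp only [matT, of_apply, Fin.zero_eta, Fin.mk_one, Fin.reduceFinMk, Matrix.cons_val]
  · linear_combination uu
  · linear_combination uv
  · linear_combination uw
  · ring
  · ring
  · linear_combination z * det
  · linear_combination vv
  · linear_combination vw
  · ring
  · linear_combination -y * det
  · ring
  · linear_combination ww
  · linear_combination x * det
  · ring
  · ring
  · linear_combination e33 - ht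
  · linear_combination e34 - z * hs
  · linear_combination e35 + y * hs
  · linear_combination e44 - ht
  · linear_combination e45 - x * hs
  · linear_combination e55 - ht

lemma exT' {x y z : ℝ} (hx : x * x = 1) (hy : y * y = 1) (hz : z * z = 1) (hxyz : x * y = z) :
    matT (√2 - 1) (√2 - 1) (√2 - 1) (z * (2 - √2)) (-(y * (2 - √2))) (x * (2 - √2)) ∈ Gs c0 := by
  obtain ⟨r, hr⟩ : ∃ r, r = √2 := ⟨_, rfl⟩
  have r2 : r ^ 2 = 2 := by rw [hr]; exact Real.sq_sqrt (by norm_num)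
  obtain ⟨q, hq⟩ : ∃ q : ℝ, q ^ 2 = r := ⟨√r, Real.sq_sqrt (by rw [hr]; positivity)⟩
  rw [← hr]
  obtain ⟨b, hb⟩ : ∃ b : ℝ, 3 * b = r - 1 - q := ⟨(r - 1 - q) / 3, by ring⟩
  have k : 2 * q * b + 3 * b ^ 2 = -(r - 1) := by
    linear_combination (2 * q + 3 * b + r - 1 - q) / 3 * hb + r2 / 3 - hq / 3
  have dg : (q + b) * (q + b) + b * b + b * b = 1 := by linear_combination k + hq
  refine exT (u0 := q + b) (u1 := b) (u2 := b) (v0 := b) (v1 := q + b) (v2 := b)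
    (w0 := b) (w1 := b) (w2 := q + b) (by linarith) (by linarith) (by linarith) (by linarith) (by linarith)
    (by linarith) (by linear_combination r2) (by linear_combination r2) ?_ hx hy hz hxyz
  linear_combination q ^ 2 * hb + (r - 1) * hq + r2

/-- the eight Gram matrices of the Fermat quartic -/
noncomputable def eight (t s : ℝ) : Fin 8 → Matrix (Fin 6) (Fin 6) ℝ :=
  ![matT 0 0 0 0 0 0, matT 1 0 0 0 0 0, matT 0 1 0 0 0 0, matT 0 0 1 0 0 0,
    matT t t t (-s) (-s) (-s), matT t t t (-s) s s, matT t t t s (-s) s, matT t t t s s (-s)]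

lemma matT_inj {A B C d e g A' B' C' d' e' g' : ℝ} (h : matT A B C d e g = matT A' B' C' d' e' g') :
    A = A' ∧ B = B' ∧ C = C' ∧ d = d' ∧ e = e' ∧ g = g' := by
  have h1 := congrFun (congrFun h 0) 1
  have h2 := congrFun (congrFun h 0) 2
  have h3 := congrFun (congrFun h 1) 2
  have h4 := congrFun (congrFun h 0) 5
  have h5 := congrFun (congrFun h 1) 4
  have h6 := congrFun (congrFun h 2) 3
  simp [matT] at h1 h2 h3 h4 h5 h6
  exact ⟨h1, h2, h3, h4, h5, h6⟩

set_option maxHeartbeats 1000000 in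
lemma eight_inj {t s : ℝ} (t0 : 0 < t) (t1 : t < 1) (s0 : 0 < s) : Function.Injective (eight t s) := by
  intro i j h
  fin_cases i <;> fin_cases j <;> first | rfl | (exfalso; obtain ⟨h1, h2, h3, h4, h5, h6⟩ := matT_inj h; linarith)

lemma sqrt_bounds : 1 < √2 ∧ √2 < 2 := by
  constructor
  · rw [Real.lt_sqrt (by norm_num)]; norm_num
  · rw [Real.sqrt_lt' (by norm_num)]; norm_num

lemma base_card : (Gs c0).ncard = 8 := by
  have : Gs c0 = Set.range (eight (√2 - 1) (2 - √2)) := by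
    apply Set.Subset.antisymm
    · rintro G ⟨M, rfl, hM⟩
      obtain ⟨A, B, C, d, e, g, h, hh⟩ := nec hM
      rw [h]
      rcases hh with ⟨rfl, rfl, rfl, hh⟩ | ⟨rfl, rfl, rfl, hh⟩
      · rcases hh with ⟨rfl, rfl, rfl⟩ | ⟨rfl, rfl, rfl⟩ | ⟨rfl, rfl, rfl⟩ | ⟨rfl, rfl, rfl⟩
        · exact ⟨0, rfl⟩
        · exact ⟨1, rfl⟩
        · exact ⟨2, rfl⟩
        · exact ⟨3, rfl⟩
      · rcases hh with ⟨rfl, rfl, rfl⟩ | ⟨rfl, rfl, rfl⟩ | ⟨rfl, rfl, rfl⟩ | ⟨rfl, rfl, rfl⟩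
        · exact ⟨4, rfl⟩
        · exact ⟨5, rfl⟩
        · exact ⟨6, rfl⟩
        · exact ⟨7, rfl⟩
    · rintro _ ⟨k, rfl⟩
      fin_cases k
      · exact ex0
      · exact exA
      · exact exB
      · exact exC
      · have := exT' (x := -1) (y := 1) (z := -1) (by norm_num) (by norm_num) (by norm_num) (by norm_num)
        simp only [neg_mul, one_mul, neg_neg] at this
        exact this
      · have := exT' (x := 1) (y := -1) (z := -1) (by norm_num) (by norm_num) (by norm_num) (by norm_num)
        simp only [neg_mul, one_mul, neg_neg] at this
        exact this
      · have := exT' (x := 1) (y := 1) (z := 1) (by norm_num) (by norm_num) (by norm_num) (by norm_num)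
        simp only [neg_mul, one_mul, neg_neg] at this
        exact this
      · have := exT' (x := -1) (y := -1) (z := 1) (by norm_num) (by norm_num) (by norm_num) (by norm_num)
        simp only [neg_mul, one_mul, neg_neg] at this
        exact this
  obtain ⟨a, b⟩ := sqrt_bounds
  rw [this, ← Set.image_univ, Set.ncard_image_of_injective _ (eight_inj (by linarith) (by linarith) (by linarith)),
    Set.ncard_univ, Nat.card_eq_fintype_card, Fintype.card_fin]

end TQ

namespace TQ

/-- a psd matrix of rank three is `MᵀM` for a `3 × 6` matrix -/
lemma psd_factor {G : Matrix (Fin 6) (Fin 6) ℝ} (hG : G.PosSemidef) (hr : G.rank = 3) :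
    ∃ M : Fin 3 → Fin 6 → ℝ, gm M = G := by
  have hH := hG.1
  have hcard := hH.rank_eq_card_non_zero_eigs
  rw [hr] at hcard
  let ee : Fin 3 ≃ {i // hH.eigenvalues i ≠ 0} := Fintype.equivOfCardEq (by simpa using hcard)
  let U := (hH.eigenvectorUnitary : Matrix (Fin 6) (Fin 6) ℝ)
  refine ⟨fun k j => √(hH.eigenvalues (ee k)) * U j (ee k), ?_⟩
  have hsp := hH.spectral_theorem
  ext i j
  have h1 : G i j = ∑ l, hH.eigenvalues l * (U i l * U j l) := by
    conv_lhs => rw [hsp]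
    simp [Unitary.conjStarAlgAut_apply, Matrix.mul_apply, Matrix.diagonal_apply, U, Matrix.star_apply]
    refine Finset.sum_congr rfl fun l _ => ?_
    ring
  rw [h1]
  have h2 : ∑ l, hH.eigenvalues l * (U i l * U j l) =
      ∑ l : {l // hH.eigenvalues l ≠ 0}, hH.eigenvalues l * (U i l * U j l) := by
    rw [← Finset.sum_subtype (Finset.univ.filter fun l => hH.eigenvalues l ≠ 0) (by simp)
      (fun l => hH.eigenvalues l * (U i l * U j l)), Finset.sum_filter]
    refine Finset.sum_congr rfl fun l _ => ?_
    split_ifs with h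
    · rfl
    · simp only [not_not] at h
      rw [h, zero_mul]
  rw [h2, ← ee.sum_comp]
  simp only [gm, of_apply]
  refine Finset.sum_congr rfl fun k _ => ?_
  have := Real.mul_self_sqrt (hG.eigenvalues_nonneg (ee k).1)
  linear_combination (U i (ee k) * U j (ee k)) * this

lemma rank_gm {M : Fin 3 → Fin 6 → ℝ} (h : NCZ M) : (gm M).rank = 3 := by
  rw [gm_eq_mul, Matrix.rank_transpose_mul_self]
  have : LinearIndependent ℝ (Matrix.of M).row := by
    rw [Fintype.linearIndependent_iff]
    intro s hs i
    rw [lin_of_ncz h hs]; rfl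
  simpa using this.rank_matrix

lemma main {c : Fin 15 → ℝ} (hc : Smooth c) :
    {G ∈ GramSpectrahedron (P c) | G.rank = 3} = Gs c := by
  ext G
  constructor
  · rintro ⟨⟨h1, h2⟩, h3⟩
    obtain ⟨M, rfl⟩ := psd_factor h1 h3
    refine ⟨M, rfl, ?_⟩
    rw [gram_sum] at h2
    rw [← sig_gm]; exact P_inj h2
  · rintro ⟨M, rfl, rfl⟩
    refine ⟨⟨?_, ?_⟩, rank_gm (ncz_of_smooth hc)⟩
    · rw [gm_eq_mul]
      simpa using Matrix.posSemidef_conjTranspose_mul_self (Matrix.of M)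
    · rw [gram_sum, sig_gm]

end TQ

/-- **Powers–Reznick–Scheiderer–Sottile.** The Gram spectrahedron of a smooth psd
ternary quartic contains exactly eight matrices of rank 3, i.e. `f` has exactly
eight representations as a sum of three squares up to orthogonal equivalence. -/
theorem gram_spectrahedron_has_eight_rank_three_points
    (f : MvPolynomial (Fin 3) ℝ) (hhom : f.IsHomogeneous 4)
    (hsm : IsSmooth f) (hpsd : IsPsd f) :
    {G ∈ GramSpectrahedron f | G.rank = 3}.ncard = 8 := by
  obtain ⟨c, rfl⟩ := TQ.P_surj f hhom
  have hc := (TQ.smooth_iff c).1 hsm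
  have hp : TQ.PD c := TQ.pd_of_smooth hc (fun a => by rw [← TQ.eval_P]; exact hpsd a)
  rw [TQ.main hc, TQ.Gs_eq hc hp TQ.c0_smooth TQ.c0_pd, TQ.base_card]
end

section
/- Let U be a linear subspace of dimension 5 (codimension 1) of the 6-dimensional space ℂ[x,y,z]₂ of homogeneous quadratic forms. If the forms in U have no common zero in ℂ³ ∖ {0}, then the codimension of U² in the 15-dimensional space ℂ[x,y,z]₄ is 0 or 2, i.e., dim U² ∈ {13, 15}. -/
open MvPolynomial

namespace CodimOne

abbrev R := MvPolynomial (Fin 3) ℂ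

noncomputable def ex (t : ℕ × ℕ × ℕ) : Fin 3 →₀ ℕ := Finsupp.equivFunOnFinite.symm ![t.1, t.2.1, t.2.2]

noncomputable def m (t : ℕ × ℕ × ℕ) : R := monomial (ex t) 1

lemma ex_inj : Function.Injective ex := by
  intro s t h
  have h0 := DFunLike.congr_fun h 0
  have h1 := DFunLike.congr_fun h 1
  have h2 := DFunLike.congr_fun h 2
  simp [ex] at h0 h1 h2
  ext <;> assumption

lemma m_mul (s t : ℕ × ℕ × ℕ) : m s * m t = m (s + t) := by
  have : ex s + ex t = ex (s + t) := by
    ext i; fin_cases i <;> simp [ex]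
  simp [m, monomial_mul, this]

lemma m_eq (a b c : ℕ) : m (a, b, c) = X 0 ^ a * X 1 ^ b * X 2 ^ c := by
  rw [m, monomial_eq, Finsupp.prod_fintype _ _ (by simp)]
  simp [Fin.prod_univ_three, ex]

lemma finrank_m (T : Finset (ℕ × ℕ × ℕ)) :
    Module.finrank ℂ (Submodule.span ℂ (m '' (T : Set (ℕ × ℕ × ℕ)))) = T.card := by
  have h : LinearIndependent ℂ (fun t : T => m t) := by
    have := (basisMonomials (Fin 3) ℂ).linearIndependent
    have h2 := this.comp (fun t : T => ex t) (ex_inj.comp Subtype.val_injective)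
    have e : (fun t : T => m t) = (basisMonomials (Fin 3) ℂ) ∘ fun t : T => ex t := by
      funext t
      simp [m]
    rw [e]
    exact h2
  have := finrank_span_eq_card h
  rw [Fintype.card_coe] at this
  have e : m '' (T : Set (ℕ × ℕ × ℕ)) = Set.range fun t : T => m t := by
    ext x
    simp
  rw [← this, e]

def T (n : ℕ) : Finset (ℕ × ℕ × ℕ) :=
  (Finset.range (n+1) ×ˢ Finset.range (n+1) ×ˢ Finset.range (n+1)).filter
    (fun t => t.1 + t.2.1 + t.2.2 = n)

noncomputable abbrev V (n : ℕ) : Submodule ℂ R := homogeneousSubmodule (Fin 3) ℂ n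

lemma V_eq (n : ℕ) : V n = Submodule.span ℂ (m '' (T n : Set (ℕ × ℕ × ℕ))) := by
  apply le_antisymm
  · intro p hp
    rw [mem_homogeneousSubmodule] at hp
    rw [p.as_sum]
    refine Submodule.sum_mem _ fun d hd => ?_
    have hdeg := hp (mem_support_iff.1 hd)
    have : monomial d (coeff d p) = coeff d p • m (d 0, d 1, d 2) := by
      have : ex (d 0, d 1, d 2) = d := by
        ext i; fin_cases i <;> simp [ex]
      rw [m, this, smul_monomial]; simp
    rw [this]
    refine Submodule.smul_mem _ _ (Submodule.subset_span ⟨_, ?_, rfl⟩)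
    simp [Finsupp.weight_apply, Finsupp.sum_fintype, Fin.sum_univ_three] at hdeg
    simp [T]
    omega
  · rw [Submodule.span_le]
    rintro _ ⟨⟨a, b, c⟩, ht, rfl⟩
    simp [T] at ht
    rw [SetLike.mem_coe, mem_homogeneousSubmodule]
    have : (ex (a,b,c)).degree = n := by
      simp [Finsupp.degree_eq_sum, Fin.sum_univ_three, ex, ht.2]
    exact isHomogeneous_monomial _ this

lemma V_two : V 2 = Submodule.span ℂ (Set.range fun ij : Fin 3 × Fin 3 => (X ij.1 * X ij.2 : R)) := by
  apply le_antisymm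
  · rw [V_eq, Submodule.span_le]
    rintro _ ⟨t, ht, rfl⟩
    have hT : T 2 = {(2,0,0),(0,2,0),(0,0,2),(1,1,0),(1,0,1),(0,1,1)} := by decide
    rw [hT] at ht
    apply Submodule.subset_span
    simp at ht
    rcases ht with rfl | rfl | rfl | rfl | rfl | rfl
    · exact ⟨(0,0), by simp [m_eq]; ring⟩
    · exact ⟨(1,1), by simp [m_eq]; ring⟩
    · exact ⟨(2,2), by simp [m_eq]; ring⟩
    · exact ⟨(0,1), by simp [m_eq]⟩
    · exact ⟨(0,2), by simp [m_eq]⟩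
    · exact ⟨(1,2), by simp [m_eq]⟩
  · rw [Submodule.span_le]
    rintro _ ⟨⟨i, j⟩, rfl⟩
    exact (isHomogeneous_X ℂ i).mul (isHomogeneous_X ℂ j)

noncomputable def Gram (L : R →ₗ[ℂ] ℂ) : Matrix (Fin 3) (Fin 3) ℂ := Matrix.of fun i j => L (X i * X j)

lemma XX_mem (i j : Fin 3) : (X i * X j : R) ∈ V 2 :=
  (isHomogeneous_X ℂ i).mul (isHomogeneous_X ℂ j)

lemma ext_V2 (L M : R →ₗ[ℂ] ℂ) (h : ∀ i j, L (X i * X j) = M (X i * X j)) :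
    ∀ p ∈ V 2, L p = M p := by
  intro p hp
  rw [V_two] at hp
  have : Set.EqOn L M (Set.range fun ij : Fin 3 × Fin 3 => (X ij.1 * X ij.2 : R)) := by
    rintro _ ⟨⟨i, j⟩, rfl⟩
    exact h i j
  exact LinearMap.eqOn_span this hp

def Good (L : R →ₗ[ℂ] ℂ) : Prop := ∀ U : Submodule ℂ R, U = V 2 ⊓ LinearMap.ker L →
  (∃ p ∈ V 2, L p ≠ 0) → (¬ ∃ a : Fin 3 → ℂ, a ≠ 0 ∧ ∀ p ∈ U, eval a p = 0) →
  Module.finrank ℂ (U * U : Submodule ℂ R) = 13 ∨ Module.finrank ℂ (U * U : Submodule ℂ R) = 15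

def GoodG (G : Matrix (Fin 3) (Fin 3) ℂ) : Prop := ∀ L, Gram L = G → Good L

noncomputable def phi (A : Matrix (Fin 3) (Fin 3) ℂ) : R →ₐ[ℂ] R :=
  aeval (fun i => ∑ j, A i j • (X j : R))

lemma phi_X (A : Matrix (Fin 3) (Fin 3) ℂ) (i : Fin 3) : phi A (X i) = ∑ j, A i j • (X j : R) := by
  simp [phi]

lemma phi_comp (A B : Matrix (Fin 3) (Fin 3) ℂ) (p : R) : phi A (phi B p) = phi (B * A) p := by
  have : (phi A).comp (phi B) = phi (B * A) := by
    apply algHom_ext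
    intro i
    simp only [AlgHom.comp_apply, phi_X, map_sum, map_smul, Matrix.mul_apply, Finset.smul_sum,
      Finset.sum_smul, smul_smul]
    rw [Finset.sum_comm]
  exact DFunLike.congr_fun this p

lemma phi_one (p : R) : phi 1 p = p := by
  have : phi 1 = AlgHom.id ℂ R := by
    apply algHom_ext
    intro i
    simp [phi_X, Matrix.one_apply, ite_smul]
  rw [this]; rfl

lemma phi_hom (A : Matrix (Fin 3) (Fin 3) ℂ) (p : R) (hp : p ∈ V 2) : phi A p ∈ V 2 := by
  rw [V_two] at hp
  induction hp using Submodule.span_induction with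
  | mem x hx =>
    obtain ⟨⟨i, j⟩, rfl⟩ := hx
    simp only [map_mul, phi_X, Finset.sum_mul_sum, smul_mul_smul_comm]
    exact Submodule.sum_mem _ fun a _ => Submodule.sum_mem _ fun b _ =>
      Submodule.smul_mem _ _ (XX_mem a b)
  | zero => simp
  | add x y _ _ hx hy => rw [map_add]; exact add_mem hx hy
  | smul a x _ hx => rw [map_smul]; exact Submodule.smul_mem _ _ hx

lemma gram_phi (L : R →ₗ[ℂ] ℂ) (A : Matrix (Fin 3) (Fin 3) ℂ) :
    Gram (L ∘ₗ (phi A).toLinearMap) = A * Gram L * A.transpose := by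
  ext i j
  simp only [Gram, Matrix.of_apply, LinearMap.comp_apply, AlgHom.toLinearMap_apply, map_mul, phi_X]
  simp only [Finset.sum_mul_sum, smul_mul_smul_comm, map_sum, map_smul, Matrix.mul_apply,
    Matrix.transpose_apply, smul_eq_mul]
  simp only [Finset.sum_mul, Matrix.of_apply]
  conv_rhs => rw [Finset.sum_comm]
  refine Finset.sum_congr rfl fun a _ => Finset.sum_congr rfl fun b _ => by ring

lemma transport (A A' G : Matrix (Fin 3) (Fin 3) ℂ) (h : A * A' = 1)
    (hG : GoodG (A * G * A.transpose)) : GoodG G := by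
  intro L hL U hU hne hbp
  have h' : A' * A = 1 := mul_eq_one_comm.1 h
  have e1 : ∀ p, phi A (phi A' p) = p := fun p => by rw [phi_comp, h', phi_one]
  have e2 : ∀ p, phi A' (phi A p) = p := fun p => by rw [phi_comp, h, phi_one]
  have hgood := hG (L ∘ₗ (phi A).toLinearMap) (by rw [gram_phi, hL]) _ rfl ?_ ?_
  · set U' := V 2 ⊓ LinearMap.ker (L ∘ₗ (phi A).toLinearMap) with hU'
    have hmap : U = U'.map (phi A).toLinearMap := by
      ext p
      constructor
      · intro hp
        rw [hU] at hp
        refine ⟨phi A' p, ⟨phi_hom _ _ hp.1, ?_⟩, e1 p⟩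
        have := hp.2
        simpa [e1] using this
      · rintro ⟨q, hq, rfl⟩
        rw [hU]
        exact ⟨phi_hom _ _ hq.1, hq.2⟩
    have hinj : Function.Injective (phi A).toLinearMap := Function.LeftInverse.injective e2
    have : U * U = (U' * U').map (phi A).toLinearMap := by
      rw [Submodule.map_mul, ← hmap]
    rw [this, ← (Submodule.equivMapOfInjective _ hinj (U' * U')).finrank_eq]
    exact hgood
  · obtain ⟨p, hp, hp'⟩ := hne
    exact ⟨phi A' p, phi_hom _ _ hp, by simpa [e1] using hp'⟩
  · rintro ⟨a, ha, hz⟩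
    have key : ∀ q, eval a (phi A' q) = eval (fun i => eval a (phi A' (X i))) q := by
      have : ((aeval a : R →ₐ[ℂ] ℂ).comp (phi A')) = aeval (fun i => eval a (phi A' (X i))) := by
        apply algHom_ext
        intro i
        simp [aeval_eq_eval]
      intro q
      have := DFunLike.congr_fun this q
      simpa [aeval_eq_eval] using this
    refine hbp ⟨fun i => eval a (phi A' (X i)), ?_, fun q hq => ?_⟩
    · intro h0
      apply ha
      ext j
      have := key (phi A (X j))
      rw [e2, h0, phi_X] at this
      simpa using this
    · rw [← key]
      apply hz
      rw [hU] at hq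
      refine ⟨phi_hom _ _ hq.1, ?_⟩
      have := hq.2
      simpa [e1] using this

lemma good_one (i : Fin 3) (d : ℂ) : GoodG (Matrix.diagonal (Pi.single i d)) := by
  intro L hL U hU hne hbp
  exfalso
  have key := ext_V2 L (d • (aeval (Pi.single i 1) : R →ₐ[ℂ] ℂ).toLinearMap) (by
    intro j k
    have : L (X j * X k) = Gram L j k := rfl
    rw [this, hL]
    simp [Matrix.diagonal_apply, Pi.single_apply]
    split_ifs <;> simp_all)
  obtain ⟨p, hp, hp'⟩ := hne
  have hd : d ≠ 0 := by
    rintro rfl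
    apply hp'
    simpa using key p hp
  refine hbp ⟨Pi.single i 1, by simp, fun q hq => ?_⟩
  rw [hU] at hq
  have := key q hq.1
  rw [LinearMap.mem_ker.1 hq.2] at this
  simpa [hd, aeval_eq_eval] using this

lemma good_hyp (c : ℂ) (hc : c ≠ 0) : GoodG !![0, c, 0; c, 0, 0; 0, 0, 0] := by
  intro L hL U hU hne hbp
  left
  have hg : ∀ i j, L (X i * X j) = !![0, c, 0; c, 0, 0; 0, 0, 0] i j := by
    intro i j; rw [← hL]; rfl
  let S : Finset (ℕ × ℕ × ℕ) := {(2,0,0),(0,2,0),(0,0,2),(1,0,1),(0,1,1)}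
  have hT : T 2 = insert (1,1,0) S := by decide
  have hS : ∀ z ∈ Submodule.span ℂ (m '' (S : Set (ℕ × ℕ × ℕ))), L z = 0 := by
    suffices Submodule.span ℂ (m '' (S : Set (ℕ × ℕ × ℕ))) ≤ LinearMap.ker L from this
    rw [Submodule.span_le]
    rintro _ ⟨t, ht, rfl⟩
    simp [S] at ht
    rw [SetLike.mem_coe, LinearMap.mem_ker]
    rcases ht with rfl | rfl | rfl | rfl | rfl <;> simp [m_eq, pow_two, hg]
  have hc' : L (m (1,1,0)) = c := by simp [m_eq, hg]
  have hUS : U = Submodule.span ℂ (m '' (S : Set (ℕ × ℕ × ℕ))) := by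
    rw [hU, V_eq, hT]
    apply le_antisymm
    · rintro p ⟨hp, hp2⟩
      rw [Finset.coe_insert, Set.image_insert_eq, SetLike.mem_coe, Submodule.mem_span_insert] at hp
      obtain ⟨a, z, hz, rfl⟩ := hp
      have : L (a • m (1,1,0) + z) = 0 := hp2
      rw [map_add, map_smul, hc', hS z hz] at this
      have ha : a = 0 := by simpa [hc] using this
      simpa [ha] using hz
    · intro z hz
      refine ⟨Submodule.span_mono (Set.image_mono ?_) hz, hS z hz⟩
      simp
  have : U * U = Submodule.span ℂ (m '' ((Finset.image₂ (· + ·) S S : Finset _) : Set (ℕ × ℕ × ℕ))) := by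
    rw [hUS, Submodule.span_mul_span]
    congr 1
    ext x
    simp only [Set.mem_mul, Set.mem_image, Finset.coe_image₂, Set.mem_image2]
    constructor
    · rintro ⟨_, ⟨s, hs, rfl⟩, _, ⟨t, ht, rfl⟩, rfl⟩
      exact ⟨_, ⟨s, hs, t, ht, rfl⟩, (m_mul s t).symm⟩
    · rintro ⟨_, ⟨s, hs, t, ht, rfl⟩, rfl⟩
      exact ⟨_, ⟨s, hs, rfl⟩, _, ⟨t, ht, rfl⟩, m_mul s t⟩
  rw [this, finrank_m]
  decide

lemma good_three (d : Fin 3 → ℂ) (hd : ∀ i, d i ≠ 0) : GoodG (Matrix.diagonal d) := by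
  intro L hL U hU hne hbp
  right
  have hg : ∀ i j, L (X i * X j) = Matrix.diagonal d i j := by
    intro i j; rw [← hL]; rfl
  have hle : U ≤ V 2 := by rw [hU]; exact inf_le_left
  have u1 : ∀ i j, i ≠ j → (X i * X j : R) ∈ U := by
    intro i j hij
    rw [hU]
    exact ⟨XX_mem i j, by simp [hg, hij]⟩
  have u2 : ∀ i j, d j • (X i * X i : R) - d i • (X j * X j : R) ∈ U := by
    intro i j
    rw [hU]
    refine ⟨sub_mem (Submodule.smul_mem _ _ (XX_mem i i)) (Submodule.smul_mem _ _ (XX_mem j j)), ?_⟩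
    simp [hg, mul_comm]
  have w1 : ∀ i j, i ≠ j → (X i ^ 2 * X j ^ 2 : R) ∈ U * U := by
    intro i j h
    have := Submodule.mul_mem_mul (u1 i j h) (u1 i j h)
    convert this using 1; ring
  have w2 : ∀ i j k, i ≠ j → i ≠ k → (X i ^ 2 * X j * X k : R) ∈ U * U := by
    intro i j k h h'
    have := Submodule.mul_mem_mul (u1 i j h) (u1 i k h')
    convert this using 1; ring
  have w3 : ∀ i j k, i ≠ j → i ≠ k → j ≠ k → (X i ^ 3 * X j : R) ∈ U * U := by
    intro i j k hij hik hjk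
    have h1 := Submodule.mul_mem_mul (u1 i j hij) (u2 i k)
    have h2 := Submodule.smul_mem _ (d i) (w2 k i j hik.symm hjk.symm)
    have h3 := Submodule.smul_mem _ (d k)⁻¹ (add_mem h1 h2)
    convert h3 using 1
    have : (X i * X j * (d k • (X i * X i) - d i • (X k * X k)) + d i • (X k ^ 2 * X i * X j) : R)
        = d k • (X i ^ 3 * X j) := by
      simp only [smul_eq_C_mul]; ring
    rw [this, inv_smul_smul₀ (hd k)]
  have w4 : ∀ i j k, i ≠ j → i ≠ k → j ≠ k → (X i ^ 4 : R) ∈ U * U := by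
    intro i j k hij hik hjk
    have h1 := Submodule.mul_mem_mul (u2 i j) (u2 i k)
    have h2 := Submodule.smul_mem _ (d j * d i) (w1 i k hik)
    have h3 := Submodule.smul_mem _ (d i * d k) (w1 i j hij)
    have h4 := Submodule.smul_mem _ (d i * d i) (w1 j k hjk)
    have h5 := Submodule.smul_mem _ (d j * d k)⁻¹ (sub_mem (add_mem (add_mem h1 h2) h3) h4)
    convert h5 using 1
    have : ((d j • (X i * X i) - d i • (X j * X j)) * (d k • (X i * X i) - d i • (X k * X k))
        + (d j * d i) • (X i ^ 2 * X k ^ 2) + (d i * d k) • (X i ^ 2 * X j ^ 2)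
        - (d i * d i) • (X j ^ 2 * X k ^ 2) : R)
        = (d j * d k) • (X i ^ 4) := by
      simp only [smul_eq_C_mul, C_mul]; ring
    rw [this, inv_smul_smul₀ (mul_ne_zero (hd j) (hd k))]
  have : U * U = V 4 := by
    apply le_antisymm
    · rw [Submodule.mul_le]
      intro p hp q hq
      exact IsHomogeneous.mul (hle hp) (hle hq)
    · rw [V_eq, Submodule.span_le]
      rintro _ ⟨t, ht, rfl⟩
      have hT : T 4 = {(4,0,0),(0,4,0),(0,0,4),(2,2,0),(2,0,2),(0,2,2),(2,1,1),(1,2,1),(1,1,2),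
        (3,1,0),(3,0,1),(1,3,0),(0,3,1),(1,0,3),(0,1,3)} := by decide
      rw [hT] at ht
      simp at ht
      rw [SetLike.mem_coe]
      rcases ht with rfl | rfl | rfl | rfl | rfl | rfl | rfl | rfl | rfl | rfl | rfl | rfl | rfl |
        rfl | rfl <;> rw [m_eq]
      · convert w4 0 1 2 (by decide) (by decide) (by decide) using 1; ring
      · convert w4 1 0 2 (by decide) (by decide) (by decide) using 1; ring
      · convert w4 2 0 1 (by decide) (by decide) (by decide) using 1; ring
      · convert w1 0 1 (by decide) using 1; ring
      · convert w1 0 2 (by decide) using 1; ring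
      · convert w1 1 2 (by decide) using 1; ring
      · convert w2 0 1 2 (by decide) (by decide) using 1; ring
      · convert w2 1 0 2 (by decide) (by decide) using 1; ring
      · convert w2 2 0 1 (by decide) (by decide) using 1; ring
      · convert w3 0 1 2 (by decide) (by decide) (by decide) using 1; ring
      · convert w3 0 2 1 (by decide) (by decide) (by decide) using 1; ring
      · convert w3 1 0 2 (by decide) (by decide) (by decide) using 1; ring
      · convert w3 1 2 0 (by decide) (by decide) (by decide) using 1; ring
      · convert w3 2 0 1 (by decide) (by decide) (by decide) using 1; ring
      · convert w3 2 1 0 (by decide) (by decide) (by decide) using 1; ring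
  rw [this, V_eq, finrank_m]
  decide

lemma good_two (a b : ℂ) (ha : a ≠ 0) (hb : b ≠ 0) : GoodG (Matrix.diagonal ![a, b, 0]) := by
  obtain ⟨c, hc⟩ := IsAlgClosed.exists_pow_nat_eq (-a / b) (n := 2) (by norm_num)
  have hc2 : c ^ 2 * b = -a := by rw [hc]; field_simp
  have hc0 : c ≠ 0 := by
    rintro rfl
    apply ha
    simpa using hc2.symm
  refine transport !![1, c, 0; 1, -c, 0; 0, 0, 1] !![1/2, 1/2, 0; 1/(2*c), -1/(2*c), 0; 0, 0, 1] _ ?_ ?_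
  · ext i j
    fin_cases i <;> fin_cases j <;> simp [Matrix.mul_apply, Fin.sum_univ_three] <;> field_simp <;> norm_num
  · convert good_hyp (2 * a) (by simpa using ha) using 1
    ext i j
    fin_cases i <;> fin_cases j <;>
      simp only [Matrix.mul_apply, Fin.sum_univ_three, Matrix.diagonal_apply] <;> simp <;>
      first | linear_combination hc2 | linear_combination -hc2

lemma good_diag (d : Fin 3 → ℂ) : GoodG (Matrix.diagonal d) := by
  have one : ∀ i, (∀ j, j ≠ i → d j = 0) → GoodG (Matrix.diagonal d) := by
    intro i h
    have : d = Pi.single i (d i) := by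
      ext j
      by_cases hj : j = i
      · subst hj; simp
      · simp [hj, h j hj]
    rw [this]
    exact good_one i _
  by_cases h0 : d 0 = 0
  · by_cases h1 : d 1 = 0
    · exact one 2 (by intro j hj; fin_cases j <;> simp_all)
    · by_cases h2 : d 2 = 0
      · exact one 1 (by intro j hj; fin_cases j <;> simp_all)
      · refine transport !![0,0,1;0,1,0;1,0,0] !![0,0,1;0,1,0;1,0,0] _ ?_ ?_
        · ext i j
          fin_cases i <;> fin_cases j <;> simp [Matrix.mul_apply, Fin.sum_univ_three]
        · convert good_two (d 2) (d 1) h2 h1 using 1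
          ext i j
          fin_cases i <;> fin_cases j <;>
            simp only [Matrix.mul_apply, Fin.sum_univ_three, Matrix.diagonal_apply] <;> simp [h0]
  · by_cases h1 : d 1 = 0
    · by_cases h2 : d 2 = 0
      · exact one 0 (by intro j hj; fin_cases j <;> simp_all)
      · refine transport !![1,0,0;0,0,1;0,1,0] !![1,0,0;0,0,1;0,1,0] _ ?_ ?_
        · ext i j
          fin_cases i <;> fin_cases j <;> simp [Matrix.mul_apply, Fin.sum_univ_three]
        · convert good_two (d 0) (d 2) h0 h2 using 1
          ext i j
          fin_cases i <;> fin_cases j <;>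
            simp only [Matrix.mul_apply, Fin.sum_univ_three, Matrix.diagonal_apply] <;> simp [h1]
    · by_cases h2 : d 2 = 0
      · convert good_two (d 0) (d 1) h0 h1 using 2
        ext j; fin_cases j <;> simp [h2]
      · exact good_three d (by intro j; fin_cases j <;> simpa)

lemma good_all (G : Matrix (Fin 3) (Fin 3) ℂ) (hG : G.IsSymm) : GoodG G := by
  have hs : LinearMap.IsSymm (Matrix.toBilin' G) := by
    refine ⟨fun x y => ?_⟩
    simp only [Matrix.toBilin'_apply', RingHom.id_apply]
    rw [Matrix.dotProduct_mulVec, ← Matrix.mulVec_transpose, hG.eq, dotProduct_comm]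
  obtain ⟨v, hv⟩ := LinearMap.BilinForm.exists_orthogonal_basis hs
  have hcard : Module.finrank ℂ (Fin 3 → ℂ) = 3 := by simp
  let w := v.reindex (finCongr hcard)
  let A : Matrix (Fin 3) (Fin 3) ℂ := Matrix.of fun i j => w i j
  have hA : IsUnit A := Matrix.linearIndependent_rows_iff_isUnit.1 w.linearIndependent
  obtain ⟨A', hA'⟩ := hA.exists_right_inv
  refine transport A A' G hA' ?_
  convert good_diag (fun i => Matrix.toBilin' G (w i) (w i)) using 1
  ext i j
  have e : (A * G * A.transpose) i j = Matrix.toBilin' G (w i) (w j) := by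
    rw [Matrix.toBilin'_apply', Matrix.dotProduct_mulVec]
    rfl
  rw [e, Matrix.diagonal_apply]
  split_ifs with h
  · rw [h]
  · have := hv (i := (finCongr hcard).symm i) (j := (finCongr hcard).symm j) (by simpa using h)
    simpa [w] using this

end CodimOne

/-- If `U ⊆ ℂ[x,y,z]₂` is a subspace of dimension 5 (codimension 1) whose forms
have no common zero in `ℂ³ ∖ {0}`, then the codimension of `U²` in `ℂ[x,y,z]₄`
is 0 or 2, i.e. `dim U² ∈ {13, 15}`. -/
theorem codim_one_square_basepoint_free
    (U : Submodule ℂ (MvPolynomial (Fin 3) ℂ))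
    (hU_hom : ∀ p ∈ U, p.IsHomogeneous 2)
    (hU_dim : Module.finrank ℂ U = 5)
    (hbpf : ¬ ∃ a : Fin 3 → ℂ, a ≠ 0 ∧ ∀ p ∈ U, eval a p = 0)
    (U2 : Submodule ℂ (MvPolynomial (Fin 3) ℂ))
    (hU2 : U2 = Submodule.span ℂ {g | ∃ p ∈ U, ∃ q ∈ U, g = p * q}) :
    Module.finrank ℂ U2 = 13 ∨ Module.finrank ℂ U2 = 15 := by
  have hmul : U2 = U * U := by
    rw [hU2, Submodule.mul_eq_span_mul_set]
    congr 1
    ext g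
    simp [Set.mem_mul, eq_comm]
  have hle : U ≤ CodimOne.V 2 := hU_hom
  have h6 : Module.finrank ℂ (CodimOne.V 2) = 6 := by
    rw [CodimOne.V_eq, CodimOne.finrank_m]; decide
  have : FiniteDimensional ℂ (CodimOne.V 2) := Module.finite_of_finrank_pos (by rw [h6]; norm_num)
  obtain ⟨p, hp, hpU⟩ : ∃ p ∈ CodimOne.V 2, p ∉ U := by
    by_contra! h
    have : U = CodimOne.V 2 := le_antisymm hle h
    rw [this, h6] at hU_dim
    norm_num at hU_dim
  obtain ⟨L, hLp, hL⟩ := Submodule.exists_le_ker_of_notMem hpU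
  have hUeq : U = CodimOne.V 2 ⊓ LinearMap.ker L := by
    have hle2 : U ≤ CodimOne.V 2 ⊓ LinearMap.ker L := le_inf hle hL
    have hlt : CodimOne.V 2 ⊓ LinearMap.ker L < CodimOne.V 2 := by
      refine lt_of_le_of_ne inf_le_left fun h => hLp ?_
      rw [← h] at hp
      exact hp.2
    have h1 := Submodule.finrank_lt_finrank_of_lt hlt
    have : FiniteDimensional ℂ (CodimOne.V 2 ⊓ LinearMap.ker L : Submodule ℂ _) :=
      Submodule.finiteDimensional_of_le inf_le_left
    apply Submodule.eq_of_le_of_finrank_le hle2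
    rw [hU_dim]
    rw [h6] at h1
    exact Nat.le_of_lt_succ h1
  rw [hmul]
  refine CodimOne.good_all (CodimOne.Gram L) ?_ L rfl U hUeq ⟨p, hp, hLp⟩ hbpf
  ext i j
  simp [CodimOne.Gram, mul_comm]
end

section
/- Let f ∈ ℝ[x,y,z] be a smooth psd ternary quartic and let G ∈ Gram(f) be a Gram matrix of rank 5. Then every face F of Gram(f) whose relative interior contains G has dimension 0 or dimension 2. -/
open MvPolynomial Matrix

/-- A face of a convex set `S`: a convex subset `F ⊆ S` such that whenever a point
of `F` lies in the open segment between two points of `S`, both endpoints lie in `F`. -/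
def IsFace {E : Type*} [AddCommGroup E] [Module ℝ E] (S F : Set E) : Prop :=
  F ⊆ S ∧ Convex ℝ F ∧ ∀ x ∈ S, ∀ y ∈ S, ∀ t : ℝ, 0 < t → t < 1 →
    t • x + (1 - t) • y ∈ F → x ∈ F ∧ y ∈ F

/-- symmetric matrix attached to a vector -/
def symN (v : Fin 6 → ℝ) : Matrix (Fin 3) (Fin 3) ℝ :=
  !![v 0, v 3, v 4; v 3, v 1, v 5; v 4, v 5, v 2]

/-- polarised adjugate -/
def cross3 (N B : Matrix (Fin 3) (Fin 3) ℝ) : Matrix (Fin 3) (Fin 3) ℝ :=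
  (N + B).adjugate - N.adjugate - B.adjugate

lemma cross3_eq (N B : Matrix (Fin 3) (Fin 3) ℝ) : cross3 N B =
  !![N 1 1 * B 2 2 + B 1 1 * N 2 2 - N 1 2 * B 2 1 - B 1 2 * N 2 1,
     -(N 0 1 * B 2 2 + B 0 1 * N 2 2) + N 0 2 * B 2 1 + B 0 2 * N 2 1,
     N 0 1 * B 1 2 + B 0 1 * N 1 2 - N 0 2 * B 1 1 - B 0 2 * N 1 1;
     -(N 1 0 * B 2 2 + B 1 0 * N 2 2) + N 1 2 * B 2 0 + B 1 2 * N 2 0,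
     N 0 0 * B 2 2 + B 0 0 * N 2 2 - N 0 2 * B 2 0 - B 0 2 * N 2 0,
     -(N 0 0 * B 1 2 + B 0 0 * N 1 2) + N 0 2 * B 1 0 + B 0 2 * N 1 0;
     N 1 0 * B 2 1 + B 1 0 * N 2 1 - N 1 1 * B 2 0 - B 1 1 * N 2 0,
     -(N 0 0 * B 2 1 + B 0 0 * N 2 1) + N 0 1 * B 2 0 + B 0 1 * N 2 0,
     N 0 0 * B 1 1 + B 0 0 * N 1 1 - N 0 1 * B 1 0 - B 0 1 * N 1 0] := by
  unfold cross3
  rw [adjugate_fin_three, adjugate_fin_three, adjugate_fin_three]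
  ext i j
  fin_cases i <;> fin_cases j <;> simp <;> ring

lemma cross3_congr (Q N B : Matrix (Fin 3) (Fin 3) ℝ) :
    cross3 (Q * N * Qᵀ) (Q * B * Qᵀ) = Qᵀ.adjugate * cross3 N B * Q.adjugate := by
  unfold cross3
  rw [← add_mul, ← mul_add]
  simp only [adjugate_mul_distrib, mul_sub, sub_mul, mul_assoc]

/-- The kernel of the polarised adjugate. -/
def crossKer (N : Matrix (Fin 3) (Fin 3) ℝ) : Submodule ℝ (Matrix (Fin 3) (Fin 3) ℝ) where
  carrier := {B | Bᵀ = B ∧ cross3 N B = 0}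
  zero_mem' := by simp [cross3]
  add_mem' := by
    rintro A B ⟨h1, h2⟩ ⟨h3, h4⟩
    refine ⟨by rw [transpose_add, h1, h3], ?_⟩
    have : cross3 N (A + B) = cross3 N A + cross3 N B := by
      rw [cross3_eq, cross3_eq, cross3_eq]
      ext i j
      fin_cases i <;> fin_cases j <;> simp <;> ring
    rw [this, h2, h4, add_zero]
  smul_mem' := by
    rintro c B ⟨h1, h2⟩
    refine ⟨by rw [transpose_smul, h1], ?_⟩
    have : cross3 N (c • B) = c • cross3 N B := by
      rw [cross3_eq, cross3_eq]
      ext i j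
      fin_cases i <;> fin_cases j <;> simp <;> ring
    rw [this, h2, smul_zero]

lemma finrank_crossKer_congr (Q R N : Matrix (Fin 3) (Fin 3) ℝ) (h1 : Q * R = 1) :
    Module.finrank ℝ (crossKer (Q * N * Qᵀ)) = Module.finrank ℝ (crossKer N) := by
  have h2 : R * Q = 1 := mul_eq_one_comm.mp h1
  have h1' : Rᵀ * Qᵀ = 1 := by rw [← transpose_mul, h1, transpose_one]
  have h2' : Qᵀ * Rᵀ = 1 := by rw [← transpose_mul, h2, transpose_one]
  have key : ∀ (Q M B : Matrix (Fin 3) (Fin 3) ℝ), B ∈ crossKer M →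
      Q * B * Qᵀ ∈ crossKer (Q * M * Qᵀ) := by
    rintro Q M B ⟨hs, hc⟩
    refine ⟨by simp [transpose_mul, hs, mul_assoc], ?_⟩
    rw [cross3_congr, hc]; simp
  have hinv : ∀ (Q R M : Matrix (Fin 3) (Fin 3) ℝ), R * Q = 1 → Qᵀ * Rᵀ = 1 →
      R * (Q * M * Qᵀ) * Rᵀ = M := by
    intro Q R M h2 h2'
    calc _ = (R * Q) * M * (Qᵀ * Rᵀ) := by simp only [mul_assoc]
      _ = M := by rw [h2, h2']; simp
  symm
  refine LinearEquiv.finrank_eq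
    { toFun := fun B => ⟨Q * B.1 * Qᵀ, key Q N B.1 B.2⟩
      invFun := fun B => ⟨R * B.1 * Rᵀ, by
        have := key R _ B.1 B.2
        rwa [hinv Q R N h2 h2'] at this⟩
      map_add' := ?_
      map_smul' := ?_
      left_inv := ?_
      right_inv := ?_ }
  · intro A B; ext1; simp [mul_add, add_mul]
  · intro c B; ext1; simp
  · intro B; ext1; exact hinv Q R _ h2 h2'
  · intro B; ext1; exact hinv R Q _ h1 h1'

lemma finrank_two_of {K : Submodule ℝ (Matrix (Fin 3) (Fin 3) ℝ)}
    (B C : Matrix (Fin 3) (Fin 3) ℝ) (hK : ∀ M, M ∈ K ↔ ∃ s t : ℝ, s • B + t • C = M)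
    (hli : ∀ s t : ℝ, s • B + t • C = 0 → s = 0 ∧ t = 0) : Module.finrank ℝ K = 2 := by
  have hl : LinearIndependent ℝ ![B, C] := LinearIndependent.pair_iff.mpr hli
  have : K = Submodule.span ℝ (Set.range ![B, C]) := by
    ext M
    rw [hK]
    simp only [Matrix.range_cons, Matrix.range_empty, Set.union_empty, Set.singleton_union,
      Submodule.mem_span_pair]
  rw [this, finrank_span_eq_card hl]
  simp

lemma mem_crossKer_diag (d : Fin 3 → ℝ) (B : Matrix (Fin 3) (Fin 3) ℝ) :
    B ∈ crossKer (diagonal d) ↔ (B 1 0 = B 0 1 ∧ B 2 0 = B 0 2 ∧ B 2 1 = B 1 2) ∧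
      d 1 * B 2 2 + B 1 1 * d 2 = 0 ∧ d 0 * B 2 2 + B 0 0 * d 2 = 0 ∧
      d 0 * B 1 1 + B 0 0 * d 1 = 0 ∧ d 2 * B 0 1 = 0 ∧ d 1 * B 0 2 = 0 ∧ d 0 * B 1 2 = 0 := by
  change (Bᵀ = B ∧ cross3 _ B = 0) ↔ _
  rw [cross3_eq, ← Matrix.ext_iff, ← Matrix.ext_iff]
  simp only [Fin.forall_fin_succ]
  simp [diagonal]
  grind

lemma finrank_crossKer_diag (d : Fin 3 → ℝ)
    (h : ∀ i j, i ≠ j → ¬ (d i = 0 ∧ d j = 0)) :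
    Module.finrank ℝ (crossKer (diagonal d)) = 0 ∨
      Module.finrank ℝ (crossKer (diagonal d)) = 2 := by
  have h01 := h 0 1 (by decide)
  have h02 := h 0 2 (by decide)
  have h12 := h 1 2 (by decide)
  by_cases h0 : d 0 = 0
  · have h1 : d 1 ≠ 0 := by tauto
    have h2 : d 2 ≠ 0 := by tauto
    right
    refine finrank_two_of !![0,0,0;0,d 1,0;0,0,-d 2] !![0,0,0;0,0,1;0,1,0] ?_ ?_
    · intro M
      rw [mem_crossKer_diag]
      constructor
      · rintro ⟨⟨e1, e2, e3⟩, f1, f2, f3, f4, f5, f6⟩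
        refine ⟨M 1 1 / d 1, M 1 2, ?_⟩
        have : M 0 0 = 0 := by simpa [h0, h1] using f3
        have : M 0 1 = 0 := by simpa [h2] using f4
        have : M 0 2 = 0 := by simpa [h1] using f5
        have : M 1 1 / d 1 * d 2 = - M 2 2 := by field_simp; linarith
        ext i j
        fin_cases i <;> fin_cases j <;> simp_all
      · rintro ⟨s, t, rfl⟩
        simp [h0]; ring
    · intro s t hst
      have a := congrFun (congrFun hst 1) 1
      have b := congrFun (congrFun hst 1) 2
      simp [h1] at a b
      exact ⟨a, b⟩
  by_cases h1 : d 1 = 0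
  · have h2 : d 2 ≠ 0 := by tauto
    right
    refine finrank_two_of !![d 0,0,0;0,0,0;0,0,-d 2] !![0,0,1;0,0,0;1,0,0] ?_ ?_
    · intro M
      rw [mem_crossKer_diag]
      constructor
      · rintro ⟨⟨e1, e2, e3⟩, f1, f2, f3, f4, f5, f6⟩
        refine ⟨M 0 0 / d 0, M 0 2, ?_⟩
        have : M 1 1 = 0 := by simpa [h0, h1] using f3
        have : M 0 1 = 0 := by simpa [h2] using f4
        have : M 1 2 = 0 := by simpa [h0] using f6
        have : M 0 0 / d 0 * d 2 = - M 2 2 := by field_simp; linarith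
        ext i j
        fin_cases i <;> fin_cases j <;> simp_all
      · rintro ⟨s, t, rfl⟩
        simp [h1]; ring
    · intro s t hst
      have a := congrFun (congrFun hst 0) 0
      have b := congrFun (congrFun hst 0) 2
      simp [h0] at a b
      exact ⟨a, b⟩
  by_cases h2 : d 2 = 0
  · right
    refine finrank_two_of !![d 0,0,0;0,-d 1,0;0,0,0] !![0,1,0;1,0,0;0,0,0] ?_ ?_
    · intro M
      rw [mem_crossKer_diag]
      constructor
      · rintro ⟨⟨e1, e2, e3⟩, f1, f2, f3, f4, f5, f6⟩
        refine ⟨M 0 0 / d 0, M 0 1, ?_⟩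
        have : M 2 2 = 0 := by simpa [h2, h1] using f1
        have : M 0 2 = 0 := by simpa [h1] using f5
        have : M 1 2 = 0 := by simpa [h0] using f6
        have : M 0 0 / d 0 * d 1 = - M 1 1 := by field_simp; linarith
        ext i j
        fin_cases i <;> fin_cases j <;> simp_all
      · rintro ⟨s, t, rfl⟩
        simp [h2]; ring
    · intro s t hst
      have a := congrFun (congrFun hst 0) 0
      have b := congrFun (congrFun hst 0) 1
      simp [h0] at a b
      exact ⟨a, b⟩
  left
  have : crossKer (diagonal d) = ⊥ := by
    rw [eq_bot_iff]
    intro M hM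
    rw [mem_crossKer_diag] at hM
    obtain ⟨⟨e1, e2, e3⟩, f1, f2, f3, f4, f5, f6⟩ := hM
    have g1 : M 0 1 = 0 := by simpa [h2] using f4
    have g2 : M 0 2 = 0 := by simpa [h1] using f5
    have g3 : M 1 2 = 0 := by simpa [h0] using f6
    have k : M 0 0 = 0 := by
      have : M 0 0 * (d 1 * d 2 * 2) = 0 := by
        linear_combination d 2 * f3 + d 1 * f2 - d 0 * f1
      simpa [h1, h2] using this
    have k1 : M 1 1 = 0 := by simpa [k, h0] using f3
    have k2 : M 2 2 = 0 := by simpa [k, h0] using f2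
    change M = 0
    ext i j
    fin_cases i <;> fin_cases j <;> simp_all
  rw [this]; simp

/-- The Gram map. -/
noncomputable def gramPoly (A : Matrix (Fin 6) (Fin 6) ℝ) : MvPolynomial (Fin 3) ℝ :=
  ∑ i, ∑ j, MvPolynomial.C (A i j) * (gramBasis i * gramBasis j)

lemma gramPoly_add (A B : Matrix (Fin 6) (Fin 6) ℝ) :
    gramPoly (A + B) = gramPoly A + gramPoly B := by
  simp [gramPoly, add_mul, Finset.sum_add_distrib]

lemma gramPoly_smul (c : ℝ) (B : Matrix (Fin 6) (Fin 6) ℝ) :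
    gramPoly (c • B) = MvPolynomial.C c * gramPoly B := by
  simp [gramPoly, Finset.mul_sum, mul_assoc]

/-- The relations cutting out symmetric matrices in the kernel of the Gram map. -/
lemma gramPoly_eq_zero_iff (A : Matrix (Fin 6) (Fin 6) ℝ) (hA : Aᵀ = A) :
    gramPoly A = 0 ↔ (A 0 0 = 0 ∧ A 1 1 = 0 ∧ A 2 2 = 0 ∧ A 0 3 = 0 ∧ A 0 4 = 0 ∧ A 1 3 = 0 ∧
      A 1 5 = 0 ∧ A 2 4 = 0 ∧ A 2 5 = 0) ∧ A 3 3 = -2 * A 0 1 ∧ A 4 4 = -2 * A 0 2 ∧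
      A 5 5 = -2 * A 1 2 ∧ A 3 4 = - A 0 5 ∧ A 3 5 = - A 1 4 ∧ A 4 5 = - A 2 3 := by
  have hs : ∀ i j, A j i = A i j := fun i j => congrFun (congrFun hA i) j
  constructor
  · intro h
    have ev : ∀ x y z : ℝ, A 0 0 * x^4 + A 1 1 * y^4 + A 2 2 * z^4
        + 2 * A 0 3 * x^3*y + 2 * A 0 4 * x^3*z + 2 * A 1 3 * y^3*x + 2 * A 1 5 * y^3*z
        + 2 * A 2 4 * z^3*x + 2 * A 2 5 * z^3*y + (2 * A 0 1 + A 3 3) * x^2*y^2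
        + (2 * A 0 2 + A 4 4) * x^2*z^2 + (2 * A 1 2 + A 5 5) * y^2*z^2
        + 2 * (A 0 5 + A 3 4) * x^2*y*z + 2 * (A 1 4 + A 3 5) * y^2*x*z
        + 2 * (A 2 3 + A 4 5) * z^2*x*y = 0 := by
      intro x y z
      have := congrArg (MvPolynomial.eval ![x, y, z]) h
      simp [gramPoly, gramBasis, Fin.sum_univ_succ] at this
      rw [hs 0 1, hs 0 2, hs 0 3, hs 0 4, hs 0 5, hs 1 2, hs 1 3, hs 1 4, hs 1 5, hs 2 3, hs 2 4,
        hs 2 5, hs 3 4, hs 3 5, hs 4 5] at this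
      linear_combination this
    have e1 := ev 1 0 0
    have e2 := ev 0 1 0
    have e3 := ev 0 0 1
    have e4 := ev 1 1 0
    have e5 := ev 1 (-1) 0
    have e6 := ev 1 2 0
    have e7 := ev 1 0 1
    have e8 := ev 1 0 (-1)
    have e9 := ev 1 0 2
    have e10 := ev 0 1 1
    have e11 := ev 0 1 (-1)
    have e12 := ev 0 1 2
    have e13 := ev 1 1 1
    have e14 := ev 1 1 (-1)
    have e15 := ev 1 (-1) 1
    norm_num at e1 e2 e3 e4 e5 e6 e7 e8 e9 e10 e11 e12 e13 e14 e15
    refine ⟨⟨?_, ?_, ?_, ?_, ?_, ?_, ?_, ?_, ?_⟩, ?_, ?_, ?_, ?_, ?_, ?_⟩ <;> linarith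
  · rintro ⟨⟨e1, e2, e3, e4, e5, e6, e7, e8, e9⟩, f1, f2, f3, f4, f5, f6⟩
    simp [gramPoly, gramBasis, Fin.sum_univ_succ]
    rw [hs 0 1, hs 0 2, hs 0 3, hs 0 4, hs 0 5, hs 1 2, hs 1 3, hs 1 4, hs 1 5, hs 2 3, hs 2 4,
        hs 2 5, hs 3 4, hs 3 5, hs 4 5]
    rw [e1, e2, e3, e4, e5, e6, e7, e8, e9, f1, f2, f3, f4, f5, f6]
    simp only [map_mul, map_neg, map_zero, map_ofNat]
    ring

/-- The tangent space of the supporting face. -/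
noncomputable def faceDir (v : Fin 6 → ℝ) : Submodule ℝ (Matrix (Fin 6) (Fin 6) ℝ) where
  carrier := {A | Aᵀ = A ∧ gramPoly A = 0 ∧ A *ᵥ v = 0}
  zero_mem' := by simp [gramPoly]
  add_mem' := by
    rintro A B ⟨h1, h2, h3⟩ ⟨g1, g2, g3⟩
    exact ⟨by rw [transpose_add, h1, g1], by rw [gramPoly_add, h2, g2, add_zero],
      by rw [add_mulVec, h3, g3, add_zero]⟩
  smul_mem' := by
    rintro c B ⟨h1, h2, h3⟩
    exact ⟨by rw [transpose_smul, h1], by rw [gramPoly_smul, h2, mul_zero],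
      by rw [smul_mulVec, h3, smul_zero]⟩

/-- the quadric attached to a symmetric 3×3 matrix -/
def quadOf (B : Matrix (Fin 3) (Fin 3) ℝ) : Matrix (Fin 6) (Fin 6) ℝ :=
  !![0, B 2 2, B 1 1, 0, 0, -2 * B 1 2;
     B 2 2, 0, B 0 0, 0, -2 * B 0 2, 0;
     B 1 1, B 0 0, 0, -2 * B 0 1, 0, 0;
     0, 0, -2 * B 0 1, -2 * B 2 2, 2 * B 1 2, 2 * B 0 2;
     0, -2 * B 0 2, 0, 2 * B 1 2, -2 * B 1 1, 2 * B 0 1;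
     -2 * B 1 2, 0, 0, 2 * B 0 2, 2 * B 0 1, -2 * B 0 0]

/-- inverse of `quadOf` -/
noncomputable def quadInv (A : Matrix (Fin 6) (Fin 6) ℝ) : Matrix (Fin 3) (Fin 3) ℝ :=
  !![A 1 2, -A 2 3 / 2, -A 1 4 / 2; -A 2 3 / 2, A 0 2, -A 0 5 / 2; -A 1 4 / 2, -A 0 5 / 2, A 0 1]

lemma quadOf_transpose (B : Matrix (Fin 3) (Fin 3) ℝ) : (quadOf B)ᵀ = quadOf B := by
  ext i j
  fin_cases i <;> fin_cases j <;> rfl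

lemma quadOf_gram (B : Matrix (Fin 3) (Fin 3) ℝ) : gramPoly (quadOf B) = 0 := by
  rw [gramPoly_eq_zero_iff _ (quadOf_transpose B)]
  simp [quadOf]

lemma quadOf_mulVec (B : Matrix (Fin 3) (Fin 3) ℝ) (hB : Bᵀ = B) (v : Fin 6 → ℝ) :
    quadOf B *ᵥ v = 0 ↔ cross3 (symN v) B = 0 := by
  have hs : ∀ i j, B j i = B i j := fun i j => congrFun (congrFun hB i) j
  rw [cross3_eq, ← Matrix.ext_iff, funext_iff]
  simp only [Fin.forall_fin_succ]
  simp [quadOf, symN, mulVec, dotProduct, Fin.sum_univ_succ]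
  rw [hs 0 1, hs 0 2, hs 1 2]
  constructor
  · rintro ⟨h0, h1, h2, h3, h4, h5⟩
    refine ⟨⟨?_, ?_, ?_⟩, ⟨?_, ?_, ?_⟩, ?_, ?_, ?_⟩ <;> linarith
  · rintro ⟨⟨h0, h1, h2⟩, ⟨h3, h4, h5⟩, h6, h7, h8⟩
    refine ⟨?_, ?_, ?_, ?_, ?_, ?_⟩ <;> linarith

lemma quadInv_transpose (A : Matrix (Fin 6) (Fin 6) ℝ) : (quadInv A)ᵀ = quadInv A := by
  ext i j
  fin_cases i <;> fin_cases j <;> rfl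

lemma quadOf_quadInv (A : Matrix (Fin 6) (Fin 6) ℝ) (hA : Aᵀ = A) (h : gramPoly A = 0) :
    quadOf (quadInv A) = A := by
  have hs : ∀ i j, A j i = A i j := fun i j => congrFun (congrFun hA i) j
  rw [gramPoly_eq_zero_iff _ hA] at h
  obtain ⟨⟨e1, e2, e3, e4, e5, e6, e7, e8, e9⟩, f1, f2, f3, f4, f5, f6⟩ := h
  ext i j
  fin_cases i <;> fin_cases j <;> simp [quadOf, quadInv] <;>
    linarith [hs 0 1, hs 0 2, hs 0 3, hs 0 4, hs 0 5, hs 1 2, hs 1 3, hs 1 4, hs 1 5, hs 2 3,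
      hs 2 4, hs 2 5, hs 3 4, hs 3 5, hs 4 5]

lemma quadInv_quadOf (B : Matrix (Fin 3) (Fin 3) ℝ) (hB : Bᵀ = B) :
    quadInv (quadOf B) = B := by
  have hs : ∀ i j, B j i = B i j := fun i j => congrFun (congrFun hB i) j
  ext i j
  fin_cases i <;> fin_cases j <;> simp [quadOf, quadInv] <;> rw [hs]

set_option maxHeartbeats 1000000 in
lemma quadOf_add (A B : Matrix (Fin 3) (Fin 3) ℝ) : quadOf (A + B) = quadOf A + quadOf B := by
  ext i j
  fin_cases i <;> fin_cases j <;> simp [quadOf] <;> ring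

set_option maxHeartbeats 1000000 in
lemma quadOf_smul (c : ℝ) (B : Matrix (Fin 3) (Fin 3) ℝ) : quadOf (c • B) = c • quadOf B := by
  ext i j
  fin_cases i <;> fin_cases j <;> simp [quadOf] <;> ring

lemma finrank_faceDir (v : Fin 6 → ℝ) :
    Module.finrank ℝ (faceDir v) = Module.finrank ℝ (crossKer (symN v)) := by
  symm
  refine LinearEquiv.finrank_eq
    { toFun := fun B => ⟨quadOf B.1, quadOf_transpose _, quadOf_gram _,
        (quadOf_mulVec _ B.2.1 v).mpr B.2.2⟩
      invFun := fun A => ⟨quadInv A.1, quadInv_transpose _, by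
        rw [← quadOf_mulVec _ (quadInv_transpose _), quadOf_quadInv _ A.2.1 A.2.2.1]
        exact A.2.2.2⟩
      map_add' := ?_
      map_smul' := ?_
      left_inv := ?_
      right_inv := ?_ }
  · intro A B; exact Subtype.ext (quadOf_add A.1 B.1)
  · intro c B; exact Subtype.ext (quadOf_smul c B.1)
  · intro B; ext1; exact quadInv_quadOf _ B.2.1
  · intro A; ext1; exact quadOf_quadInv _ A.2.1 A.2.2.1

lemma real_spectral {n : Type*} [Fintype n] [DecidableEq n] (N : Matrix n n ℝ) (hN : Nᵀ = N) :
    ∃ (Q : Matrix n n ℝ) (d : n → ℝ), Q * Qᵀ = 1 ∧ N = Q * diagonal d * Qᵀ := by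
  have h : N.IsHermitian := by rw [IsHermitian, conjTranspose_eq_transpose_of_trivial, hN]
  refine ⟨h.eigenvectorUnitary, h.eigenvalues, ?_, ?_⟩
  · have := Unitary.coe_mul_star_self h.eigenvectorUnitary
    rwa [Unitary.coe_star, star_eq_conjTranspose, conjTranspose_eq_transpose_of_trivial] at this
  · have := h.spectral_theorem
    rw [Unitary.conjStarAlgAut_apply, star_eq_conjTranspose,
      conjTranspose_eq_transpose_of_trivial] at this
    exact this

/-- If `v` is a multiple of a Veronese point killed by `G`, then `f` is singular there. -/
lemma singular_of_veronese (f : MvPolynomial (Fin 3) ℝ) (hsm : IsSmooth f)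
    (G : Matrix (Fin 6) (Fin 6) ℝ) (hs : Gᵀ = G) (hf : gramPoly G = f)
    (q : Fin 3 → ℝ) (hq : q ≠ 0) (h : G *ᵥ (fun i => eval q (gramBasis i)) = 0) : False := by
  apply hq
  have hz : (fun i => (q i : ℂ)) = 0 := by
    apply hsm
    intro k
    rw [pderiv_map]
    have : eval (fun i => (q i : ℂ)) (map (algebraMap ℝ ℂ) (pderiv k f))
        = algebraMap ℝ ℂ (eval q (pderiv k f)) := by
      rw [eval_map]
      exact (eval₂_comp (algebraMap ℝ ℂ) q _).symm
    rw [this]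
    have h1 : ∀ i, ∑ j, G i j * eval q (gramBasis j) = 0 := fun i => congrFun h i
    have h2 : ∀ j, ∑ i, G i j * eval q (gramBasis i) = 0 := by
      intro j
      rw [← h1 j]
      refine Finset.sum_congr rfl fun i _ => ?_
      rw [show G i j = G j i from congrFun (congrFun hs j) i]
    have : eval q (pderiv k f) = 0 := by
      rw [← hf, gramPoly]
      simp only [map_sum, pderiv_mul, pderiv_C, zero_mul, zero_add, map_mul, map_add, eval_C,
        mul_add, Finset.sum_add_distrib]
      rw [Finset.sum_comm]
      have a1 : ∀ j, ∑ i, G i j * (eval q (pderiv k (gramBasis i)) * eval q (gramBasis j))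
          = ∑ i, eval q (pderiv k (gramBasis i)) * (G i j * eval q (gramBasis j)) := fun j =>
        Finset.sum_congr rfl fun i _ => by ring
      simp only [a1]
      rw [Finset.sum_comm]
      simp only [← Finset.mul_sum, h1]
      rw [Finset.sum_comm]
      have a2 : ∀ j, ∑ i, G i j * (eval q (gramBasis i) * eval q (pderiv k (gramBasis j)))
          = (∑ i, G i j * eval q (gramBasis i)) * eval q (pderiv k (gramBasis j)) := fun j => by
        rw [Finset.sum_mul]
        exact Finset.sum_congr rfl fun i _ => by ring
      simp [a2, h2]
    rw [this]; simp
  funext i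
  simpa using congrFun hz i

lemma finrank_faceDir_cases (f : MvPolynomial (Fin 3) ℝ) (hsm : IsSmooth f)
    (G : Matrix (Fin 6) (Fin 6) ℝ) (hs : Gᵀ = G) (hf : gramPoly G = f)
    (v : Fin 6 → ℝ) (hv : v ≠ 0) (hGv : G *ᵥ v = 0) :
    Module.finrank ℝ (faceDir v) = 0 ∨ Module.finrank ℝ (faceDir v) = 2 := by
  rw [finrank_faceDir]
  obtain ⟨Q, d, hQ, hN⟩ := real_spectral (symN v) (by
    ext i j; fin_cases i <;> fin_cases j <;> rfl)
  have key : ∀ k, (∀ i, i ≠ k → d i = 0) → False := by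
    intro k hk
    have hent : ∀ i j, symN v i j = d k * (Q i k * Q j k) := by
      intro i j
      rw [hN]
      rw [mul_apply]
      simp only [mul_diagonal, transpose_apply]
      rw [Finset.sum_eq_single k]
      · ring
      · intro b _ hb; rw [hk b hb]; ring
      · simp
    have hv' : v = d k • (fun i => eval (fun i => Q i k) (gramBasis i)) := by
      have e0 := hent 0 0
      have e1 := hent 1 1
      have e2 := hent 2 2
      have e3 := hent 0 1
      have e4 := hent 0 2
      have e5 := hent 1 2
      simp [symN] at e0 e1 e2 e3 e4 e5
      funext i
      fin_cases i <;> simp only [gramBasis] <;> simp <;> linarith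
    have hd : d k ≠ 0 := by
      rintro h0
      rw [h0, zero_smul] at hv'
      exact hv hv'
    refine singular_of_veronese f hsm G hs hf (fun i => Q i k) ?_ ?_
    · intro h0
      have hQ' : Qᵀ * Q = 1 := mul_eq_one_comm.mp hQ
      have := congrFun (congrFun hQ' k) k
      simp only [mul_apply, transpose_apply, one_apply_eq] at this
      have h1 : ∀ i, Q i k = 0 := fun i => congrFun h0 i
      simp [h1] at this
    · rw [hv', mulVec_smul] at hGv
      exact (smul_eq_zero.mp hGv).resolve_left hd
  rw [hN, finrank_crossKer_congr Q Qᵀ _ hQ]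
  apply finrank_crossKer_diag
  rintro i j hij ⟨h1, h2⟩
  have : ∃ k, ∀ l, l ≠ k → l = i ∨ l = j := by
    clear * - hij
    revert i j; decide
  obtain ⟨k, hk⟩ := this
  exact key k fun l hl => by rcases hk l hl with rfl | rfl <;> assumption

/-- Perturbation inside the psd cone along directions killing the kernel. -/
lemma psd_perturb {n : Type*} [Fintype n] [DecidableEq n] (G A : Matrix n n ℝ)
    (hG : G.PosSemidef) (hA : Aᵀ = A) (hk : ∀ x, G *ᵥ x = 0 → A *ᵥ x = 0) :
    ∃ ε : ℝ, 0 < ε ∧ ∀ s : ℝ, |s| ≤ ε → (G + s • A).PosSemidef := by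
  have hGt : Gᵀ = G := by
    have := hG.1
    rwa [IsHermitian, conjTranspose_eq_transpose_of_trivial] at this
  obtain ⟨Q, d, hQ, hD⟩ := real_spectral G hGt
  have hQ' : Qᵀ * Q = 1 := mul_eq_one_comm.mp hQ
  have hD' : Qᵀ * G * Q = diagonal d := by
    rw [hD]
    calc _ = (Qᵀ * Q) * diagonal d * (Qᵀ * Q) := by simp only [mul_assoc]
      _ = _ := by rw [hQ']; simp
  set A' := Qᵀ * A * Q with hA'
  have hA't : A'ᵀ = A' := by rw [hA']; simp [transpose_mul, hA, mul_assoc]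
  have hAA : A = Q * A' * Qᵀ := by
    rw [hA']
    calc A = (Q * Qᵀ) * A * (Q * Qᵀ) := by rw [hQ]; simp
      _ = _ := by simp only [mul_assoc]
  have hd : ∀ i, 0 ≤ d i := by
    have : (diagonal d).PosSemidef := by
      rw [← hD']
      have := hG.conjTranspose_mul_mul_same Q
      rwa [conjTranspose_eq_transpose_of_trivial] at this
    exact posSemidef_diagonal_iff.mp this
  have hz : ∀ j, d j = 0 → ∀ i, A' i j = 0 := by
    intro j hj i
    have h1 : G *ᵥ (Q *ᵥ Pi.single j 1) = 0 := by
      rw [mulVec_mulVec, hD, mul_assoc, hQ', mul_one, ← mulVec_mulVec]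
      have : diagonal d *ᵥ Pi.single j 1 = 0 := by
        rw [mulVec_single_one]
        funext l
        by_cases hl : l = j
        · subst hl; simp [hj]
        · simp [diagonal_apply_ne _ hl]
      rw [this, mulVec_zero]
    have h2 := hk _ h1
    have h3 : A' *ᵥ Pi.single j 1 = 0 := by
      rw [hA', ← mulVec_mulVec, ← mulVec_mulVec, h2, mulVec_zero]
    have := congrFun h3 i
    simpa using this
  set κ := ∑ k, (d k)⁻¹ with hκ
  have hκ0 : 0 ≤ κ := Finset.sum_nonneg fun k _ => inv_nonneg.mpr (hd k)
  set M := ∑ i, ∑ j, |A' i j| with hM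
  have hM0 : 0 ≤ M := Finset.sum_nonneg fun i _ => Finset.sum_nonneg fun j _ => abs_nonneg _
  have hb : ∀ y : n → ℝ, |y ⬝ᵥ (A' *ᵥ y)| ≤ M * κ * ∑ k, d k * y k ^ 2 := by
    intro y
    set T := ∑ k, d k * y k ^ 2 with hT
    have hsing : ∀ i, d i ≠ 0 → y i ^ 2 ≤ κ * T := by
      intro i hi
      have hp : 0 < d i := lt_of_le_of_ne (hd i) (Ne.symm hi)
      have t1 : (d i)⁻¹ ≤ κ := Finset.single_le_sum (f := fun k => (d k)⁻¹)
        (fun k _ => inv_nonneg.mpr (hd k)) (Finset.mem_univ i)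
      have t2 : d i * y i ^ 2 ≤ T := Finset.single_le_sum (f := fun k => d k * y k ^ 2)
        (fun k _ => mul_nonneg (hd k) (sq_nonneg _)) (Finset.mem_univ i)
      calc y i ^ 2 = (d i)⁻¹ * (d i * y i ^ 2) := by field_simp
        _ ≤ κ * T := mul_le_mul t1 t2 (mul_nonneg (hd i) (sq_nonneg _)) hκ0
    have hterm : ∀ i j, |y i * (A' i j * y j)| ≤ |A' i j| * (κ * T) := by
      intro i j
      by_cases h1 : d j = 0
      · simp [hz j h1 i]
      by_cases h2 : d i = 0
      · have : A' i j = 0 := by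
          have := hz i h2 j
          rw [← hA't]; exact this
        simp [this]
      have a1 := hsing i h2
      have a2 := hsing j h1
      have a3 : |y i * y j| ≤ κ * T := by
        rw [abs_le]; constructor <;> nlinarith [sq_nonneg (y i + y j), sq_nonneg (y i - y j)]
      calc |y i * (A' i j * y j)| = |A' i j| * |y i * y j| := by rw [← abs_mul]; ring_nf
        _ ≤ _ := mul_le_mul_of_nonneg_left a3 (abs_nonneg _)
    calc |y ⬝ᵥ (A' *ᵥ y)| = |∑ i, ∑ j, y i * (A' i j * y j)| := by
          simp [dotProduct, mulVec, Finset.mul_sum]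
      _ ≤ ∑ i, ∑ j, |y i * (A' i j * y j)| :=
          (Finset.abs_sum_le_sum_abs _ _).trans
            (Finset.sum_le_sum fun i _ => Finset.abs_sum_le_sum_abs _ _)
      _ ≤ ∑ i, ∑ j, |A' i j| * (κ * T) :=
          Finset.sum_le_sum fun i _ => Finset.sum_le_sum fun j _ => hterm i j
      _ = M * κ * T := by simp only [← Finset.sum_mul, hM]; ring
  have hMk : 0 ≤ M * κ := mul_nonneg hM0 hκ0
  refine ⟨1 / (M * κ + 1), by positivity, ?_⟩
  intro s hs
  have hpsd : (diagonal d + s • A').PosSemidef := by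
    refine PosSemidef.of_dotProduct_mulVec_nonneg ?_ ?_
    · rw [IsHermitian, conjTranspose_eq_transpose_of_trivial, transpose_add, transpose_smul,
        diagonal_transpose, hA't]
    · intro y
      have e : star y ⬝ᵥ ((diagonal d + s • A') *ᵥ y)
          = ∑ k, d k * y k ^ 2 + s * (y ⬝ᵥ (A' *ᵥ y)) := by
        rw [add_mulVec, smul_mulVec, dotProduct_add, dotProduct_smul, smul_eq_mul]
        congr 1
        simp only [dotProduct, mulVec_diagonal]
        exact Finset.sum_congr rfl fun i _ => by simp; ring
      rw [e]
      set T := ∑ k, d k * y k ^ 2 with hT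
      have hT0 : 0 ≤ T := Finset.sum_nonneg fun k _ => mul_nonneg (hd k) (sq_nonneg _)
      have h1 : |s * (y ⬝ᵥ (A' *ᵥ y))| ≤ T := by
        rw [abs_mul]
        calc |s| * |y ⬝ᵥ (A' *ᵥ y)| ≤ 1 / (M * κ + 1) * (M * κ * T) :=
              mul_le_mul hs (hb y) (abs_nonneg _) (by positivity)
          _ = (M * κ) / (M * κ + 1) * T := by ring
          _ ≤ 1 * T := by
              apply mul_le_mul_of_nonneg_right _ hT0
              rw [div_le_one (by positivity)]; linarith
          _ = T := one_mul T
      linarith [(abs_le.mp h1).1]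
  have := hpsd.mul_mul_conjTranspose_same Q
  rw [conjTranspose_eq_transpose_of_trivial, mul_add, add_mul, ← hD, mul_smul_comm, smul_mul_assoc,
    ← hAA] at this
  exact this

/-- On the Gram spectrahedron of a smooth psd ternary quartic, the supporting face
of any rank-5 Gram matrix has dimension 0 or 2. -/
theorem rank_five_face_dim_zero_or_two
    (f : MvPolynomial (Fin 3) ℝ) (hhom : f.IsHomogeneous 4)
    (hsm : IsSmooth f) (hpsd : IsPsd f)
    (G : Matrix (Fin 6) (Fin 6) ℝ) (hG : G ∈ GramSpectrahedron f)
    (hrk : G.rank = 5)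
    (F : Set (Matrix (Fin 6) (Fin 6) ℝ))
    (hF : IsFace (GramSpectrahedron f) F)
    (hGF : G ∈ intrinsicInterior ℝ F) :
    Module.finrank ℝ (vectorSpan ℝ F) = 0 ∨
      Module.finrank ℝ (vectorSpan ℝ F) = 2 := by

  have hps : G.PosSemidef := hG.1
  have hgf : gramPoly G = f := hG.2
  have hs : Gᵀ = G := by
    have := hps.1
    rwa [IsHermitian, conjTranspose_eq_transpose_of_trivial] at this
  have hker : Module.finrank ℝ (LinearMap.ker G.mulVecLin) = 1 := by
    have h1 := G.mulVecLin.finrank_range_add_finrank_ker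
    have h2 : Module.finrank ℝ (LinearMap.range G.mulVecLin) = 5 := hrk
    rw [h2] at h1
    simp at h1
    omega
  obtain ⟨⟨v, hvk⟩, hv0, hvs⟩ := finrank_eq_one_iff'.mp hker
  have hGv : G *ᵥ v = 0 := by simpa using hvk
  have hv : v ≠ 0 := fun h => hv0 (Subtype.ext h)
  have hspan : ∀ x, G *ᵥ x = 0 → ∃ c : ℝ, c • v = x := by
    intro x hx
    obtain ⟨c, hc⟩ := hvs ⟨x, by simpa using hx⟩
    exact ⟨c, congrArg Subtype.val hc⟩
  have hGm : G ∈ F := intrinsicInterior_subset hGF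
  have hmain : vectorSpan ℝ F = faceDir v := by
    apply le_antisymm
    · rw [vectorSpan_eq_span_vsub_set_right ℝ hGm, Submodule.span_le]
      rintro _ ⟨H, hH, rfl⟩
      have hHS := hF.1 hH
      have hHs : Hᵀ = H := by
        have := hHS.1.1
        rwa [IsHermitian, conjTranspose_eq_transpose_of_trivial] at this
      have hHf : gramPoly H = f := hHS.2
      have hHv : H *ᵥ v = 0 := by
        obtain ⟨y, hy, hyG⟩ := mem_intrinsicInterior.mp hGF
        let φ : ℝ → affineSpan ℝ F := fun t =>
          ⟨AffineMap.lineMap G H (-t), AffineMap.lineMap_mem _ (subset_affineSpan ℝ F hGm)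
            (subset_affineSpan ℝ F hH)⟩
        have hφ : Continuous φ := by
          apply Continuous.subtype_mk
          simp only [AffineMap.lineMap_apply_module]
          fun_prop
        have hφ0 : φ 0 = y := by
          apply Subtype.ext
          simp [φ, hyG]
        have hn : φ ⁻¹' ((↑) ⁻¹' F : Set (affineSpan ℝ F)) ∈ nhds (0 : ℝ) := by
          apply hφ.continuousAt
          rw [hφ0]
          exact mem_interior_iff_mem_nhds.mp hy
        obtain ⟨δ, hδ, hball⟩ := Metric.mem_nhds_iff.mp hn
        have hmem : φ (δ / 2) ∈ ((↑) ⁻¹' F : Set (affineSpan ℝ F)) := by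
          apply hball
          rw [Metric.mem_ball, dist_zero_right, Real.norm_eq_abs, abs_of_pos (by linarith)]
          linarith
        have hpp := (hF.1 hmem).1.dotProduct_mulVec_nonneg v
        have hnn := hHS.1.dotProduct_mulVec_nonneg v
        simp only [φ, AffineMap.lineMap_apply_module, add_mulVec, smul_mulVec, hGv, smul_zero,
          zero_add, dotProduct_smul, smul_eq_mul] at hpp
        rw [← hHS.1.dotProduct_mulVec_zero_iff]
        nlinarith
      refine ⟨?_, ?_, ?_⟩
      · simp [hHs, hs]
      · have : (H -ᵥ G : Matrix (Fin 6) (Fin 6) ℝ) = H + (-1 : ℝ) • G := by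
          simp [sub_eq_add_neg]
        change gramPoly (H -ᵥ G) = 0
        rw [this, gramPoly_add, gramPoly_smul, hHf, hgf]
        simp
      · change (H - G) *ᵥ v = 0
        rw [sub_mulVec, hHv, hGv, sub_zero]
    · rintro A ⟨hAs, hA0, hAv⟩
      obtain ⟨ε, hε, hper⟩ := psd_perturb G A hps hAs (by
        intro x hx
        obtain ⟨c, rfl⟩ := hspan x hx
        rw [mulVec_smul, hAv, smul_zero])
      have hmem : ∀ s : ℝ, |s| ≤ ε → G + s • A ∈ GramSpectrahedron f := by
        intro s hs
        refine ⟨hper s hs, ?_⟩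
        change gramPoly _ = f
        rw [gramPoly_add, gramPoly_smul, hA0, hgf, mul_zero, add_zero]
      have h1 := hmem ε (by rw [abs_of_pos hε])
      have h2 := hmem (-ε) (by rw [abs_neg, abs_of_pos hε])
      have h3 := (hF.2.2 _ h1 _ h2 (1/2) (by norm_num) (by norm_num) (by
        have : (1/2 : ℝ) • (G + ε • A) + (1 - 1/2 : ℝ) • (G + (-ε) • A) = G := by
          module
        rw [this]; exact hGm)).1
      have h4 := vsub_mem_vectorSpan ℝ h3 hGm
      have h5 : (G + ε • A) -ᵥ G = ε • A := by simp
      rw [h5] at h4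
      have := Submodule.smul_mem _ ε⁻¹ h4
      rwa [smul_smul, inv_mul_cancel₀ hε.ne', one_smul] at this
  rw [hmain]
  exact finrank_faceDir_cases f hsm G hs hgf v hv hGv
end
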